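/- Let n ≥ 2 be an integer and p, q > 0 real. There exists a proper holomorphic mapping f : 𝔼_{p,n} → 𝔼_{q,n} if and only if p/q is a positive integer. -/

import Mathlib

open Finset

/-- The symmetrization map `π_n : ℂⁿ → ℂⁿ`, whose `k`-th component is the
`(k+1)`-st elementary symmetric polynomial of the coordinates. -/
noncomputable def piMap (n : ℕ) (z : Fin n → ℂ) : Fin n → ℂ :=
  fun k => ∑ s ∈ Finset.powersetCard (k.1 + 1) Finset.univ, ∏ j ∈ s, z j

/-- The generalized complex ellipsoid `𝔹_{p,n} = {z : ∑ |z_j|^(2p) < 1}`. -/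
noncomputable def ellipsoid (p : ℝ) (n : ℕ) : Set (Fin n → ℂ) :=
  {z | ∑ j, ‖z j‖ ^ (2 * p) < 1}

/-- The symmetrized `(p,n)`-ellipsoid `𝔼_{p,n} = π_n(𝔹_{p,n})`. -/
noncomputable def symEllipsoid (p : ℝ) (n : ℕ) : Set (Fin n → ℂ) :=
  piMap n '' ellipsoid p n

/-- The Euclidean unit ball in `ℂⁿ`. -/
def unitBall (n : ℕ) : Set (Fin n → ℂ) :=
  {z | ∑ j, ‖z j‖ ^ 2 < 1}

/-- `f` is a proper holomorphic map from the domain `D` onto (into) the domain `G`: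
it is holomorphic on `D`, maps `D` into `G`, and preimages of compact subsets of `G`
are compact. -/
def IsProperHolomorphic {n : ℕ} (f : (Fin n → ℂ) → (Fin n → ℂ))
    (D G : Set (Fin n → ℂ)) : Prop :=
  DifferentiableOn ℂ f D ∧ Set.MapsTo f D G ∧
    ∀ K : Set (Fin n → ℂ), K ⊆ G → IsCompact K → IsCompact (D ∩ f ⁻¹' K)

/-- `φ` is an automorphism of the domain `D`: a holomorphic bijection of `D` onto
itself with holomorphic inverse. -/
def IsAutomorphismOf {n : ℕ} (φ : (Fin n → ℂ) → (Fin n → ℂ))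
    (D : Set (Fin n → ℂ)) : Prop :=
  DifferentiableOn ℂ φ D ∧ Set.BijOn φ D D ∧
    ∃ ψ : (Fin n → ℂ) → (Fin n → ℂ), DifferentiableOn ℂ ψ D ∧ Set.InvOn ψ φ D D

/-- `f : ℂⁿ → ℂⁿ` is a polynomial mapping. -/
def IsPolynomialMap {n : ℕ} (f : (Fin n → ℂ) → (Fin n → ℂ)) : Prop :=
  ∃ P : Fin n → MvPolynomial (Fin n) ℂ, ∀ z k, f z k = MvPolynomial.eval z (P k)


namespace SymEll

open Set Filter Topology MeasureTheory Metric

section P0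
variable {E G : Type} [NormedAddCommGroup E] [NormedSpace ℂ E]
  [NormedAddCommGroup G] [NormedSpace ℂ G]

lemma norm_fderiv_le_of_bound [CompleteSpace G] {f : E → G} {z : E} {r M : ℝ} (hr : 0 < r)
    (hf : DifferentiableOn ℂ f (ball z (2 * r))) (hM : ∀ w ∈ ball z (2 * r), ‖f w‖ ≤ M) :
    ‖fderiv ℂ f z‖ ≤ M / r := by
  have hM0 : 0 ≤ M := (norm_nonneg _).trans (hM z (mem_ball_self (by positivity)))
  refine ContinuousLinearMap.opNorm_le_bound _ (by positivity) fun v => ?_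
  by_cases hv : v = 0
  · simp [hv]
  have hv0 : 0 < ‖v‖ := norm_pos_iff.2 hv
  have hmem : ∀ t : ℂ, ‖t‖ ≤ r / ‖v‖ → z + t • v ∈ ball z (2 * r) := by
    intro t ht
    rw [mem_ball_iff_norm, add_sub_cancel_left, norm_smul]
    rw [le_div_iff₀ hv0] at ht
    linarith
  have hdiff : ∀ t : ℂ, ‖t‖ ≤ r / ‖v‖ → HasDerivAt (fun t : ℂ => f (z + t • v))
      (fderiv ℂ f (z + t • v) v) t := by
    intro t ht
    have h1 : HasFDerivAt f (fderiv ℂ f (z + t • v)) (z + t • v) :=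
      ((hf _ (hmem t ht)).differentiableAt (isOpen_ball.mem_nhds (hmem t ht))).hasFDerivAt
    have h2 : HasDerivAt (fun t : ℂ => z + t • v) v t := by
      simpa using ((hasDerivAt_id t).smul_const v).const_add z
    exact h1.comp_hasDerivAt t h2
  have key := Complex.norm_deriv_le_of_forall_mem_sphere_norm_le (c := 0) (R := r / ‖v‖)
    (f := fun t : ℂ => f (z + t • v)) (C := M) (by positivity) ?_ ?_
  · rw [(hdiff 0 (by simp; positivity)).deriv] at key
    simp only [zero_smul, add_zero] at key
    calc _ ≤ M / (r / ‖v‖) := key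
      _ = _ := by field_simp
  · refine DifferentiableOn.diffContOnCl ?_
    rw [closure_ball _ (by positivity)]
    intro t ht
    exact (hdiff t (by simpa using ht)).differentiableAt.differentiableWithinAt
  · intro t ht
    exact hM _ (hmem t (by simpa using (mem_sphere_zero_iff_norm.1 ht).le))

lemma differentiableOn_fderiv_apply [FiniteDimensional ℂ E] [FiniteDimensional ℂ G]
    {f : E → G} {U : Set E} (hU : IsOpen U)
    (hf : DifferentiableOn ℂ f U) (v : E) : DifferentiableOn ℂ (fun z => fderiv ℂ f z v) U := by
  haveI : CompleteSpace G := FiniteDimensional.complete ℂ G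
  haveI : CompleteSpace E := FiniteDimensional.complete ℂ E
  haveI : ProperSpace E := FiniteDimensional.proper ℂ E
  haveI : ProperSpace G := FiniteDimensional.proper ℂ G
  intro z0 hz0
  refine DifferentiableAt.differentiableWithinAt ?_
  -- closed ball of radius 4 r in U
  obtain ⟨r, hr, hrU⟩ : ∃ r > 0, closedBall z0 (4 * r) ⊆ U := by
    obtain ⟨e, he, h⟩ := Metric.nhds_basis_closedBall.mem_iff.1 (hU.mem_nhds hz0)
    exact ⟨e / 4, by positivity, by convert h using 2; ring⟩
  obtain ⟨M, hM⟩ := (isCompact_closedBall z0 (4 * r)).exists_bound_of_continuousOn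
    (hf.continuousOn.mono hrU)
  have hfat : ∀ w ∈ ball z0 (4 * r), DifferentiableAt ℂ f w := fun w hw =>
    (hf w (hrU (ball_subset_closedBall hw))).differentiableAt
      (hU.mem_nhds (hrU (ball_subset_closedBall hw)))
  have hbd : ∀ w ∈ ball z0 (2 * r), ‖fderiv ℂ f w‖ ≤ M / r := by
    intro w hw
    have hsub : ball w (2 * r) ⊆ ball z0 (4 * r) := by
      refine ball_subset_ball' ?_
      have := mem_ball.1 hw
      linarith
    exact norm_fderiv_le_of_bound hr (fun x hx => (hfat x (hsub hx)).differentiableWithinAt)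
      (fun x hx => hM x (ball_subset_closedBall (hsub hx)))
  set ε : ℝ := r / (‖v‖ + 1) with hε
  have hv1 : 0 < ‖v‖ + 1 := by positivity
  have hε0 : 0 < ε := by positivity
  have hmem : ∀ z ∈ ball z0 r, ∀ t : ℂ, ‖t‖ ≤ ε → z + t • v ∈ ball z0 (2 * r) := by
    intro z hz t ht
    rw [mem_ball_iff_norm] at hz ⊢
    have h1 : ‖t • v‖ ≤ r := by
      rw [norm_smul]
      calc ‖t‖ * ‖v‖ ≤ ε * (‖v‖ + 1) := by gcongr; linarith
        _ = r := by rw [hε]; field_simp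
    calc ‖z + t • v - z0‖ = ‖(z - z0) + t • v‖ := by congr 1; abel
      _ ≤ ‖z - z0‖ + ‖t • v‖ := norm_add_le _ _
      _ < _ := by linarith
  have h24 : ball z0 (2 * r) ⊆ ball z0 (4 * r) := ball_subset_ball (by linarith)
  have hdiff : ∀ z ∈ ball z0 r, ∀ t : ℂ, ‖t‖ ≤ ε → HasDerivAt (fun t : ℂ => f (z + t • v))
      (fderiv ℂ f (z + t • v) v) t := by
    intro z hz t ht
    have h1 : HasFDerivAt f (fderiv ℂ f (z + t • v)) (z + t • v) :=
      (hfat _ (h24 (hmem z hz t ht))).hasFDerivAt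
    have h2 : HasDerivAt (fun t : ℂ => z + t • v) v t := by
      simpa using ((hasDerivAt_id t).smul_const v).const_add z
    exact h1.comp_hasDerivAt t h2
  let I : E → G := fun z => ∮ t in C(0, ε), (t - 0) ^ (-2 : ℤ) • f (z + t • v)
  have hI : ∀ z ∈ ball z0 r, fderiv ℂ f z v = (2 * Real.pi * Complex.I : ℂ)⁻¹ • I z := by
    intro z hz
    have key : DiffContOnCl ℂ (fun t : ℂ => f (z + t • v)) (ball 0 ε) := by
      refine DifferentiableOn.diffContOnCl ?_
      rw [closure_ball _ hε0.ne']
      intro t ht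
      exact (hdiff z hz t (by simpa using ht)).differentiableAt.differentiableWithinAt
    have := key.deriv_eq_smul_circleIntegral hε0
    rw [(hdiff z hz 0 (by simp; positivity)).deriv] at this
    have h2 : (2 * Real.pi * Complex.I : ℂ) ≠ 0 := by simp [Real.pi_ne_zero]
    rw [eq_inv_smul_iff₀ h2]
    simp only [zero_smul, add_zero] at this
    rw [← this]
    simp [I, zpow_neg]
  have hcirc : ∀ θ : ℝ, ‖circleMap 0 ε θ‖ ≤ ε := fun θ => by simp [abs_of_pos hε0]
  have hID : DifferentiableAt ℂ I z0 := by
    have hμ : ∀ z ∈ ball z0 r, Continuous fun θ : ℝ => f (z + circleMap 0 ε θ • v) := by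
      intro z hz
      rw [continuous_iff_continuousAt]
      intro θ
      have h1 : ContinuousAt f (z + circleMap 0 ε θ • v) :=
        (hfat _ (h24 (hmem z hz _ (hcirc θ)))).continuousAt
      refine ContinuousAt.comp (f := fun θ : ℝ => z + circleMap 0 ε θ • v) h1 ?_
      have := continuous_circleMap 0 ε
      fun_prop
    have hc2 : Continuous fun θ : ℝ => deriv (circleMap 0 ε) θ • ((circleMap 0 ε θ - 0) ^ (-2 : ℤ)) := by
      have h1 := continuous_circleMap 0 ε
      simp only [deriv_circleMap]
      refine Continuous.smul (h1.mul continuous_const) ?_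
      refine Continuous.zpow₀ (by fun_prop) _ (fun θ => Or.inl ?_)
      simpa using hε0.ne'
    let c : ℝ → ℂ := fun θ => deriv (circleMap 0 ε) θ • ((circleMap 0 ε θ - 0) ^ (-2 : ℤ))
    have hcn : ∀ θ, ‖c θ‖ ≤ ε⁻¹ := by
      intro θ
      simp only [c, norm_smul, deriv_circleMap, norm_mul, sub_zero, norm_circleMap_zero, Complex.norm_I, mul_one, abs_of_pos hε0, zpow_neg, norm_inv]
      rw [show (2 : ℤ) = ((2 : ℕ) : ℤ) from rfl, zpow_natCast, norm_pow, norm_circleMap_zero, abs_of_pos hε0]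
      apply le_of_eq
      field_simp
    have hIeq : I = fun z => ∫ θ in (0:ℝ)..2 * Real.pi, c θ • f (z + circleMap 0 ε θ • v) := by
      funext z
      simp only [I, circleIntegral, c, smul_assoc]
    rw [hIeq]
    simp only [intervalIntegral.integral_of_le (Real.two_pi_pos.le)]
    borelize E
    borelize (E →L[ℂ] G)
    haveI : FiniteDimensional ℝ E := FiniteDimensional.complexToReal E
    haveI : FiniteDimensional ℝ (E →L[ℂ] G) := FiniteDimensional.complexToReal _
    haveI : SecondCountableTopology (E →L[ℂ] G) := by
      haveI := FiniteDimensional.proper ℝ (E →L[ℂ] G)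
      infer_instance
    refine (hasFDerivAt_integral_of_dominated_of_fderiv_le
      (F' := fun z θ => c θ • fderiv ℂ f (z + circleMap 0 ε θ • v))
      (bound := fun _ => ε⁻¹ * (M / r)) (ball_mem_nhds z0 hr) ?_ ?_ ?_ ?_ ?_ ?_).differentiableAt
    · filter_upwards [ball_mem_nhds z0 hr] with z hz
      exact (hc2.smul (hμ z hz)).aestronglyMeasurable
    · exact ((hc2.smul (hμ z0 (mem_ball_self hr))).integrableOn_Icc (a := 0) (b := 2 * Real.pi)).mono_set Ioc_subset_Icc_self
    · refine AEStronglyMeasurable.smul hc2.aestronglyMeasurable ?_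
      have hm := measurable_fderiv ℂ f
      refine (Measurable.comp hm ?_).aestronglyMeasurable
      have := continuous_circleMap 0 ε
      exact Continuous.measurable (by fun_prop)
    · refine Eventually.of_forall fun θ z hz => ?_
      rw [norm_smul]
      gcongr
      · exact hcn θ
      · exact hbd _ (hmem z hz _ (hcirc θ))
    · exact integrable_const _
    · refine Eventually.of_forall fun θ z hz => ?_
      have h1 : HasFDerivAt f (fderiv ℂ f (z + circleMap 0 ε θ • v)) (z + circleMap 0 ε θ • v) :=
        (hfat _ (h24 (hmem z hz _ (hcirc θ)))).hasFDerivAt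
      have h2 : HasFDerivAt (fun z => f (z + circleMap 0 ε θ • v)) (fderiv ℂ f (z + circleMap 0 ε θ • v)) z := by
        have := h1.comp z ((hasFDerivAt_id z).add_const (circleMap 0 ε θ • v))
        rwa [ContinuousLinearMap.comp_id] at this
      exact h2.const_smul (c θ)
  have := hID.const_smul ((2 * Real.pi * Complex.I : ℂ)⁻¹)
  refine this.congr_of_eventuallyEq ?_
  filter_upwards [ball_mem_nhds z0 hr] with z hz using hI z hz

lemma differentiableOn_fderiv [FiniteDimensional ℂ E] [FiniteDimensional ℂ G]
    {f : E → G} {U : Set E} (hU : IsOpen U)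
    (hf : DifferentiableOn ℂ f U) : DifferentiableOn ℂ (fderiv ℂ f) U := by
  let b := Module.finBasis ℂ E
  have hdec : ∀ z, fderiv ℂ f z = ∑ i, ContinuousLinearMap.smulRight
      (LinearMap.toContinuousLinearMap (b.coord i)) (fderiv ℂ f z (b i)) := by
    intro z
    ext v
    conv_lhs => rw [← b.sum_repr v]
    simp [-Module.Basis.sum_repr, map_sum]
  rw [show fderiv ℂ f = fun z => ∑ i, ContinuousLinearMap.smulRight
      (LinearMap.toContinuousLinearMap (b.coord i)) (fderiv ℂ f z (b i)) from funext hdec]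
  refine DifferentiableOn.fun_sum fun i _ => ?_
  have := differentiableOn_fderiv_apply hU hf (b i)
  exact ((ContinuousLinearMap.smulRightL ℂ E G
    (LinearMap.toContinuousLinearMap (b.coord i))).differentiable.comp_differentiableOn this)

lemma contDiffOn_nat {E : Type} [NormedAddCommGroup E] [NormedSpace ℂ E] [FiniteDimensional ℂ E] (m : ℕ) :
    ∀ {G : Type} [NormedAddCommGroup G] [NormedSpace ℂ G] [FiniteDimensional ℂ G]
    {f : E → G} {U : Set E} (_ : IsOpen U)
    (_ : DifferentiableOn ℂ f U), ContDiffOn ℂ m f U := by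
  induction m with
  | zero => intro G _ _ _ f U hU hf; exact contDiffOn_zero.2 hf.continuousOn
  | succ m ih =>
    intro G _ _ _ f U hU hf
    push_cast
    rw [contDiffOn_succ_iff_fderiv_of_isOpen hU]
    exact ⟨hf, by simp, ih hU (differentiableOn_fderiv hU hf)⟩

end P0
end SymEll

namespace SymEll
open Set Filter Topology MeasureTheory Metric

/-- identity theorem on convex open sets, along complex lines -/
lemma eqOn_zero_of_convex {E G : Type} [NormedAddCommGroup E] [NormedSpace ℂ E]
    [NormedAddCommGroup G] [NormedSpace ℂ G] [CompleteSpace G]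
    {f : E → G} {U : Set E} (hU : IsOpen U) (hc : Convex ℝ U) (hf : DifferentiableOn ℂ f U)
    {z₀ : E} (h₀ : z₀ ∈ U) (hz : ∀ᶠ z in 𝓝 z₀, f z = 0) : ∀ z ∈ U, f z = 0 := by
  intro z hzU
  let L : ℂ → E := fun t => z₀ + t • (z - z₀)
  have hLd : Differentiable ℂ L := by
    intro t; exact ((differentiableAt_id.smul_const _).const_add _)
  have hV : IsOpen (L ⁻¹' U) := hU.preimage hLd.continuous
  have hVc : Convex ℝ (L ⁻¹' U) := by
    intro a ha b hb s t hs ht hst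
    have := hc ha hb hs ht hst
    have h2 : L (s • a + t • b) = s • L a + t • L b := by
      simp only [L, smul_add, add_smul, smul_assoc]
      have : z₀ = s • z₀ + t • z₀ := by rw [← add_smul, hst, one_smul]
      nth_rewrite 1 [this]
      abel
    rw [Set.mem_preimage, h2]; exact this
  have hg : DifferentiableOn ℂ (f ∘ L) (L ⁻¹' U) :=
    hf.comp hLd.differentiableOn (fun t ht => ht)
  have h0 : (0 : ℂ) ∈ L ⁻¹' U := by simpa [L] using h₀
  have h1 : (1 : ℂ) ∈ L ⁻¹' U := by simpa [L] using hzU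
  have := (hg.analyticOnNhd hV).eqOn_zero_of_preconnected_of_eventuallyEq_zero
    hVc.isPreconnected h0 ?_ h1
  · simpa [L] using this
  · have hL0 : Tendsto L (𝓝 0) (𝓝 z₀) := by
      have := hLd.continuous.tendsto 0
      simpa [L] using this
    exact hL0.eventually hz

variable {n : ℕ}

lemma prod_add_eq (z : Fin n → ℂ) (T : ℂ) :
    ∏ j, (T + z j) = T ^ n + ∑ k : Fin n, piMap n z k * T ^ (n - 1 - k.1) := by
  have h1 : ∏ j, (T + z j) = ∑ s ∈ (Finset.univ : Finset (Fin n)).powerset,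
      (∏ j ∈ s, z j) * T ^ (n - s.card) := by
    simp_rw [add_comm T]
    rw [Finset.prod_add]
    refine Finset.sum_congr rfl fun s hs => ?_
    rw [Finset.prod_const, Finset.card_sdiff_of_subset (Finset.mem_powerset.1 hs)]
    simp
  rw [h1, Finset.sum_powerset_apply_card_aux z T]
where
  Finset.sum_powerset_apply_card_aux (z : Fin n → ℂ) (T : ℂ) :
      ∑ s ∈ (Finset.univ : Finset (Fin n)).powerset, (∏ j ∈ s, z j) * T ^ (n - s.card) =
      T ^ n + ∑ k : Fin n, piMap n z k * T ^ (n - 1 - k.1) := by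
    rw [Finset.sum_powerset]
    simp only [Finset.card_univ, Fintype.card_fin]
    rw [Finset.sum_range_succ', add_comm, Finset.sum_range]
    congr 1
    · simp
    · refine Finset.sum_congr rfl fun k _ => ?_
      rw [piMap, Finset.sum_mul]
      refine Finset.sum_congr rfl fun s hs => ?_
      rw [(Finset.mem_powersetCard.1 hs).2]
      congr 2
      omega

lemma piMap_eq_eval (z : Fin n → ℂ) (k : Fin n) :
    piMap n z k = MvPolynomial.eval z (MvPolynomial.esymm (Fin n) ℂ (k.1 + 1)) := by
  simp [piMap, MvPolynomial.esymm, map_sum, map_prod]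

lemma exists_poly_of_symmetric (P : MvPolynomial (Fin n) ℂ) (hP : P.IsSymmetric) :
    ∃ Q : MvPolynomial (Fin n) ℂ, ∀ z, MvPolynomial.eval z P = MvPolynomial.eval (piMap n z) Q := by
  obtain ⟨Q, hQ⟩ := MvPolynomial.esymmAlgHom_surjective (σ := Fin n) (n := n) (R := ℂ) (by simp)
    ⟨P, hP⟩
  refine ⟨Q, fun z => ?_⟩
  have h1 : P = MvPolynomial.aeval (fun i : Fin n => MvPolynomial.esymm (Fin n) ℂ (i.1 + 1)) Q := by
    have := congrArg Subtype.val hQ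
    rw [MvPolynomial.esymmAlgHom_apply] at this
    exact this.symm
  rw [h1, ← MvPolynomial.coe_aeval_eq_eval, ← MvPolynomial.coe_aeval_eq_eval, RingHom.coe_coe, RingHom.coe_coe]
  have := MvPolynomial.comp_aeval (fun i : Fin n => MvPolynomial.esymm (Fin n) ℂ (i.1 + 1))
    (MvPolynomial.aeval (R := ℂ) z)
  have h2 := DFunLike.congr_fun this Q
  simp only [AlgHom.comp_apply] at h2
  rw [h2]
  congr 2
  funext i
  simp [piMap_eq_eval, MvPolynomial.aeval_eq_eval]

lemma piMap_perm (z : Fin n → ℂ) (σ : Equiv.Perm (Fin n)) : piMap n (z ∘ σ) = piMap n z := by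
  funext k
  rw [piMap_eq_eval, piMap_eq_eval, ← MvPolynomial.eval_rename]
  rw [MvPolynomial.esymm_isSymmetric (Fin n) ℂ (k.1 + 1) σ]

open Polynomial in
lemma perm_of_piMap_eq {a b : Fin n → ℂ} (h : piMap n a = piMap n b) :
    ∃ σ : Equiv.Perm (Fin n), b = a ∘ σ := by
  have h1 : (Finset.univ.val.map (fun j => X - C (-a j)) : Multiset ℂ[X]).prod
      = (Finset.univ.val.map (fun j => X - C (-b j)) : Multiset ℂ[X]).prod := by
    change ∏ j, (X - C (-a j)) = ∏ j, (X - C (-b j))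
    apply Polynomial.funext
    intro T
    simp only [eval_prod, eval_sub, eval_X, eval_C, sub_neg_eq_add]
    rw [prod_add_eq, prod_add_eq, h]
  have h2 : ((Finset.univ.val.map fun j => -a j) : Multiset ℂ) = Finset.univ.val.map fun j => -b j := by
    have e : ∀ c : Fin n → ℂ, (Finset.univ.val.map (fun j => X - C (-c j)) : Multiset ℂ[X]) =
      (Finset.univ.val.map fun j => -c j).map (fun x => X - C x) := fun c => by
        rw [Multiset.map_map]; rfl
    rw [e a, e b] at h1
    have := congrArg Polynomial.roots h1
    rwa [Polynomial.roots_multiset_prod_X_sub_C, Polynomial.roots_multiset_prod_X_sub_C] at this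
  obtain ⟨σ, hσ⟩ : ∃ σ : Equiv.Perm (Fin n), (fun j => -b j) = (fun j => -a j) ∘ σ := by
    have e : ∀ x : ℂ, Nonempty ({j // -b j = x} ≃ {j // -a j = x}) := by
      intro x
      rw [← Fintype.card_eq, Fintype.card_subtype, Fintype.card_subtype]
      have h3 := congrArg (Multiset.count x) h2.symm
      rw [Multiset.count_map, Multiset.count_map] at h3
      simp only [eq_comm (a := x)] at h3
      exact h3
    let e' : ∀ x : ℂ, ({j // -b j = x} ≃ {j // -a j = x}) := fun x => (e x).some
    refine ⟨((Equiv.sigmaFiberEquiv (fun j => -b j)).symm.trans (Equiv.sigmaCongrRight e')).trans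
      (Equiv.sigmaFiberEquiv (fun j => -a j)), ?_⟩
    funext j
    exact ((e' (-b j)) ⟨j, rfl⟩).2.symm
  refine ⟨σ, ?_⟩
  funext j
  have := congrFun hσ j
  simpa using this

lemma exists_map_eq_multiset {n : ℕ} (s : Multiset ℂ) (hs : s.card = n) :
    ∃ z : Fin n → ℂ, Finset.univ.val.map z = s := by
  obtain ⟨l, rfl⟩ := Quot.exists_rep s
  have hl : l.length = n := hs
  subst hl
  refine ⟨l.get, ?_⟩
  rw [Fin.univ_val_map, List.ofFn_get]
  rfl

open Polynomial in
lemma piMap_surjective (w : Fin n → ℂ) : ∃ z, piMap n z = w := by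
  let P : ℂ[X] := X ^ n + ∑ k : Fin n, C (w k) * X ^ (n - 1 - k.1)
  have hdeg : (∑ k : Fin n, C (w k) * X ^ (n - 1 - k.1) : ℂ[X]).degree < n := by
    refine (Polynomial.degree_sum_le _ _).trans_lt ?_
    rw [Finset.sup_lt_iff (by exact_mod_cast WithBot.bot_lt_coe n)]
    intro k _
    refine (Polynomial.degree_C_mul_X_pow_le _ _).trans_lt ?_
    have := k.2
    exact_mod_cast (show n - 1 - k.1 < n by omega)
  have hm : P.Monic := Polynomial.monic_X_pow_add hdeg
  have hn : P.natDegree = n := by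
    rw [Polynomial.natDegree_eq_of_degree_eq_some]
    simp only [P]
    rw [Polynomial.degree_add_eq_left_of_degree_lt]
    · simp
    · simpa using hdeg
  have hs := IsAlgClosed.splits P
  have hcard : P.roots.card = n := by rw [← hn]; exact hs.natDegree_eq_card_roots.symm
  have hprod := hs.eq_prod_roots_of_monic hm
  obtain ⟨z0, hz0⟩ := exists_map_eq_multiset P.roots hcard
  let z : Fin n → ℂ := fun j => -z0 j
  refine ⟨z, ?_⟩
  have key : ∀ T : ℂ, ∏ j, (T + z j) = P.eval T := by
    intro T
    conv_rhs => rw [hprod, ← hz0, Multiset.map_map, eval_multiset_prod, Multiset.map_map]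
    refine Finset.prod_congr rfl fun j _ => ?_
    simp [z, sub_eq_add_neg]
  have h2 : (X ^ n + ∑ k : Fin n, C (piMap n z k) * X ^ (n - 1 - k.1) : ℂ[X]) = P := by
    apply Polynomial.funext
    intro T
    rw [← key, prod_add_eq]
    simp [eval_finset_sum]
  funext k
  have h3 := congrArg (fun Q : ℂ[X] => Q.coeff (n - 1 - k.1)) h2
  have hk : ∀ c : Fin n → ℂ, (X ^ n + ∑ k : Fin n, C (c k) * X ^ (n - 1 - k.1) : ℂ[X]).coeff (n - 1 - k.1) = c k := by
    intro c
    have hk2 := k.2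
    simp only [coeff_add, coeff_X_pow, finset_sum_coeff, coeff_C_mul]
    rw [if_neg (by omega), zero_add, Finset.sum_eq_single k]
    · simp
    · intro b _ hb
      have hb2 := b.2
      have : b.1 ≠ k.1 := fun h => hb (Fin.ext h)
      rw [if_neg (by omega), mul_zero]
    · simp
  simp only [P] at h3
  rw [hk, hk] at h3
  exact h3

lemma contDiff_piMap (m : WithTop ℕ∞) : ContDiff ℂ m (piMap n) := by
  rw [contDiff_pi]
  intro k
  unfold piMap
  refine ContDiff.sum fun s _ => ?_
  refine contDiff_prod fun j _ => ?_
  exact contDiff_apply ℂ ℂ j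

lemma differentiable_piMap : Differentiable ℂ (piMap n) :=
  (contDiff_piMap 1).differentiable (by norm_num)

lemma continuous_piMap : Continuous (piMap n) := differentiable_piMap.continuous

lemma norm_le_of_piMap (z : Fin n → ℂ) (j : Fin n) : ‖z j‖ ≤ 1 + ∑ k, ‖piMap n z k‖ := by
  have hS : 0 ≤ ∑ k, ‖piMap n z k‖ := Finset.sum_nonneg fun k _ => norm_nonneg _
  by_contra hcon
  push Not at hcon
  set S := ∑ k, ‖piMap n z k‖ with hSdef
  have ht : 1 < ‖z j‖ := by linarith
  have h0 : ∏ i, (-z j + z i) = 0 := Finset.prod_eq_zero (Finset.mem_univ j) (by simp)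
  rw [prod_add_eq] at h0
  have h1 : ‖z j‖ ^ n = ‖∑ k : Fin n, piMap n z k * (-z j) ^ (n - 1 - k.1)‖ := by
    rw [← norm_neg (z j), ← norm_pow, eq_neg_of_add_eq_zero_left h0, norm_neg]
  have h2 : ‖∑ k : Fin n, piMap n z k * (-z j) ^ (n - 1 - k.1)‖ ≤ S * ‖z j‖ ^ (n - 1) := by
    rw [hSdef, Finset.sum_mul]
    refine norm_sum_le_of_le _ fun k _ => ?_
    rw [norm_mul, norm_pow, norm_neg]
    exact mul_le_mul_of_nonneg_left (pow_le_pow_right₀ ht.le (by omega)) (norm_nonneg _)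
  have hn : n = (n - 1) + 1 := by have := j.2; omega
  have h3 : ‖z j‖ ^ n = ‖z j‖ * ‖z j‖ ^ (n - 1) := by
    conv_lhs => rw [hn, pow_succ, mul_comm]
  have h4 : 0 < ‖z j‖ ^ (n - 1) := by positivity
  have h5 : ‖z j‖ * ‖z j‖ ^ (n - 1) ≤ S * ‖z j‖ ^ (n - 1) := by rw [← h3, h1]; exact h2
  have := le_of_mul_le_mul_right h5 h4
  linarith

lemma isCompact_preimage_piMap {K : Set (Fin n → ℂ)} (hK : IsCompact K) :
    IsCompact (piMap n ⁻¹' K) := by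
  refine Metric.isCompact_of_isClosed_isBounded (hK.isClosed.preimage continuous_piMap) ?_
  obtain ⟨M, hM⟩ := hK.exists_bound_of_continuousOn
    (f := fun w : Fin n → ℂ => ((1 + ∑ k, ‖w k‖ : ℝ))) (by fun_prop)
  refine (Metric.isBounded_iff_subset_closedBall 0).2 ⟨max M 0, fun z hz => ?_⟩
  rw [mem_closedBall_zero_iff, pi_norm_le_iff_of_nonneg (le_max_right _ _)]
  intro j
  refine (norm_le_of_piMap z j).trans (le_trans ?_ (le_max_left _ _))
  exact (Real.le_norm_self _).trans (hM _ hz)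

lemma isClosedMap_piMap : IsClosedMap (piMap n) :=
  (isProperMap_iff_isCompact_preimage.2
    ⟨continuous_piMap, fun _ hK => isCompact_preimage_piMap hK⟩).isClosedMap

/-- the defining function -/
noncomputable def rho (q : ℝ) (z : Fin n → ℂ) : ℝ := ∑ j, ‖z j‖ ^ (2 * q)

lemma mem_ellipsoid {q : ℝ} {z : Fin n → ℂ} : z ∈ ellipsoid q n ↔ rho q z < 1 := Iff.rfl

lemma continuous_rho {q : ℝ} (hq : 0 < q) : Continuous (rho (n := n) q) := by
  unfold rho
  refine continuous_finsetSum _ fun j _ => ?_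
  exact (continuous_norm.comp (continuous_apply j)).rpow_const (fun _ => Or.inr (by positivity))

lemma rho_nonneg (q : ℝ) (z : Fin n → ℂ) : 0 ≤ rho q z :=
  Finset.sum_nonneg fun j _ => by positivity

lemma rho_perm (q : ℝ) (z : Fin n → ℂ) (σ : Equiv.Perm (Fin n)) : rho q (z ∘ σ) = rho q z :=
  Equiv.sum_comp σ (fun j => ‖z j‖ ^ (2 * q))

lemma rho_eq_of_piMap_eq {q : ℝ} {a b : Fin n → ℂ} (h : piMap n a = piMap n b) :
    rho q a = rho q b := by
  obtain ⟨σ, rfl⟩ := perm_of_piMap_eq h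
  rw [rho_perm]

lemma rho_smul (q : ℝ) (c : ℂ) (z : Fin n → ℂ) : rho q (c • z) = ‖c‖ ^ (2 * q) * rho q z := by
  unfold rho
  rw [Finset.mul_sum]
  refine Finset.sum_congr rfl fun j _ => ?_
  rw [Pi.smul_apply, smul_eq_mul, norm_mul, Real.mul_rpow (norm_nonneg _) (norm_nonneg _)]

lemma isOpen_ellipsoid {q : ℝ} (hq : 0 < q) : IsOpen (ellipsoid q n) :=
  isOpen_lt (continuous_rho hq) continuous_const

lemma norm_le_of_rho_le {q : ℝ} (hq : 0 < q) {z : Fin n → ℂ} (h : rho q z ≤ 1) : ‖z‖ ≤ 1 := by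
  rw [pi_norm_le_iff_of_nonneg zero_le_one]
  intro j
  have h1 : ‖z j‖ ^ (2 * q) ≤ 1 :=
    (Finset.single_le_sum (f := fun j => ‖z j‖ ^ (2 * q)) (fun i _ => by positivity)
      (Finset.mem_univ j)).trans h
  by_contra hcon
  push Not at hcon
  exact absurd h1 (not_le.2 (Real.one_lt_rpow hcon (by positivity)))

lemma isCompact_rho_le {q s : ℝ} (hq : 0 < q) (hs : s ≤ 1) :
    IsCompact {z : Fin n → ℂ | rho q z ≤ s} := by
  refine Metric.isCompact_of_isClosed_isBounded (isClosed_le (continuous_rho hq) continuous_const) ?_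
  refine (Metric.isBounded_iff_subset_closedBall 0).2 ⟨1, fun z hz => ?_⟩
  rw [mem_closedBall_zero_iff]
  exact norm_le_of_rho_le hq (le_trans hz hs)

lemma piMap_mem_symEllipsoid {q : ℝ} {z : Fin n → ℂ} :
    piMap n z ∈ symEllipsoid q n ↔ rho q z < 1 := by
  constructor
  · rintro ⟨a, ha, h⟩
    rw [← rho_eq_of_piMap_eq h]; exact ha
  · intro h; exact ⟨z, h, rfl⟩

lemma isOpen_symEllipsoid {q : ℝ} (hq : 0 < q) : IsOpen (symEllipsoid q n) := by
  have : symEllipsoid q n = (piMap n '' {z | 1 ≤ rho q z})ᶜ := by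
    ext w
    obtain ⟨z, rfl⟩ := piMap_surjective w
    rw [piMap_mem_symEllipsoid, Set.mem_compl_iff, ← not_le, not_iff_not]
    constructor
    · intro h; exact ⟨z, h, rfl⟩
    · rintro ⟨a, ha, h⟩
      rw [← rho_eq_of_piMap_eq h]; exact ha
  rw [this]
  exact (isClosedMap_piMap _ (isClosed_le continuous_const (continuous_rho hq))).isOpen_compl

/-- weighted dilation -/
def dil (c : ℂ) (w : Fin n → ℂ) : Fin n → ℂ := fun j => c ^ (j.1 + 1) * w j

lemma piMap_smul (c : ℂ) (z : Fin n → ℂ) : piMap n (c • z) = dil c (piMap n z) := by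
  funext k
  simp only [piMap, dil, Finset.mul_sum]
  refine Finset.sum_congr rfl fun s hs => ?_
  simp only [Pi.smul_apply, smul_eq_mul, Finset.prod_mul_distrib, Finset.prod_const]
  rw [(Finset.mem_powersetCard.1 hs).2]

lemma fderiv_piMap_injective {z : Fin n → ℂ} (hz : Function.Injective z) {v : Fin n → ℂ}
    (hv : fderiv ℂ (piMap n) z v = 0) : v = 0 := by
  funext j
  have h2 : HasDerivAt (fun t : ℂ => z + t • v) v 0 := by
    simpa using ((hasDerivAt_id (0 : ℂ)).smul_const v).const_add z
  have h1 : HasDerivAt (fun t : ℂ => piMap n (z + t • v)) 0 0 := by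
    have h3 : HasFDerivAt (piMap n) (fderiv ℂ (piMap n) z) (z + (0 : ℂ) • v) := by
      simpa using (differentiable_piMap z).hasFDerivAt
    have := h3.comp_hasDerivAt (0 : ℂ) h2
    rwa [hv] at this
  have h4 : HasDerivAt (fun t : ℂ => ∏ i, (-z j + (z + t • v) i)) 0 0 := by
    simp_rw [prod_add_eq]
    have : HasDerivAt (fun t : ℂ => ∑ k : Fin n, piMap n (z + t • v) k * (-z j) ^ (n - 1 - k.1))
        (∑ k : Fin n, (0 : ℂ) * (-z j) ^ (n - 1 - k.1)) 0 := by
      refine HasDerivAt.fun_sum fun k _ => ?_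
      exact ((hasDerivAt_pi.1 h1) k).mul_const _
    simpa using this.const_add ((-z j) ^ n)
  have h5 : HasDerivAt (fun t : ℂ => ∏ i, (-z j + (z + t • v) i))
      (∑ i, (∏ l ∈ Finset.univ.erase i, (-z j + (z + (0 : ℂ) • v) l)) • v i) 0 := by
    refine HasDerivAt.fun_finsetProd fun i _ => ?_
    exact ((hasDerivAt_pi.1 h2) i).const_add _
  have h6 := h4.unique h5
  rw [Finset.sum_eq_single j] at h6
  · have : ∏ l ∈ Finset.univ.erase j, (-z j + (z + (0 : ℂ) • v) l) ≠ 0 := by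
      rw [Finset.prod_ne_zero_iff]
      intro l hl
      have hne : l ≠ j := (Finset.mem_erase.1 hl).1
      simp only [zero_smul, add_zero]
      intro h0
      apply hne
      apply hz
      linear_combination h0
    rcases smul_eq_zero.1 h6.symm with h7 | h7
    · exact absurd h7 this
    · exact h7
  · intro i _ hij
    rw [Finset.prod_eq_zero (i := j), zero_smul]
    · simp [Ne.symm hij]
    · simp
  · simp

/-- the lifted proper map -/
lemma proper_lift {p q : ℝ} {f : (Fin n → ℂ) → (Fin n → ℂ)}
    (hf : IsProperHolomorphic f (symEllipsoid p n) (symEllipsoid q n)) :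
    IsProperHolomorphic (f ∘ piMap n) (ellipsoid p n) (symEllipsoid q n) := by
  have hm : Set.MapsTo (piMap n) (ellipsoid p n) (symEllipsoid p n) := fun z hz => ⟨z, hz, rfl⟩
  refine ⟨hf.1.comp differentiable_piMap.differentiableOn hm, hf.2.1.comp hm, fun K hK hKc => ?_⟩
  have := isCompact_preimage_piMap (hf.2.2 K hK hKc)
  convert this using 1
  ext z
  simp only [Set.mem_inter_iff, Set.mem_preimage, piMap_mem_symEllipsoid, Function.comp]
  rfl

/-- reverse direction -/
lemma reverse_direction (p q : ℝ) (hp : 0 < p) (hq : 0 < q) (k : ℕ) (hk : 0 < k)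
    (h : p / q = (k : ℝ)) :
    ∃ f : (Fin n → ℂ) → (Fin n → ℂ),
        IsProperHolomorphic f (symEllipsoid p n) (symEllipsoid q n) := by
  have hpq : p = k * q := by field_simp at h; linarith
  have hsym : ∀ i : Fin n, (MvPolynomial.expand k (MvPolynomial.esymm (Fin n) ℂ (i.1 + 1))).IsSymmetric := by
    intro i σ
    rw [MvPolynomial.rename_expand, MvPolynomial.esymm_isSymmetric (Fin n) ℂ (i.1 + 1) σ]
  choose Q hQ using fun i => exists_poly_of_symmetric _ (hsym i)
  let f : (Fin n → ℂ) → (Fin n → ℂ) := fun w i => MvPolynomial.eval w (Q i)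
  have hfπ : ∀ z, f (piMap n z) = piMap n (fun j => z j ^ k) := by
    intro z
    funext i
    simp only [f, ← hQ, piMap_eq_eval]
    rw [MvPolynomial.eval_expand]
    rfl
  have hfd : Differentiable ℂ f := by
    rw [differentiable_pi]
    intro i w
    exact ((AnalyticOnNhd.eval_mvPolynomial (𝕜 := ℂ) (Q i)) w (Set.mem_univ _)).differentiableAt
  have hrho : ∀ z : Fin n → ℂ, rho q (fun j => z j ^ k) = rho p z := by
    intro z
    refine Finset.sum_congr rfl fun j _ => ?_
    rw [norm_pow, ← Real.rpow_natCast, ← Real.rpow_mul (norm_nonneg _), hpq]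
    ring_nf
  refine ⟨f, hfd.differentiableOn, ?_, fun K hK hKc => ?_⟩
  · rintro _ ⟨z, hz, rfl⟩
    rw [hfπ, piMap_mem_symEllipsoid, hrho]; exact hz
  · have hset : symEllipsoid p n ∩ f ⁻¹' K = piMap n '' {z | (fun j => z j ^ k) ∈ piMap n ⁻¹' K} := by
      ext w
      obtain ⟨z, rfl⟩ := piMap_surjective w
      constructor
      · rintro ⟨_, h2⟩
        refine ⟨z, ?_, rfl⟩
        simpa [hfπ] using h2
      · rintro ⟨a, ha, h2⟩
        rw [← h2]
        have ha' : piMap n (fun j => a j ^ k) ∈ K := ha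
        refine ⟨?_, ?_⟩
        · rw [piMap_mem_symEllipsoid, ← hrho, ← piMap_mem_symEllipsoid]; exact hK ha'
        · rw [Set.mem_preimage, hfπ]; exact ha'
    rw [hset]
    refine IsCompact.image ?_ continuous_piMap
    have hcK := isCompact_preimage_piMap hKc
    refine Metric.isCompact_of_isClosed_isBounded (hcK.isClosed.preimage (by fun_prop)) ?_
    obtain ⟨M, hM⟩ := hcK.isBounded.exists_norm_le
    refine (Metric.isBounded_iff_subset_closedBall 0).2 ⟨max 1 M, fun z hz => ?_⟩
    rw [mem_closedBall_zero_iff, pi_norm_le_iff_of_nonneg (by positivity)]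
    intro j
    have h1 := (norm_le_pi_norm (fun j => z j ^ k) j).trans (hM _ hz)
    rw [norm_pow] at h1
    rcases le_total ‖z j‖ 1 with h2 | h2
    · exact h2.trans (le_max_left _ _)
    · exact ((le_self_pow₀ h2 hk.ne').trans h1).trans (le_max_right _ _)

end SymEll

namespace SymEll
open Set Filter Topology MeasureTheory Metric

variable {n : ℕ}

lemma differentiableOn_matrix_det {X : Type} [NormedAddCommGroup X] [NormedSpace ℂ X]
    {A : X → Matrix (Fin n) (Fin n) ℂ} {U : Set X}
    (h : ∀ i j, DifferentiableOn ℂ (fun x => A x i j) U) :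
    DifferentiableOn ℂ (fun x => (A x).det) U := by
  simp only [Matrix.det_apply']
  refine DifferentiableOn.fun_sum fun σ _ => ?_
  refine DifferentiableOn.const_mul ?_ _
  exact fun x hx => (HasFDerivWithinAt.finsetProd (g := fun i x => A x (σ i) i)
    fun i _ => (h (σ i) i x hx).hasFDerivWithinAt).differentiableWithinAt

lemma differentiableOn_clm_det {X : Type} [NormedAddCommGroup X] [NormedSpace ℂ X]
    {A : X → ((Fin n → ℂ) →L[ℂ] (Fin n → ℂ))} {U : Set X}
    (h : DifferentiableOn ℂ A U) : DifferentiableOn ℂ (fun x => (A x).det) U := by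
  have : ∀ x, (A x).det = (LinearMap.toMatrix' (A x : (Fin n → ℂ) →ₗ[ℂ] (Fin n → ℂ))).det := by
    intro x
    rw [LinearMap.det_toMatrix']
  simp only [this]
  refine differentiableOn_matrix_det fun i j => ?_
  simp only [LinearMap.toMatrix'_apply]
  have h1 : DifferentiableOn ℂ (fun x => A x (Pi.single j 1)) U :=
    h.clm_apply (differentiableOn_const _)
  exact (differentiableOn_pi.1 h1) i

lemma clm_bijective {A : (Fin n → ℂ) →L[ℂ] (Fin n → ℂ)} (h : A.det ≠ 0) : Function.Bijective A := by
  have h2 : IsUnit (LinearMap.det (A : (Fin n → ℂ) →ₗ[ℂ] (Fin n → ℂ))) := isUnit_iff_ne_zero.2 h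
  exact (Module.End.isUnit_iff _).1 ((LinearMap.isUnit_iff_isUnit_det _).2 h2)

lemma local_inverse {F : (Fin n → ℂ) → (Fin n → ℂ)} {U : Set (Fin n → ℂ)} (hU : IsOpen U)
    (hF : DifferentiableOn ℂ F U) {z : Fin n → ℂ} (hz : z ∈ U) (hd : (fderiv ℂ F z).det ≠ 0) :
    ∃ (g : (Fin n → ℂ) → (Fin n → ℂ)) (V W : Set (Fin n → ℂ)), IsOpen V ∧ IsOpen W ∧ z ∈ W ∧ W ⊆ U ∧
      MapsTo F W V ∧ MapsTo g V W ∧ (∀ x ∈ W, g (F x) = x) ∧ (∀ y ∈ V, F (g y) = y) ∧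
      DifferentiableOn ℂ g V := by
  have hcd : ContDiffAt ℂ 1 F z := ((contDiffOn_nat 1 hU hF) z hz).contDiffAt (hU.mem_nhds hz)
  let e' : (Fin n → ℂ) ≃L[ℂ] (Fin n → ℂ) :=
    ContinuousLinearEquiv.ofBijective (fderiv ℂ F z) (by
      rw [LinearMap.ker_eq_bot]
      exact (clm_bijective hd).1) (by
      rw [LinearMap.range_eq_top]
      exact (clm_bijective hd).2)
  have he' : HasFDerivAt F (e' : (Fin n → ℂ) →L[ℂ] (Fin n → ℂ)) z := by
    have : (e' : (Fin n → ℂ) →L[ℂ] (Fin n → ℂ)) = fderiv ℂ F z := by ext; rfl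
    rw [this]
    exact (hcd.differentiableAt (by norm_num)).hasFDerivAt
  let e := hcd.toOpenPartialHomeomorph F he' (by norm_num)
  have hes : z ∈ e.source := hcd.mem_toOpenPartialHomeomorph_source he' (by norm_num)
  have hcoe : (e : (Fin n → ℂ) → (Fin n → ℂ)) = F := rfl
  have hsm : ContDiffAt ℂ 1 e.symm (F z) := hcd.to_localInverse he' (by norm_num)
  have hev : ∀ᶠ y in 𝓝 (F z), DifferentiableAt ℂ e.symm y := by
    filter_upwards [hsm.eventually (by simp)] with y hy using hy.differentiableAt (by norm_num)
  obtain ⟨O, hO, hOo, hzO⟩ := _root_.eventually_nhds_iff.1 hev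
  have hVo : IsOpen (e.target ∩ e.symm ⁻¹' U ∩ O) :=
    (e.isOpen_inter_preimage_symm hU).inter hOo
  refine ⟨e.symm, e.target ∩ e.symm ⁻¹' U ∩ O, e.source ∩ e ⁻¹' (e.target ∩ e.symm ⁻¹' U ∩ O), hVo,
    e.isOpen_inter_preimage hVo, ⟨hes, ⟨e.map_source hes, ?_⟩, hzO⟩, ?_, ?_, ?_, ?_, ?_, ?_⟩
  · rw [Set.mem_preimage, e.left_inv hes]; exact hz
  · rintro x ⟨hx, ⟨_, h2⟩, _⟩
    rw [Set.mem_preimage, e.left_inv hx] at h2; exact h2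
  · rintro x ⟨hx, h2⟩; exact h2
  · intro y hy
    refine ⟨e.map_target hy.1.1, ?_⟩
    rw [Set.mem_preimage, e.right_inv hy.1.1]; exact hy
  · rintro x ⟨hx, _⟩; exact e.left_inv hx
  · intro y hy; exact e.right_inv hy.1.1
  · intro y hy; exact (hO y hy.2).differentiableWithinAt

/-- P3: a holomorphic map with compact fibres has generically nonzero Jacobian -/
lemma exists_det_ne_zero {F : (Fin n → ℂ) → (Fin n → ℂ)} {D : Set (Fin n → ℂ)} (hD : IsOpen D)
    (hDne : D.Nonempty) (hF : DifferentiableOn ℂ F D)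
    (hfib : ∀ w, IsCompact (D ∩ F ⁻¹' {F w}) ∨ w ∉ D) :
    ∃ z ∈ D, (fderiv ℂ F z).det ≠ 0 := by
  classical
  by_contra hcon
  push Not at hcon
  let rk : (Fin n → ℂ) → ℕ := fun z => Module.finrank ℂ (LinearMap.range (fderiv ℂ F z : (Fin n → ℂ) →ₗ[ℂ] (Fin n → ℂ)))
  have hrk : ∀ z, rk z ≤ n := by
    intro z
    have := Submodule.finrank_le (LinearMap.range (fderiv ℂ F z : (Fin n → ℂ) →ₗ[ℂ] (Fin n → ℂ)))
    simpa [rk] using this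
  obtain ⟨z0, hz0, hmax⟩ : ∃ z0 ∈ D, ∀ z ∈ D, rk z ≤ rk z0 := by
    have hfin : (rk '' D).Finite := (Set.finite_Iic n).subset (by rintro _ ⟨z, _, rfl⟩; exact hrk z)
    obtain ⟨m, ⟨z0, hz0, rfl⟩, h⟩ := Set.exists_max_image (rk '' D) id hfin (hDne.image _)
    exact ⟨z0, hz0, fun z hz => h _ ⟨z, hz, rfl⟩⟩
  let T : (Fin n → ℂ) →ₗ[ℂ] (Fin n → ℂ) := fderiv ℂ F z0
  obtain ⟨s, hs⟩ := LinearMap.exists_rightInverse_of_surjective T.rangeRestrict (LinearMap.range_rangeRestrict T)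
  obtain ⟨P, hP⟩ := LinearMap.exists_leftInverse_of_injective (LinearMap.range T).subtype (by simp)
  let g : (Fin n → ℂ) →ₗ[ℂ] (Fin n → ℂ) := s ∘ₗ P
  have hPT : ∀ x, P (T x) = T.rangeRestrict x := fun x => LinearMap.congr_fun hP (T.rangeRestrict x)
  have hTs : ∀ y, T (s y) = y := fun y => congrArg Subtype.val (LinearMap.congr_fun hs y)
  have hTgT : ∀ x, T (g (T x)) = T x := by
    intro x
    simp only [g, LinearMap.comp_apply, hPT, hTs]; rfl
  have hgTg : ∀ x, g (T (g x)) = g x := by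
    intro x
    simp only [g, LinearMap.comp_apply, hTs]
    congr 1
    exact LinearMap.congr_fun hP (P x)
  let L2 : (Fin n → ℂ) →ₗ[ℂ] (Fin n → ℂ) := LinearMap.id - g ∘ₗ T
  have hTL2 : ∀ x, T (L2 x) = 0 := by intro x; simp [L2, hTgT]
  obtain ⟨c, hc0, hTc⟩ : ∃ c, c ≠ 0 ∧ T c = 0 := by
    have h1 : LinearMap.det T = 0 := hcon z0 hz0
    have h2 : LinearMap.ker T ≠ ⊥ := by
      intro h
      have := (LinearMap.isUnit_iff_ker_eq_bot T).2 h
      have := this.map (LinearMap.det)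
      rw [h1] at this
      exact not_isUnit_zero this
    obtain ⟨c, hc, h⟩ := Submodule.exists_mem_ne_zero_of_ne_bot h2
    exact ⟨c, h, hc⟩
  have hL2c : L2 c = c := by simp [L2, hTc]
  let gc := LinearMap.toContinuousLinearMap g
  let L2c := LinearMap.toContinuousLinearMap L2
  let Ψ : (Fin n → ℂ) → (Fin n → ℂ) := fun z => gc (F z) + L2c z
  have hFat : ∀ z ∈ D, HasFDerivAt F (fderiv ℂ F z) z := fun z hz =>
    ((hF z hz).differentiableAt (hD.mem_nhds hz)).hasFDerivAt
  have hΨat : ∀ z ∈ D, HasFDerivAt Ψ (gc ∘L fderiv ℂ F z + L2c) z := fun z hz =>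
    (gc.hasFDerivAt.comp z (hFat z hz)).add L2c.hasFDerivAt
  have hΨD : DifferentiableOn ℂ Ψ D := fun z hz => (hΨat z hz).differentiableAt.differentiableWithinAt
  let μ : (Fin n → ℂ) → ℂ := fun z => (fderiv ℂ Ψ z).det
  have hμD : DifferentiableOn ℂ μ D := differentiableOn_clm_det (differentiableOn_fderiv hD hΨD)
  have hμ0 : μ z0 ≠ 0 := by
    have : gc ∘L fderiv ℂ F z0 + L2c = ContinuousLinearMap.id ℂ _ := by
      ext1 x
      change g (T x) + (x - g (T x)) = x
      abel
    simp only [μ, (hΨat z0 hz0).fderiv, this]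
    have : (ContinuousLinearMap.id ℂ (Fin n → ℂ)).det = 1 := LinearMap.det_id
    rw [this]; exact one_ne_zero
  -- the kernel property
  have hker : ∀ z ∈ D, μ z ≠ 0 → ∀ x, fderiv ℂ Ψ z x = c → fderiv ℂ F z x = 0 := by
    intro z hz hμ x hx
    let A : (Fin n → ℂ) →ₗ[ℂ] (Fin n → ℂ) := (fderiv ℂ F z).toLinearMap
    have hM : ∀ y, fderiv ℂ Ψ z y = g (A y) + L2 y := by
      intro y; rw [(hΨat z hz).fderiv]; rfl
    have hgA : g (A x) = 0 := by
      have h1 : g (A x) + L2 x = c := by rw [← hM]; exact hx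
      have h2 := congrArg (fun y => g (T y)) h1
      simp only [map_add, hgTg, hTL2, hTc, map_zero, add_zero] at h2
      exact h2
    have hsurj : LinearMap.range (g ∘ₗ A) ⊔ LinearMap.range L2 = ⊤ := by
      rw [eq_top_iff]
      intro y _
      obtain ⟨w, hw⟩ := (clm_bijective hμ).2 y
      have hw' : g (A w) + L2 w = y := by rw [← hM]; exact hw
      rw [← hw']
      exact Submodule.add_mem_sup ⟨w, rfl⟩ ⟨w, rfl⟩
    have hd1 : Module.finrank ℂ (LinearMap.range L2) ≤ Module.finrank ℂ (LinearMap.ker T) :=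
      Submodule.finrank_mono (by rintro _ ⟨y, rfl⟩; exact hTL2 y)
    have hd2 := LinearMap.finrank_range_add_finrank_ker T
    have hd3 := LinearMap.finrank_range_add_finrank_ker A
    have hd4 := LinearMap.finrank_range_add_finrank_ker (g ∘ₗ A)
    have hd5 := Submodule.finrank_add_le_finrank_add_finrank (LinearMap.range (g ∘ₗ A)) (LinearMap.range L2)
    rw [hsurj, finrank_top] at hd5
    have hd6 : Module.finrank ℂ (LinearMap.range A) ≤ Module.finrank ℂ (LinearMap.range T) := hmax z hz
    have hle : LinearMap.ker A ≤ LinearMap.ker (g ∘ₗ A) := LinearMap.ker_le_ker_comp A g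
    have heq := Submodule.eq_of_le_of_finrank_le hle (by omega)
    have : x ∈ LinearMap.ker A := by rw [heq]; exact hgA
    exact this
  -- the extremal point
  let K := D ∩ F ⁻¹' {F z0}
  have hK : IsCompact K := by
    rcases hfib z0 with h | h
    · exact h
    · exact absurd hz0 h
  let Φ : (Fin n → ℂ) → ℝ := fun z => ‖μ z‖ ^ 2 * Real.exp (∑ j, ‖z j‖ ^ 2)
  have hΦc : ContinuousOn Φ K := by
    have h1 : ContinuousOn μ K := hμD.continuousOn.mono Set.inter_subset_left
    have h2 : Continuous fun z : Fin n → ℂ => Real.exp (∑ j, ‖z j‖ ^ 2) := by fun_prop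
    exact (h1.norm.pow 2).mul h2.continuousOn
  obtain ⟨z1, hz1, hmax1⟩ := hK.exists_isMaxOn ⟨z0, hz0, rfl⟩ hΦc
  have hμ1 : μ z1 ≠ 0 := by
    have h1 : Φ z0 ≤ Φ z1 := hmax1 ⟨hz0, rfl⟩
    have h2 : 0 < Φ z0 := by
      have := norm_pos_iff.2 hμ0
      positivity
    intro h3
    have : Φ z1 = 0 := by simp [Φ, h3]
    linarith
  -- local inverse
  obtain ⟨h, V, W, hV, hW, hz1W, hWD, hFW, hhV, hleft, hright, hhd⟩ :=
    local_inverse hD hΨD hz1.1 hμ1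
  let ℓ : ℂ → (Fin n → ℂ) := fun t => Ψ z1 + t • c
  have hℓ : Differentiable ℂ ℓ := by
    intro t; exact ((differentiableAt_id.smul_const _).const_add _)
  let γ : ℂ → (Fin n → ℂ) := fun t => h (ℓ t)
  have hγ0 : γ 0 = z1 := by simp only [γ, ℓ, zero_smul, add_zero]; exact hleft z1 hz1W
  have hWμ : IsOpen (W ∩ μ ⁻¹' {0}ᶜ) := by
    refine (hμD.continuousOn.mono hWD).isOpen_inter_preimage hW isOpen_compl_singleton
  have hgood : IsOpen (ℓ ⁻¹' V) := hV.preimage hℓ.continuous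
  have hγd : DifferentiableOn ℂ γ (ℓ ⁻¹' V) := hhd.comp hℓ.differentiableOn (fun t ht => ht)
  have hgood2 : IsOpen (ℓ ⁻¹' V ∩ γ ⁻¹' (W ∩ μ ⁻¹' {0}ᶜ)) :=
    hγd.continuousOn.isOpen_inter_preimage hgood hWμ
  have h0V : (0 : ℂ) ∈ ℓ ⁻¹' V := by
    simp only [Set.mem_preimage, ℓ, zero_smul, add_zero]; exact hFW hz1W
  obtain ⟨ε, hε, hball⟩ := Metric.isOpen_iff.1 hgood2 0 ⟨h0V, by
    rw [Set.mem_preimage, hγ0]; exact ⟨hz1W, hμ1⟩⟩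
  have hγB : ∀ t ∈ ball (0 : ℂ) ε, HasDerivAt γ (deriv γ t) t := fun t ht =>
    ((hγd t (hball ht).1).differentiableAt (hgood.mem_nhds (hball ht).1)).hasDerivAt
  have hΨγ : ∀ t ∈ ball (0 : ℂ) ε, fderiv ℂ Ψ (γ t) (deriv γ t) = c := by
    intro t ht
    have hD' : γ t ∈ D := hWD (hball ht).2.1
    have h1 : HasDerivAt (fun t => Ψ (γ t)) (fderiv ℂ Ψ (γ t) (deriv γ t)) t := by
      have := (hΨat _ hD').differentiableAt.hasFDerivAt
      exact this.comp_hasDerivAt t (hγB t ht)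
    have h2 : HasDerivAt (fun t => Ψ (γ t)) c t := by
      have h3 : HasDerivAt ℓ c t := by
        have := ((hasDerivAt_id t).smul_const c).const_add (Ψ z1)
        rw [one_smul] at this
        exact this
      refine h3.congr_of_eventuallyEq ?_
      filter_upwards [isOpen_ball.mem_nhds ht] with t' ht'
      exact hright _ (hball ht').1
    exact h1.unique h2
  have hFγ : ∀ t ∈ ball (0 : ℂ) ε, F (γ t) = F z1 := by
    have hder : ∀ t ∈ ball (0 : ℂ) ε, HasDerivAt (fun t => F (γ t)) 0 t := by
      intro t ht
      have hD' : γ t ∈ D := hWD (hball ht).2.1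
      have := (hFat _ hD').comp_hasDerivAt t (hγB t ht)
      rwa [hker _ hD' (hball ht).2.2 _ (hΨγ t ht)] at this
    intro t ht
    have := isOpen_ball.is_const_of_deriv_eq_zero (convex_ball (0 : ℂ) ε).isPreconnected
      (fun t ht => (hder t ht).differentiableAt.differentiableWithinAt)
      (fun t ht => (hder t ht).deriv) ht (mem_ball_self hε)
    simpa [hγ0] using this
  have hγK : ∀ t ∈ ball (0 : ℂ) ε, γ t ∈ K := by
    intro t ht
    refine ⟨hWD (hball ht).2.1, ?_⟩
    have h2 : F z1 = F z0 := hz1.2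
    simp [hFγ t ht, h2]
  let H : ℂ → ℂ := fun t => μ (γ t) * Complex.exp (∑ j, (γ t j - z1 j) * (starRingEnd ℂ) (z1 j))
  have hH : ∀ t ∈ ball (0 : ℂ) ε, ‖H t‖ ^ 2 ≤ ‖μ z1‖ ^ 2 * Real.exp (-∑ j, ‖γ t j - z1 j‖ ^ 2) := by
    intro t ht
    have h1 : Φ (γ t) ≤ Φ z1 := hmax1 (hγK t ht)
    simp only [Φ] at h1
    have h2 : ‖H t‖ ^ 2 = (‖μ (γ t)‖ ^ 2 * Real.exp (∑ j, ‖γ t j‖ ^ 2)) *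
        Real.exp (2 * (∑ j, (γ t j - z1 j) * (starRingEnd ℂ) (z1 j)).re - ∑ j, ‖γ t j‖ ^ 2) := by
      simp only [H, norm_mul, mul_pow, Complex.norm_exp]
      rw [mul_assoc, ← Real.exp_add, ← Real.exp_nat_mul]
      congr 2
      push_cast
      ring
    rw [h2]
    refine (mul_le_mul_of_nonneg_right h1 (Real.exp_pos _).le).trans (le_of_eq ?_)
    rw [mul_assoc, ← Real.exp_add]
    congr 2
    rw [Complex.re_sum, Finset.mul_sum, ← Finset.sum_sub_distrib, ← Finset.sum_add_distrib, ← Finset.sum_neg_distrib]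
    refine Finset.sum_congr rfl fun j _ => ?_
    rw [← Complex.normSq_eq_norm_sq, ← Complex.normSq_eq_norm_sq, ← Complex.normSq_eq_norm_sq]
    simp only [Complex.normSq_apply, Complex.mul_re, Complex.sub_re, Complex.sub_im, Complex.conj_re, Complex.conj_im]
    ring
  have hH0 : H 0 = μ z1 := by simp [H, hγ0]
  have hHd : ∀ᶠ t in 𝓝 (0 : ℂ), DifferentiableAt ℂ H t := by
    filter_upwards [ball_mem_nhds (0 : ℂ) hε] with t ht
    have hD' : γ t ∈ D := hWD (hball ht).2.1
    have h1 : DifferentiableAt ℂ (fun t => μ (γ t)) t :=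
      DifferentiableAt.comp (g := μ) t (hμD.differentiableAt (hD.mem_nhds hD')) (hγB t ht).differentiableAt
    have h2 : ∀ j, DifferentiableAt ℂ (fun t => γ t j) t := fun j =>
      (hasDerivAt_pi.1 (hγB t ht) j).differentiableAt
    refine h1.mul (DifferentiableAt.cexp ?_)
    refine DifferentiableAt.fun_sum fun j _ => ?_
    exact ((h2 j).sub_const _).mul_const _
  have hloc : IsLocalMax (norm ∘ H) 0 := by
    filter_upwards [ball_mem_nhds (0 : ℂ) hε] with t ht
    have h1 := hH t ht
    have h2 : Real.exp (-∑ j, ‖γ t j - z1 j‖ ^ 2) ≤ 1 := by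
      rw [Real.exp_le_one_iff, neg_nonpos]; positivity
    simp only [Function.comp, hH0]
    refine (sq_le_sq₀ (norm_nonneg _) (norm_nonneg _)).1 (h1.trans ?_)
    exact mul_le_of_le_one_right (by positivity) h2
  have hconst := Complex.norm_eventually_eq_of_isLocalMax hHd hloc
  have hγc : ∀ᶠ t in 𝓝 (0 : ℂ), γ t = z1 := by
    filter_upwards [hconst, ball_mem_nhds (0 : ℂ) hε] with t h1 ht
    have h2 := hH t ht
    rw [h1, hH0] at h2
    have h3 : 0 < ‖μ z1‖ ^ 2 := by have := norm_pos_iff.2 hμ1; positivity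
    have h4 : 1 ≤ Real.exp (-∑ j, ‖γ t j - z1 j‖ ^ 2) := by
      by_contra h5
      push Not at h5
      nlinarith
    rw [Real.one_le_exp_iff, le_neg, neg_zero] at h4
    have h5 : ∑ j, ‖γ t j - z1 j‖ ^ 2 = 0 := le_antisymm h4 (by positivity)
    rw [Finset.sum_eq_zero_iff_of_nonneg (fun _ _ => by positivity)] at h5
    funext j
    have := h5 j (Finset.mem_univ j)
    rw [sq_eq_zero_iff, norm_eq_zero, sub_eq_zero] at this
    exact this
  have h1 := hΨγ 0 (mem_ball_self hε)
  have h2 : deriv γ 0 = 0 := by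
    have : γ =ᶠ[𝓝 0] fun _ => z1 := hγc
    rw [this.deriv_eq]; simp
  rw [h2, map_zero] at h1
  exact hc0 h1.symm

end SymEll

namespace SymEll
open Set Filter Topology MeasureTheory Metric

variable {n : ℕ}

/-- determinant as a continuous multilinear map of the rows -/
noncomputable def detC (n : ℕ) : ContinuousMultilinearMap ℂ (fun _ : Fin n => (Fin n → ℂ)) ℂ :=
  { (Matrix.detRowAlternating (R := ℂ) (n := Fin n)).toMultilinearMap with
    cont := by
      change Continuous fun M : Fin n → Fin n → ℂ => Matrix.det (M : Matrix (Fin n) (Fin n) ℂ)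
      exact Continuous.matrix_det continuous_id }

lemma detC_apply (M : Fin n → Fin n → ℂ) : detC n M = Matrix.det (M : Matrix (Fin n) (Fin n) ℂ) := rfl

/-- Jacobian matrix -/
noncomputable def Jm (F : (Fin n → ℂ) → (Fin n → ℂ)) (z : Fin n → ℂ) : Matrix (Fin n) (Fin n) ℂ :=
  LinearMap.toMatrix' (fderiv ℂ F z : (Fin n → ℂ) →ₗ[ℂ] (Fin n → ℂ))

lemma Jm_apply (F : (Fin n → ℂ) → (Fin n → ℂ)) (z : Fin n → ℂ) (i j : Fin n) :
    Jm F z i j = fderiv ℂ F z (Pi.single j 1) i := by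
  simp [Jm, LinearMap.toMatrix'_apply]

lemma det_Jm (F : (Fin n → ℂ) → (Fin n → ℂ)) (z : Fin n → ℂ) :
    (Jm F z).det = (fderiv ℂ F z).det := by
  simp only [Jm, LinearMap.det_toMatrix']

lemma sum_symm_antisymm (c A : Fin n → Fin n → ℂ) (hc : ∀ i l, c i l = c l i)
    (hA : ∀ i l, A i l = - A l i) : ∑ i, ∑ l, c i l * A i l = 0 := by
  have h : ∑ i, ∑ l, c i l * A i l = - ∑ i, ∑ l, c i l * A i l := by
    conv_lhs => rw [Finset.sum_comm]
    simp only [← Finset.sum_neg_distrib]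
    refine Finset.sum_congr rfl fun i _ => Finset.sum_congr rfl fun l _ => ?_
    rw [hc l i, hA l i]; ring
  exact self_eq_neg.1 h

lemma adj_hasFDerivAt {F : (Fin n → ℂ) → (Fin n → ℂ)} {D : Set (Fin n → ℂ)} (hD : IsOpen D)
    (hF : DifferentiableOn ℂ F D) {z : Fin n → ℂ} (hz : z ∈ D) (i j : Fin n) :
    ∃ L : (Fin n → ℂ) →L[ℂ] ℂ, HasFDerivAt (fun z => (Jm F z).adjugate i j) L z ∧
      ∀ v, L v = ∑ r, if r = j then 0 else
        ∑ l, fderiv ℂ (fderiv ℂ F) z v (Pi.single l 1) r *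
          (((Jm F z).updateRow j (Pi.single i 1)).updateRow r (Pi.single l 1)).det := by
  classical
  have h2 : HasFDerivAt (fderiv ℂ F) (fderiv ℂ (fderiv ℂ F) z) z :=
    ((differentiableOn_fderiv hD hF).differentiableAt (hD.mem_nhds hz)).hasFDerivAt
  let row : Fin n → (Fin n → ℂ) → (Fin n → ℂ) := fun r z =>
    if r = j then Pi.single i 1 else fun l => fderiv ℂ F z (Pi.single l 1) r
  let row' : Fin n → ((Fin n → ℂ) →L[ℂ] (Fin n → ℂ)) := fun r =>
    if r = j then 0 else ContinuousLinearMap.pi fun l =>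
      (ContinuousLinearMap.proj r ∘L (ContinuousLinearMap.apply ℂ (Fin n → ℂ) (Pi.single l 1 : Fin n → ℂ)))
        ∘L fderiv ℂ (fderiv ℂ F) z
  have hrow : ∀ r, HasFDerivAt (row r) (row' r) z := by
    intro r
    by_cases hr : r = j
    · simp only [row, row', if_pos hr]; exact hasFDerivAt_const _ _
    · simp only [row, row', if_neg hr]
      rw [hasFDerivAt_pi]
      intro l
      exact (ContinuousLinearMap.proj r ∘L (ContinuousLinearMap.apply ℂ (Fin n → ℂ) (Pi.single l 1 : Fin n → ℂ))).hasFDerivAt.comp z h2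
  have hM : ∀ z, (fun r => row r z) = (Jm F z).updateRow j (Pi.single i 1) := by
    intro z
    funext r l
    by_cases hr : r = j
    · subst hr; simp [row]
    · simp [row, hr, Jm_apply, Matrix.updateRow_ne]
  have hdd := HasFDerivAt.multilinear_comp (f := detC n) hrow
  refine ⟨_, hdd.congr_of_eventuallyEq (Eventually.of_forall fun z => ?_), ?_⟩
  · simp only [Matrix.adjugate_apply, detC_apply]
    rw [← hM]
  · intro v
    simp only [ContinuousLinearMap.sum_apply, ContinuousLinearMap.comp_apply]
    refine Finset.sum_congr rfl fun r _ => ?_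
    by_cases hr : r = j
    · rw [if_pos hr]
      have : row' r v = 0 := by simp [row', hr]
      rw [this, map_zero]
    · rw [if_neg hr]
      have h3 : (detC n).toContinuousLinearMap (fun j => row j z) r (row' r v)
        = (((Jm F z).updateRow j (Pi.single i 1)).updateRow r (row' r v)).det := by
        rw [← hM]; rfl
      rw [h3]
      have h4 : row' r v = ∑ l, (fderiv ℂ (fderiv ℂ F) z v (Pi.single l 1) r) • (Pi.single l 1 : Fin n → ℂ) := by
        simp only [row', if_neg hr]
        funext m
        simp [Finset.sum_apply, Pi.single_apply]
      rw [h4]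
      have h5 := map_sum ((Matrix.detRowAlternating (R := ℂ) (n := Fin n)).toMultilinearMap.toLinearMap
        ((Jm F z).updateRow j (Pi.single i 1)) r)
        (fun l => (fderiv ℂ (fderiv ℂ F) z v (Pi.single l 1) r) • (Pi.single l 1 : Fin n → ℂ)) Finset.univ
      refine h5.trans ?_
      refine Finset.sum_congr rfl fun l _ => ?_
      rw [map_smul, smul_eq_mul]
      rfl

lemma piola {F : (Fin n → ℂ) → (Fin n → ℂ)} {D : Set (Fin n → ℂ)} (hD : IsOpen D)
    (hF : DifferentiableOn ℂ F D) {z : Fin n → ℂ} (hz : z ∈ D) (j : Fin n) :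
    ∑ i, fderiv ℂ (fun z => (Jm F z).adjugate i j) z (Pi.single i 1) = 0 := by
  have hsym : IsSymmSndFDerivAt ℂ F z := by
    refine ContDiffAt.isSymmSndFDerivAt (n := 2)
      (((contDiffOn_nat 2 hD hF) z hz).contDiffAt (hD.mem_nhds hz)) ?_
    simp
  have h1 : ∀ i, fderiv ℂ (fun z => (Jm F z).adjugate i j) z (Pi.single i 1) = ∑ r, if r = j then 0 else
        ∑ l, fderiv ℂ (fderiv ℂ F) z (Pi.single i 1) (Pi.single l 1) r *
          (((Jm F z).updateRow j (Pi.single i 1)).updateRow r (Pi.single l 1)).det := by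
    intro i
    obtain ⟨L, hL, hv⟩ := adj_hasFDerivAt hD hF hz i j
    rw [hL.fderiv, hv]
  simp only [h1]
  rw [Finset.sum_comm]
  refine Finset.sum_eq_zero fun r _ => ?_
  by_cases hr : r = j
  · simp [hr]
  simp only [if_neg hr]
  refine sum_symm_antisymm (fun i l => fderiv ℂ (fderiv ℂ F) z (Pi.single i 1) (Pi.single l 1) r)
    (fun i l => (((Jm F z).updateRow j (Pi.single i 1)).updateRow r (Pi.single l 1)).det) ?_ ?_
  · intro i l
    change _ = _
    rw [hsym.eq]
  · intro i l
    have := (Matrix.detRowAlternating (R := ℂ) (n := Fin n)).map_swap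
      (((Jm F z).updateRow j (Pi.single l 1)).updateRow r (Pi.single i 1)) hr
    refine Eq.trans ?_ this
    change _ = Matrix.det _
    congr 1
    ext a b
    change _ = (((Jm F z).updateRow j (Pi.single l 1)).updateRow r (Pi.single i 1)) (Equiv.swap r j a) b
    by_cases ha : a = r
    · subst ha
      rw [Equiv.swap_apply_left, Matrix.updateRow_self, Matrix.updateRow_ne (Ne.symm hr), Matrix.updateRow_self]
    · by_cases hb : a = j
      · subst hb
        rw [Equiv.swap_apply_right, Matrix.updateRow_self, Matrix.updateRow_ne ha, Matrix.updateRow_self]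
      · rw [Equiv.swap_apply_of_ne_of_ne ha hb, Matrix.updateRow_ne ha, Matrix.updateRow_ne ha,
          Matrix.updateRow_ne hb, Matrix.updateRow_ne hb]

lemma integral_fderiv_eq_zero {Y : (Fin n → ℂ) → ℂ} (hY : ContDiff ℝ 1 Y) (hc : HasCompactSupport Y)
    (v : Fin n → ℂ) : ∫ x, fderiv ℝ Y x v = 0 := by
  have h1 : Continuous fun x => fderiv ℝ Y x v := (hY.continuous_fderiv (by norm_num)).clm_apply continuous_const
  have h2 : HasCompactSupport fun x => fderiv ℝ Y x v := hc.fderiv_apply (𝕜 := ℝ) v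
  have := integral_bilinear_hasLineDerivAt_right_eq_neg_left_of_integrable (μ := volume)
    (f := fun _ : Fin n → ℂ => (1 : ℝ)) (f' := fun _ => 0) (g := Y) (g' := fun x => fderiv ℝ Y x v) (v := v)
    (B := ContinuousLinearMap.lsmul ℝ ℝ) (by simp) (by simpa using h1.integrable_of_hasCompactSupport h2)
    (by simpa using hY.continuous.integrable_of_hasCompactSupport hc)
    (fun x _ => by
      have := (hasFDerivAt_const (𝕜 := ℝ) (1 : ℝ) x).hasLineDerivAt v
      simpa using this)
    (fun x _ => ((hY.differentiable (by norm_num)) x).hasFDerivAt.hasLineDerivAt v)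
  simpa using this

/-- the (1,0) part of a real-linear functional -/
noncomputable def dz (L : (Fin n → ℂ) →L[ℝ] ℂ) : (Fin n → ℂ) →ₗ[ℂ] ℂ where
  toFun v := (1 / 2 : ℂ) * (L v - Complex.I * L (Complex.I • v))
  map_add' v w := by simp only [smul_add, map_add]; ring
  map_smul' c v := by
    have hc : ∀ w : Fin n → ℂ, L (c • w) = c.re * L w + c.im * L (Complex.I • w) := by
      intro w
      have : c • w = c.re • w + c.im • (Complex.I • w) := by
        rw [← smul_assoc, Complex.real_smul]
        conv_lhs => rw [← Complex.re_add_im c]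
        rw [add_smul]; rfl
      rw [this, map_add, map_smul, map_smul, Complex.real_smul, Complex.real_smul]
    rw [smul_comm Complex.I c v, hc v, hc (Complex.I • v), smul_smul, Complex.I_mul_I]
    simp only [neg_smul, one_smul, map_neg, RingHom.id_apply, smul_eq_mul]
    conv_rhs => rw [← Complex.re_add_im c]
    linear_combination (1/2 * (c.im : ℂ) * L (Complex.I • v)) * Complex.I_sq

lemma dz_apply (L : (Fin n → ℂ) →L[ℝ] ℂ) (v) :
    dz L v = (1 / 2 : ℂ) * (L v - Complex.I * L (Complex.I • v)) := rfl

lemma dz_eq_sum (L : (Fin n → ℂ) →L[ℝ] ℂ) (v : Fin n → ℂ) :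
    dz L v = ∑ l, v l * dz L (Pi.single l 1) := by
  have := LinearMap.pi_apply_eq_sum_univ (dz L) v
  simp only [smul_eq_mul] at this
  rw [this]
  refine Finset.sum_congr rfl fun l _ => ?_
  congr 2
  funext m
  simp [Pi.single_apply, eq_comm]

lemma dz_restrictScalars (L : (Fin n → ℂ) →L[ℂ] ℂ) (v) : dz (L.restrictScalars ℝ) v = L v := by
  rw [dz_apply]
  simp only [ContinuousLinearMap.coe_restrictScalars', map_smul, smul_eq_mul]
  linear_combination (-1/2 * L v) * Complex.I_sq

lemma stokes {F : (Fin n → ℂ) → (Fin n → ℂ)} {D K : Set (Fin n → ℂ)} (hD : IsOpen D)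
    (hF : DifferentiableOn ℂ F D) (hK : IsCompact K) (hKD : K ⊆ D)
    {X : Fin n → (Fin n → ℂ) → ℂ} (hX : ∀ j, ContDiff ℝ 1 (X j))
    (hXK : ∀ z ∈ D, z ∉ K → ∀ j, X j (F z) = 0)
    {k : (Fin n → ℂ) → ℂ} (hk : DifferentiableOn ℂ k D) :
    ∫ z in D, (fderiv ℂ F z).det * (∑ j, dz (fderiv ℝ (X j) (F z)) (Pi.single j 1)) *
      (starRingEnd ℂ) (k z) = 0 := by
  classical
  let Y0 : Fin n → (Fin n → ℂ) → ℂ := fun i z =>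
    ∑ j, (Jm F z).adjugate i j * X j (F z) * (starRingEnd ℂ) (k z)
  let Y : Fin n → (Fin n → ℂ) → ℂ := fun i => D.indicator (Y0 i)
  have hY0K : ∀ i, ∀ z, z ∉ K → Y i z = 0 := by
    intro i z hz
    by_cases hzD : z ∈ D
    · simp only [Y, Set.indicator_of_mem hzD, Y0]
      exact Finset.sum_eq_zero fun j _ => by rw [hXK z hzD hz j]; ring
    · simp [Y, hzD]
  have hYev : ∀ i, ∀ z ∈ D, Y i =ᶠ[𝓝 z] Y0 i := by
    intro i z hz
    filter_upwards [hD.mem_nhds hz] with x hx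
    simp [Y, hx]
  have hYev0 : ∀ i, ∀ z, z ∉ K → Y i =ᶠ[𝓝 z] fun _ => 0 := by
    intro i z hz
    filter_upwards [hK.isClosed.isOpen_compl.mem_nhds hz] with x hx using hY0K i x hx
  have hcdF : ContDiffOn ℝ 1 F D := (contDiffOn_nat 1 hD hF).restrict_scalars ℝ
  have hcdk : ContDiffOn ℝ 1 k D := (contDiffOn_nat 1 hD hk).restrict_scalars ℝ
  have hadj : ∀ i j, DifferentiableOn ℂ (fun z => (Jm F z).adjugate i j) D := by
    intro i j z hz
    obtain ⟨L, hL, _⟩ := adj_hasFDerivAt hD hF hz i j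
    exact hL.differentiableAt.differentiableWithinAt
  have hY0cd : ∀ i, ContDiffOn ℝ 1 (Y0 i) D := by
    intro i
    refine ContDiffOn.sum fun j _ => ?_
    have h1 : ContDiffOn ℝ 1 (fun z => (Jm F z).adjugate i j) D :=
      (contDiffOn_nat 1 hD (hadj i j)).restrict_scalars ℝ
    have h2 : ContDiffOn ℝ 1 (fun z => X j (F z)) D := (hX j).comp_contDiffOn hcdF
    have h3 : ContDiffOn ℝ 1 (fun z => (starRingEnd ℂ) (k z)) D :=
      Complex.conjCLE.contDiff.comp_contDiffOn hcdk
    exact (h1.mul h2).mul h3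
  have hYcd : ∀ i, ContDiff ℝ 1 (Y i) := by
    intro i
    rw [contDiff_iff_contDiffAt]
    intro z
    by_cases hz : z ∈ K
    · exact (((hY0cd i) z (hKD hz)).contDiffAt (hD.mem_nhds (hKD hz))).congr_of_eventuallyEq (hYev i z (hKD hz))
    · exact contDiffAt_const.congr_of_eventuallyEq (hYev0 i z hz)
  have hYc : ∀ i, HasCompactSupport (Y i) := fun i =>
    HasCompactSupport.intro hK (fun z hz => hY0K i z hz)
  have hintg : ∀ i, ∀ v, Integrable fun z => fderiv ℝ (Y i) z v := by
    intro i v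
    exact (((hYcd i).continuous_fderiv (by norm_num)).clm_apply continuous_const).integrable_of_hasCompactSupport
      ((hYc i).fderiv_apply (𝕜 := ℝ) v)
  have hdzint : ∀ i v, ∫ z, dz (fderiv ℝ (Y i) z) v = 0 := by
    intro i v
    simp only [dz_apply]
    rw [integral_const_mul, integral_sub (hintg i v) ((hintg i _).const_mul _), integral_const_mul,
      integral_fderiv_eq_zero (hYcd i) (hYc i), integral_fderiv_eq_zero (hYcd i) (hYc i)]
    simp
  have hdzi : ∀ i v, Integrable fun z => dz (fderiv ℝ (Y i) z) v := by
    intro i v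
    simp only [dz_apply]
    exact ((hintg i v).sub ((hintg i _).const_mul _)).const_mul _
  have htot : ∫ z, ∑ i, dz (fderiv ℝ (Y i) z) (Pi.single i 1) = 0 := by
    rw [integral_finset_sum _ (fun i _ => hdzi i _)]
    exact Finset.sum_eq_zero fun i _ => hdzint i _
  rw [← htot, ← integral_indicator hD.measurableSet]
  refine integral_congr_ae (Eventually.of_forall fun z => ?_)
  change D.indicator _ z = _
  by_cases hz : z ∈ D
  swap
  · rw [Set.indicator_of_notMem hz]
    symm
    refine Finset.sum_eq_zero fun i _ => ?_
    rw [(hYev0 i z (fun h => hz (hKD h))).fderiv_eq]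
    simp [dz_apply]
  rw [Set.indicator_of_mem hz]
  have hFz : HasFDerivAt F (fderiv ℂ F z) z := (hF.differentiableAt (hD.mem_nhds hz)).hasFDerivAt
  have hkz : HasFDerivAt k (fderiv ℂ k z) z := (hk.differentiableAt (hD.mem_nhds hz)).hasFDerivAt
  have key : ∀ i, dz (fderiv ℝ (Y i) z) (Pi.single i 1) = ∑ j, (starRingEnd ℂ) (k z) *
      ((Jm F z).adjugate i j * (∑ l, Jm F z l i * dz (fderiv ℝ (X j) (F z)) (Pi.single l 1)) +
        X j (F z) * fderiv ℂ (fun z => (Jm F z).adjugate i j) z (Pi.single i 1)) := by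
    intro i
    rw [(hYev i z hz).fderiv_eq]
    have hterm : ∀ j, HasFDerivAt (fun z => (Jm F z).adjugate i j * X j (F z) * (starRingEnd ℂ) (k z))
        (((Jm F z).adjugate i j * X j (F z)) • ((Complex.conjCLE : ℂ →L[ℝ] ℂ) ∘L (fderiv ℂ k z).restrictScalars ℝ) +
          (starRingEnd ℂ) (k z) • ((Jm F z).adjugate i j • (fderiv ℝ (X j) (F z) ∘L (fderiv ℂ F z).restrictScalars ℝ) +
          X j (F z) • (fderiv ℂ (fun z => (Jm F z).adjugate i j) z).restrictScalars ℝ)) z := by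
      intro j
      have h1 : HasFDerivAt (fun z => (Jm F z).adjugate i j)
        ((fderiv ℂ (fun z => (Jm F z).adjugate i j) z).restrictScalars ℝ) z :=
        (((hadj i j).differentiableAt (hD.mem_nhds hz)).hasFDerivAt).restrictScalars ℝ
      have h2 : HasFDerivAt (fun z => X j (F z)) (fderiv ℝ (X j) (F z) ∘L (fderiv ℂ F z).restrictScalars ℝ) z :=
        (((hX j).differentiable (by norm_num)) (F z)).hasFDerivAt.comp z (hFz.restrictScalars ℝ)
      have h3 : HasFDerivAt (fun z => (starRingEnd ℂ) (k z))
        ((Complex.conjCLE : ℂ →L[ℝ] ℂ) ∘L (fderiv ℂ k z).restrictScalars ℝ) z :=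
        (Complex.conjCLE : ℂ →L[ℝ] ℂ).hasFDerivAt.comp z (hkz.restrictScalars ℝ)
      exact (h1.mul h2).mul h3
    have hsum := HasFDerivAt.fun_sum (u := Finset.univ) (fun j _ => hterm j)
    have : fderiv ℝ (Y0 i) z = _ := hsum.fderiv
    rw [this]
    simp only [dz_apply, ContinuousLinearMap.sum_apply, Finset.mul_sum, ← Finset.sum_sub_distrib]
    refine Finset.sum_congr rfl fun j _ => ?_
    have e1 : fderiv ℂ (fun z => (Jm F z).adjugate i j) z (Complex.I • (Pi.single i 1 : Fin n → ℂ)) =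
      Complex.I * fderiv ℂ (fun z => (Jm F z).adjugate i j) z (Pi.single i 1) := by
      rw [map_smul, smul_eq_mul]
    have e2 : fderiv ℂ k z (Complex.I • (Pi.single i 1 : Fin n → ℂ)) =
      Complex.I * fderiv ℂ k z (Pi.single i 1) := by
      rw [map_smul, smul_eq_mul]
    have e3 := dz_eq_sum (fderiv ℝ (X j) (F z)) (fderiv ℂ F z (Pi.single i 1))
    rw [dz_apply] at e3
    have e3' : ∑ l, Jm F z l i * dz (fderiv ℝ (X j) (F z)) (Pi.single l 1) = 
      (1 / 2 : ℂ) * (fderiv ℝ (X j) (F z) (fderiv ℂ F z (Pi.single i 1)) - Complex.I * fderiv ℝ (X j) (F z) (fderiv ℂ F z (Complex.I • Pi.single i 1))) := by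
      rw [map_smul, e3]
      refine Finset.sum_congr rfl fun l _ => ?_
      rw [Jm_apply]
    have e4 : ∑ l, (Jm F z).adjugate i j * (Jm F z l i * ((1 / 2 : ℂ) * (fderiv ℝ (X j) (F z) (Pi.single l 1) - Complex.I * fderiv ℝ (X j) (F z) (Complex.I • Pi.single l 1)))) = (Jm F z).adjugate i j * ∑ l, Jm F z l i * dz (fderiv ℝ (X j) (F z)) (Pi.single l 1) := by
      rw [Finset.mul_sum]; rfl
    rw [e4, e3']
    simp only [ContinuousLinearMap.add_apply, ContinuousLinearMap.smul_apply, ContinuousLinearMap.comp_apply, ContinuousLinearMap.coe_restrictScalars', e1, e2, smul_eq_mul]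
    simp only [ContinuousLinearEquiv.coe_coe, Complex.conjCLE_apply, map_mul, Complex.conj_I]
    generalize fderiv ℂ (fun z => (Jm F z).adjugate i j) z (Pi.single i 1) = a
    generalize fderiv ℂ k z (Pi.single i 1) = b
    linear_combination ((1/2 : ℂ) * (Jm F z).adjugate i j * X j (F z) * (starRingEnd ℂ) b - 
      (1/2 : ℂ) * (starRingEnd ℂ) (k z) * X j (F z) * a) * Complex.I_sq
  simp only [key]
  rw [Finset.sum_comm]
  have hfin : ∀ j, ∑ i, (starRingEnd ℂ) (k z) *
      ((Jm F z).adjugate i j * (∑ l, Jm F z l i * dz (fderiv ℝ (X j) (F z)) (Pi.single l 1)) +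
        X j (F z) * fderiv ℂ (fun z => (Jm F z).adjugate i j) z (Pi.single i 1)) =
      (starRingEnd ℂ) (k z) * ((fderiv ℂ F z).det * dz (fderiv ℝ (X j) (F z)) (Pi.single j 1)) := by
    intro j
    rw [← Finset.mul_sum, Finset.sum_add_distrib, ← Finset.mul_sum, piola hD hF hz j, mul_zero, add_zero]
    congr 1
    have h1 : ∀ l, ∑ i, Jm F z l i * (Jm F z).adjugate i j = if l = j then (fderiv ℂ F z).det else 0 := by
      intro l
      have := congrFun (congrFun (Matrix.mul_adjugate (Jm F z)) l) j
      rw [Matrix.mul_apply] at this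
      rw [this, det_Jm]
      simp [Matrix.one_apply]
    calc _ = ∑ l, (∑ i, Jm F z l i * (Jm F z).adjugate i j) * dz (fderiv ℝ (X j) (F z)) (Pi.single l 1) := by
          simp only [Finset.mul_sum, Finset.sum_mul]
          rw [Finset.sum_comm]
          refine Finset.sum_congr rfl fun l _ => Finset.sum_congr rfl fun i _ => ?_
          ring
      _ = _ := by
          simp only [h1, ite_mul, zero_mul]
          simp
  simp only [hfin]
  rw [← Finset.mul_sum, ← Finset.mul_sum]
  ring

end SymEll

namespace SymEll
open Set Filter Topology MeasureTheory Metric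

variable {n : ℕ}

lemma contDiff_param_integral {f : (Fin n → ℂ) → ℝ → ℂ} (hf : ContDiff ℝ 1 (Function.uncurry f)) (a b : ℝ) :
    ContDiff ℝ 1 (fun w => ∫ t in a..b, f w t) := by
  let f' : (Fin n → ℂ) → ℝ → ((Fin n → ℂ) →L[ℝ] ℂ) := fun w t =>
    fderiv ℝ (Function.uncurry f) (w, t) ∘L (ContinuousLinearMap.inl ℝ (Fin n → ℂ) ℝ)
  have hf'c : Continuous (Function.uncurry f') := by
    have h1 : Continuous (fderiv ℝ (Function.uncurry f)) := hf.continuous_fderiv (by norm_num)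
    have : Function.uncurry f' = fun x => fderiv ℝ (Function.uncurry f) x ∘L (ContinuousLinearMap.inl ℝ (Fin n → ℂ) ℝ) := by
      ext ⟨w, t⟩ v; rfl
    rw [this]
    exact h1.clm_comp continuous_const
  have hd : ∀ w, HasFDerivAt (fun w => ∫ t in a..b, f w t) (∫ t in a..b, f' w t) w := by
    intro w
    obtain ⟨C, hC⟩ := ((isCompact_closedBall w 1).prod (isCompact_uIcc (a := a) (b := b))).exists_bound_of_continuousOn
      hf'c.continuousOn
    have hfw : ∀ x, Continuous (f x) := fun x => hf.continuous.comp (by fun_prop : Continuous fun t : ℝ => (x, t))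
    refine intervalIntegral.hasFDerivAt_integral_of_dominated_of_fderiv_le (bound := fun _ => C)
      (closedBall_mem_nhds w one_pos) ?_ ?_ ?_ ?_ ?_ ?_
    · exact Eventually.of_forall fun x => (hfw x).aestronglyMeasurable
    · exact (hfw w).intervalIntegrable _ _
    · exact (hf'c.comp (by fun_prop : Continuous fun t : ℝ => (w, t))).aestronglyMeasurable
    · exact Eventually.of_forall fun t ht x hx => hC (x, t) ⟨hx, uIoc_subset_uIcc ht⟩
    · exact intervalIntegrable_const
    · refine Eventually.of_forall fun t ht x hx => ?_
      have h1 : HasFDerivAt (Function.uncurry f) (fderiv ℝ (Function.uncurry f) (x, t)) (x, t) :=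
        ((hf.differentiable (by norm_num)) _).hasFDerivAt
      exact HasFDerivAt.comp (f := fun x => (x, t)) x h1 (hasFDerivAt_prodMk_left x t)
  rw [contDiff_one_iff_fderiv]
  refine ⟨fun w => (hd w).differentiableAt, ?_⟩
  have : fderiv ℝ (fun w => ∫ t in a..b, f w t) = fun w => ∫ t in a..b, f' w t := funext fun w => (hd w).fderiv
  rw [this]
  exact intervalIntegral.continuous_parametric_intervalIntegral_of_continuous' hf'c a b

lemma dil_dil (a b : ℂ) (w : Fin n → ℂ) : dil a (dil b w) = dil (a * b) w := by
  funext j; simp only [dil, mul_pow]; ring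

lemma dil_one (w : Fin n → ℂ) : dil 1 w = w := by funext j; simp [dil]

/-- Euler field -/
def eu (w : Fin n → ℂ) : Fin n → ℂ := fun j => ((j.1 + 1 : ℕ) : ℂ) * w j

lemma hasDerivAt_dil_exp (c : ℂ) (w : Fin n → ℂ) :
    HasDerivAt (fun t : ℝ => dil (Complex.exp (c * t)) w) (c • eu w) 0 := by
  rw [hasDerivAt_pi]
  intro j
  have h1 : HasDerivAt (fun t : ℝ => Complex.exp (c * t)) c 0 := by
    have h2 : HasDerivAt (fun t : ℂ => Complex.exp (c * t)) c ((0 : ℝ) : ℂ) := by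
      have := ((hasDerivAt_id ((0 : ℝ) : ℂ)).const_mul c).cexp
      simpa using this
    exact h2.comp_ofReal
  have h3 := (h1.fun_pow (j.1 + 1)).mul_const (w j)
  refine h3.congr_deriv ?_
  simp [eu]
  ring

/-- the averaged identity -/
lemma bell_identity {F : (Fin n → ℂ) → (Fin n → ℂ)} {D K2 : Set (Fin n → ℂ)} (hD : IsOpen D)
    (hF : DifferentiableOn ℂ F D) (hK : IsCompact (D ∩ F ⁻¹' K2))
    (hbal : ∀ c : ℂ, ‖c‖ ≤ 1 → ∀ w ∈ K2, dil c w ∈ K2)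
    {ψ : (Fin n → ℂ) → ℂ} (hψ : ContDiff ℝ 1 ψ) (hψK : ∀ w, w ∉ K2 → ψ w = 0)
    (hinv : ∀ c : ℂ, ‖c‖ = 1 → ∀ w, ψ (dil c w) = ψ w)
    {h : (Fin n → ℂ) → ℂ} (hh : Differentiable ℂ h) {d : ℝ} (hd : ∀ w, fderiv ℂ h w (eu w) = d * h w)
    {k : (Fin n → ℂ) → ℂ} (hk : DifferentiableOn ℂ k D) :
    ∫ z in D, (fderiv ℂ F z).det * h (F z) * ((Real.exp (2 * ((∑ j : Fin n, ((j.1 + 1 : ℕ) : ℝ)) + d) * Real.log 2) : ℝ) * ψ (dil 2 (F z)) - ψ (F z)) *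
      (starRingEnd ℂ) (k z) = 0 := by
  set A : ℝ := (∑ j : Fin n, ((j.1 + 1 : ℕ) : ℝ)) + d with hA
  set S := Real.log 2 with hS
  have hS0 : 0 ≤ S := Real.log_nonneg (by norm_num)
  let g : (Fin n → ℂ) → ℝ → ℂ := fun w s => (Real.exp (2 * A * s) : ℝ) * ψ (dil (Complex.exp s) w)
  have hg : ContDiff ℝ 1 (Function.uncurry g) := by
    have h1 : ContDiff ℝ 1 fun x : (Fin n → ℂ) × ℝ => ((Real.exp (2 * A * x.2) : ℝ) : ℂ) :=
      Complex.ofRealCLM.contDiff.comp (Real.contDiff_exp.comp (contDiff_const.mul contDiff_snd))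
    have h0 : ContDiff ℝ 1 fun x : (Fin n → ℂ) × ℝ => Complex.exp (x.2 : ℂ) := by
      have : ContDiff ℝ 1 fun x : (Fin n → ℂ) × ℝ => ((x.2 : ℝ) : ℂ) := Complex.ofRealCLM.contDiff.comp contDiff_snd
      exact this.cexp
    have h2 : ContDiff ℝ 1 fun x : (Fin n → ℂ) × ℝ => dil (Complex.exp x.2) x.1 := by
      rw [contDiff_pi]
      intro j
      have h3 : ContDiff ℝ 1 fun x : (Fin n → ℂ) × ℝ => x.1 j := by fun_prop
      exact (h0.pow _).mul h3
    exact h1.mul (hψ.comp h2)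
  let Ψ : (Fin n → ℂ) → ℂ := fun w => ∫ s in (0:ℝ)..S, g w s
  have hΨ : ContDiff ℝ 1 Ψ := contDiff_param_integral hg 0 S
  have hΨinv : ∀ c : ℂ, ‖c‖ = 1 → ∀ w, Ψ (dil c w) = Ψ w := by
    intro c hc w
    refine intervalIntegral.integral_congr fun s _ => ?_
    simp only [g]
    rw [dil_dil, mul_comm (Complex.exp _) c, ← dil_dil, hinv c hc]
  have hΨK : ∀ w, w ∉ K2 → Ψ w = 0 := by
    intro w hw
    have : ∀ s ∈ uIcc (0:ℝ) S, g w s = 0 := by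
      intro s hs
      rw [uIcc_of_le hS0] at hs
      simp only [g]
      rw [hψK, mul_zero]
      intro hcon
      apply hw
      have := hbal (Complex.exp (-s)) (by rw [Complex.norm_exp]; simpa using hs.1) _ hcon
      rwa [dil_dil, ← Complex.exp_add, neg_add_cancel, Complex.exp_zero, dil_one] at this
    simp only [Ψ]
    rw [intervalIntegral.integral_congr (g := fun _ => (0:ℂ)) this]
    simp
  -- Euler derivative of Ψ
  have hE : ∀ w, dz (fderiv ℝ Ψ w) (eu w) = (1/2 : ℂ) * ((Real.exp (2 * A * S) : ℝ) * ψ (dil 2 w) - ψ w) - A * Ψ w := by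
    intro w
    have hDΨ : HasFDerivAt Ψ (fderiv ℝ Ψ w) w := ((hΨ.differentiable (by norm_num)) w).hasFDerivAt
    have hcomp : ∀ c : ℂ, HasDerivAt (fun t : ℝ => Ψ (dil (Complex.exp (c * t)) w)) (fderiv ℝ Ψ w (c • eu w)) 0 := by
      intro c
      have h1 := hasDerivAt_dil_exp c w
      refine HasFDerivAt.comp_hasDerivAt (l := Ψ) (l' := fderiv ℝ Ψ w) (f := fun t : ℝ => dil (Complex.exp (c * t)) w) (0 : ℝ) ?_ h1
      simpa [dil_one] using hDΨ
    have hI : fderiv ℝ Ψ w (Complex.I • eu w) = 0 := by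
      have h1 := hcomp Complex.I
      have h2 : (fun t : ℝ => Ψ (dil (Complex.exp (Complex.I * t)) w)) = fun _ => Ψ w := by
        funext t
        refine hΨinv _ ?_ _
        rw [mul_comm, Complex.norm_exp_ofReal_mul_I]
      rw [h2] at h1
      exact h1.unique (hasDerivAt_const _ _)
    have h1 := hcomp 1
    have hgc : Continuous (g w) := hg.continuous.comp (by fun_prop : Continuous fun t : ℝ => (w, t))
    have h2 : ∀ t : ℝ, Ψ (dil (Complex.exp (1 * t)) w) = (Real.exp (-(2 * A) * t) : ℝ) * ((∫ u in (0:ℝ)..(S + t), g w u) - ∫ u in (0:ℝ)..t, g w u) := by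
      intro t
      rw [intervalIntegral.integral_interval_sub_left (hgc.intervalIntegrable _ _) (hgc.intervalIntegrable _ _)]
      rw [← intervalIntegral.integral_const_mul]
      have := intervalIntegral.integral_comp_add_right (a := 0) (b := S) (fun u => ((Real.exp (-(2 * A) * t) : ℝ) : ℂ) * g w u) t
      rw [zero_add] at this
      rw [← this]
      refine intervalIntegral.integral_congr fun s _ => ?_
      simp only [g]
      rw [dil_dil, ← Complex.exp_add, one_mul, ← mul_assoc, ← Complex.ofReal_mul, ← Real.exp_add]
      push_cast
      congr 2
      ring_nf
    have h3 : HasDerivAt (fun t : ℝ => Ψ (dil (Complex.exp (1 * t)) w)) (-(2 * A) * Ψ w + (g w S - g w 0)) 0 := by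
      simp_rw [h2]
      have e1 : HasDerivAt (fun t : ℝ => ((Real.exp (-(2 * A) * t) : ℝ) : ℂ)) ((-(2 * A) : ℝ) : ℂ) 0 := by
        have := (((hasDerivAt_id (0:ℝ)).const_mul (-(2 * A))).exp).ofReal_comp
        simpa using this
      have e2 : HasDerivAt (fun t : ℝ => ∫ u in (0:ℝ)..t, g w u) (g w 0) 0 :=
        intervalIntegral.integral_hasDerivAt_right (hgc.intervalIntegrable _ _)
          hgc.aestronglyMeasurable.stronglyMeasurableAtFilter hgc.continuousAt
      have e3 : HasDerivAt (fun t : ℝ => ∫ u in (0:ℝ)..(S + t), g w u) (g w S) 0 := by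
        have e4 : HasDerivAt (fun t : ℝ => ∫ u in (0:ℝ)..t, g w u) (g w S) (S + 0) := by
          rw [add_zero]
          exact intervalIntegral.integral_hasDerivAt_right (hgc.intervalIntegrable _ _)
            hgc.aestronglyMeasurable.stronglyMeasurableAtFilter hgc.continuousAt
        have := e4.scomp (0:ℝ) ((hasDerivAt_id (0:ℝ)).const_add S)
        rw [one_smul] at this
        exact this
      have := e1.mul (e3.sub e2)
      refine this.congr_deriv ?_
      simp [Ψ]
    have h4 := h1.unique h3
    rw [one_smul] at h4
    rw [dz_apply, hI, h4]
    simp only [g]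
    have h5 : Complex.exp (S : ℂ) = 2 := by
      rw [← Complex.ofReal_exp, hS, Real.exp_log (by norm_num)]; norm_num
    rw [h5]
    simp only [mul_zero, Real.exp_zero, Complex.ofReal_zero, Complex.exp_zero, dil_one, Complex.ofReal_one]
    ring
  let X : Fin n → (Fin n → ℂ) → ℂ := fun j w => Ψ w * (h w * eu w j)
  have hcdh : ContDiff ℝ 1 h := by
    have := (contDiffOn_nat 1 isOpen_univ hh.differentiableOn).restrict_scalars ℝ
    rwa [contDiffOn_univ] at this
  have hceu : ∀ j, ContDiff ℝ 1 fun w : Fin n → ℂ => eu w j := by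
    intro j; unfold eu; fun_prop
  have hX : ∀ j, ContDiff ℝ 1 (X j) := fun j => hΨ.mul (hcdh.mul (hceu j))
  have := stokes hD hF hK inter_subset_left hX (fun z hz hzK j => by
    simp only [X]; rw [hΨK _ (fun hc => hzK ⟨hz, hc⟩), zero_mul]) hk
  have hdiv : ∀ w, ∑ j, dz (fderiv ℝ (X j) w) (Pi.single j 1) =
      (1/2 : ℂ) * (h w * ((Real.exp (2 * A * S) : ℝ) * ψ (dil 2 w) - ψ w)) := by
    intro w
    have hDΨ : HasFDerivAt Ψ (fderiv ℝ Ψ w) w := ((hΨ.differentiable (by norm_num)) w).hasFDerivAt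
    have hterm : ∀ j, dz (fderiv ℝ (X j) w) (Pi.single j 1) =
        h w * (eu w j * dz (fderiv ℝ Ψ w) (Pi.single j 1)) +
        Ψ w * (eu w j * fderiv ℂ h w (Pi.single j 1)) + ((j.1 + 1 : ℕ) : ℂ) * (Ψ w * h w) := by
      intro j
      have e1 : HasFDerivAt (fun w : Fin n → ℂ => eu w j) (((j.1 + 1 : ℕ) : ℂ) • (ContinuousLinearMap.proj j : (Fin n → ℂ) →L[ℂ] ℂ)) w :=
        (ContinuousLinearMap.proj (R := ℂ) (φ := fun _ : Fin n => ℂ) j).hasFDerivAt.const_mul _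
      have e2 := ((hh w).hasFDerivAt.mul e1).restrictScalars ℝ
      have e3 : fderiv ℝ (X j) w = _ := (hDΨ.mul e2).fderiv
      rw [e3]
      simp only [dz_apply, ContinuousLinearMap.add_apply, ContinuousLinearMap.smul_apply, ContinuousLinearMap.coe_restrictScalars', map_smul, smul_eq_mul, ContinuousLinearMap.proj_apply, Pi.single_eq_same, Pi.smul_apply, Pi.mul_apply]
      generalize (fderiv ℂ h w) (Pi.single j 1) = a
      linear_combination (-(1/2 : ℂ) * (Ψ w * (h w * (j.1 + 1 : ℕ) + eu w j * a))) * Complex.I_sq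
    simp only [hterm, Finset.sum_add_distrib, ← Finset.mul_sum, ← Finset.sum_mul]
    rw [← dz_eq_sum, hE]
    have e5 : ∑ j, eu w j * fderiv ℂ h w (Pi.single j 1) = fderiv ℂ h w (eu w) := by
      have := dz_eq_sum ((fderiv ℂ h w).restrictScalars ℝ) (eu w)
      simp only [dz_restrictScalars] at this
      exact this.symm
    rw [e5, hd, hA]
    push_cast
    ring
  simp only [hdiv] at this
  have h2 : ∀ z, (fderiv ℂ F z).det * (1 / 2 * (h (F z) * (((Real.exp (2 * A * S) : ℝ):ℂ) * ψ (dil 2 (F z)) - ψ (F z)))) * (starRingEnd ℂ) (k z)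
    = (1/2 : ℂ) * ((fderiv ℂ F z).det * h (F z) * (((Real.exp (2 * A * S) : ℝ):ℂ) * ψ (dil 2 (F z)) - ψ (F z)) * (starRingEnd ℂ) (k z)) := fun z => by ring
  simp only [h2] at this
  rw [integral_const_mul] at this
  simpa using this

end SymEll

namespace SymEll
open Set Filter Topology MeasureTheory Metric

variable {n : ℕ}

/-- closed sub-level sets of the symmetrized ellipsoid -/
def Eset (q s : ℝ) (n : ℕ) : Set (Fin n → ℂ) := piMap n '' {z | rho q z ≤ s}

lemma mem_Eset {q s : ℝ} {z : Fin n → ℂ} : piMap n z ∈ Eset q s n ↔ rho q z ≤ s := by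
  constructor
  · rintro ⟨a, ha, h⟩
    rw [← rho_eq_of_piMap_eq h]; exact ha
  · intro h; exact ⟨z, h, rfl⟩

lemma isCompact_Eset {q s : ℝ} (hq : 0 < q) (hs : s ≤ 1) : IsCompact (Eset q s n) :=
  (isCompact_rho_le hq hs).image continuous_piMap

lemma Eset_subset {q s : ℝ} (hs : s < 1) : Eset q s n ⊆ symEllipsoid q n := by
  rintro _ ⟨z, hz, rfl⟩
  exact ⟨z, lt_of_le_of_lt hz hs, rfl⟩

lemma Eset_dil {q s : ℝ} (hq : 0 < q) (c : ℂ) (w : Fin n → ℂ) (hw : w ∈ Eset q s n) :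
    dil c w ∈ Eset q (‖c‖ ^ (2 * q) * s) n := by
  obtain ⟨z, hz, rfl⟩ := hw
  rw [← piMap_smul, mem_Eset, rho_smul]
  exact mul_le_mul_of_nonneg_left hz (by positivity)

lemma Eset_mono {q s t : ℝ} (h : s ≤ t) : Eset q s n ⊆ Eset q t n := by
  rintro _ ⟨z, hz, rfl⟩
  exact ⟨z, le_trans hz h, rfl⟩

lemma Eset_bal {q s : ℝ} (hq : 0 < q) (c : ℂ) (hc : ‖c‖ ≤ 1) (w : Fin n → ℂ)
    (hw : w ∈ Eset q s n) : dil c w ∈ Eset q s n := by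
  obtain ⟨z, hz, rfl⟩ := hw
  rw [← piMap_smul, mem_Eset, rho_smul]
  refine le_trans ?_ hz
  refine mul_le_of_le_one_left (rho_nonneg _ _) ?_
  exact Real.rpow_le_one (norm_nonneg _) hc (by positivity)

lemma exists_bump {q s : ℝ} (hq : 0 < q) (hs : s < 1) :
    ∃ χ : (Fin n → ℂ) → ℝ, (∀ w, 0 ≤ χ w) ∧ (∀ w, χ w ≤ 1) ∧ (∀ w ∈ Eset q s n, χ w = 1) ∧
      (∀ w, w ∉ Eset q ((s + 1) / 2) n → χ w = 0) ∧ (∀ c : ℂ, ‖c‖ = 1 → ∀ w, χ (dil c w) = χ w) ∧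
      ContDiff ℝ 1 (fun w => (χ w : ℂ)) := by
  set s' := (s + 1) / 2 with hs'
  have hss' : s < s' := by rw [hs']; linarith
  have hs'1 : s' < 1 := by rw [hs']; linarith
  let T : Set (Fin n → ℂ) := piMap n '' {z | s' ≤ rho q z}
  have hT : IsClosed T := isClosedMap_piMap _ (isClosed_le continuous_const (continuous_rho hq))
  have hTmem : ∀ z, piMap n z ∈ T ↔ s' ≤ rho q z := by
    intro z
    constructor
    · rintro ⟨a, ha, h⟩
      rw [← rho_eq_of_piMap_eq h]; exact ha
    · intro h; exact ⟨z, h, rfl⟩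
  have hdisj : Disjoint T (Eset q s n) := by
    rw [Set.disjoint_left]
    intro w hw hw'
    obtain ⟨z, rfl⟩ := piMap_surjective w
    rw [hTmem] at hw
    rw [mem_Eset] at hw'
    linarith
  obtain ⟨f, hf0, hf1, hf⟩ := exists_contMDiffMap_zero_one_of_isClosed (n := 1) (modelWithCornersSelf ℝ (Fin n → ℂ)) hT
    (isCompact_Eset hq hs.le).isClosed hdisj
  have hfc : ContDiff ℝ 1 f := by
    have := f.contMDiff
    rw [contMDiff_iff_contDiff] at this
    exact this
  have hdilc : ∀ w : Fin n → ℂ, Continuous fun θ : ℝ => dil (Complex.exp (θ * Complex.I)) w := by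
    intro w
    unfold dil
    fun_prop
  have hcont : ∀ w : Fin n → ℂ, Continuous fun θ : ℝ => f (dil (Complex.exp (θ * Complex.I)) w) :=
    fun w => hfc.continuous.comp (hdilc w)
  have hπ : (0:ℝ) ≤ 2 * Real.pi := by positivity
  have hnorm : ∀ θ : ℝ, ‖Complex.exp (θ * Complex.I)‖ = 1 := Complex.norm_exp_ofReal_mul_I
  let χ : (Fin n → ℂ) → ℝ := fun w => (2 * Real.pi)⁻¹ * ∫ θ in (0:ℝ)..2 * Real.pi, f (dil (Complex.exp (θ * Complex.I)) w)
  refine ⟨χ, ?_, ?_, ?_, ?_, ?_, ?_⟩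
  · intro w
    refine mul_nonneg (by positivity) (intervalIntegral.integral_nonneg hπ fun θ _ => (hf _).1)
  · intro w
    have h1 := intervalIntegral.integral_mono_on (a := 0) (b := 2 * Real.pi) (μ := volume) hπ ((hcont w).intervalIntegrable _ _)
      (intervalIntegrable_const (c := (1:ℝ))) (fun θ _ => (hf _).2)
    rw [intervalIntegral.integral_const] at h1
    calc χ w ≤ (2 * Real.pi)⁻¹ * (2 * Real.pi) := by
          refine mul_le_mul_of_nonneg_left (by simpa using h1) (by positivity)
      _ = 1 := by field_simp
  · intro w hw
    have : ∀ θ ∈ uIcc (0:ℝ) (2 * Real.pi), f (dil (Complex.exp (θ * Complex.I)) w) = 1 := by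
      intro θ _
      exact hf1 (Eset_bal hq _ (hnorm θ).le w hw)
    simp only [χ]
    rw [intervalIntegral.integral_congr (g := fun _ => (1:ℝ)) this, intervalIntegral.integral_const]
    simp
    field_simp
  · intro w hw
    have : ∀ θ ∈ uIcc (0:ℝ) (2 * Real.pi), f (dil (Complex.exp (θ * Complex.I)) w) = 0 := by
      intro θ _
      refine hf0 ?_
      obtain ⟨z, rfl⟩ := piMap_surjective w
      rw [← piMap_smul, hTmem, rho_smul, hnorm]
      rw [mem_Eset] at hw
      push Not at hw
      simpa using hw.le
    simp only [χ]
    rw [intervalIntegral.integral_congr (g := fun _ => (0:ℝ)) this, intervalIntegral.integral_const]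
    simp
  · intro c hc w
    have hc2 : c = Complex.exp (c.arg * Complex.I) := by
      have := Complex.norm_mul_exp_arg_mul_I c
      rw [hc] at this
      simpa using this.symm
    have hper : Function.Periodic (fun θ : ℝ => f (dil (Complex.exp (θ * Complex.I)) w)) (2 * Real.pi) := by
      intro θ
      have : Complex.exp (((θ + 2 * Real.pi : ℝ) : ℂ) * Complex.I) = Complex.exp (θ * Complex.I) := by
        push_cast
        rw [add_mul]
        exact Complex.exp_periodic _
      simp only [this]
    have h1 := hper.intervalIntegral_add_eq c.arg 0
    simp only [χ]
    congr 1
    rw [zero_add] at h1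
    rw [← h1]
    have := intervalIntegral.integral_comp_add_right (a := 0) (b := 2 * Real.pi) (fun θ : ℝ => f (dil (Complex.exp (θ * Complex.I)) w)) c.arg
    rw [zero_add, add_comm (2 * Real.pi)] at this
    rw [← this]
    refine intervalIntegral.integral_congr fun θ _ => ?_
    rw [dil_dil]
    congr 2
    conv_lhs => rw [hc2]
    rw [← Complex.exp_add]
    congr 1
    push_cast
    ring
  · have h0 : ContDiff ℝ 1 fun x : (Fin n → ℂ) × ℝ => Complex.exp ((x.2 : ℂ) * Complex.I) := by
      have : ContDiff ℝ 1 fun x : (Fin n → ℂ) × ℝ => ((x.2 : ℝ) : ℂ) := Complex.ofRealCLM.contDiff.comp contDiff_snd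
      exact (this.mul contDiff_const).cexp
    have h2 : ContDiff ℝ 1 fun x : (Fin n → ℂ) × ℝ => dil (Complex.exp (x.2 * Complex.I)) x.1 := by
      rw [contDiff_pi]
      intro j
      have h3 : ContDiff ℝ 1 fun x : (Fin n → ℂ) × ℝ => x.1 j := by fun_prop
      exact (h0.pow _).mul h3
    have h4 := contDiff_param_integral (f := fun w θ => ((f (dil (Complex.exp (θ * Complex.I)) w) : ℝ) : ℂ))
      (Complex.ofRealCLM.contDiff.comp (hfc.comp h2)) 0 (2 * Real.pi)
    have h5 : (fun w => (χ w : ℂ)) = fun w => ((2 * Real.pi)⁻¹ : ℂ) * ∫ θ in (0:ℝ)..2 * Real.pi, ((f (dil (Complex.exp (θ * Complex.I)) w) : ℝ) : ℂ) := by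
      funext w
      simp only [χ]
      rw [intervalIntegral.integral_ofReal]
      push_cast
      rfl
    rw [h5]
    exact contDiff_const.mul h4

lemma integrableOn_of_compact_zero {D K : Set (Fin n → ℂ)} (hD : IsOpen D) (hK : IsCompact K)
    (hKD : K ⊆ D) {f : (Fin n → ℂ) → ℂ} (hf : ContinuousOn f D) (h0 : ∀ z ∈ D, z ∉ K → f z = 0) :
    IntegrableOn f D :=
  ((hf.mono hKD).integrableOn_compact hK).of_forall_diff_eq_zero hD.measurableSet
    (fun z hz => h0 z hz.1 hz.2)

lemma bell_bound {q : ℝ} (hq : 0 < q) {F : (Fin n → ℂ) → (Fin n → ℂ)} {D : Set (Fin n → ℂ)}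
    (hD : IsOpen D) (hDf : volume D < ⊤) (hF : IsProperHolomorphic F D (symEllipsoid q n))
    {h : (Fin n → ℂ) → ℂ} (hh : Differentiable ℂ h) {d : ℝ} (hd : ∀ w, fderiv ℂ h w (eu w) = d * h w) :
    ∃ K ⊆ D, IsCompact K ∧ ∃ C : ℝ, IntegrableOn (fun z => (fderiv ℂ F z).det * h (F z)) D ∧
      ∀ k : (Fin n → ℂ) → ℂ, DifferentiableOn ℂ k D → ∀ M' : ℝ, (∀ z ∈ D, ‖k z‖ ≤ M') →
        ∀ M : ℝ, (∀ z ∈ K, ‖k z‖ ≤ M) →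
        ‖∫ z in D, (fderiv ℂ F z).det * h (F z) * (starRingEnd ℂ) (k z)‖ ≤ C * M := by
  obtain ⟨hFd, hFm, hFp⟩ := hF
  set c0 : ℝ := Real.exp (2 * ((∑ j : Fin n, ((j.1 + 1 : ℕ) : ℝ)) + d) * Real.log 2) with hc0
  set s0 : ℝ := (1 / 2 : ℝ) ^ (2 * q) with hs0
  have hs01 : s0 < 1 := Real.rpow_lt_one (by norm_num) (by norm_num) (by positivity)
  set K : Set (Fin n → ℂ) := D ∩ F ⁻¹' (Eset q s0 n) with hK
  have hKc : IsCompact K := hFp _ (Eset_subset hs01) (isCompact_Eset hq hs01.le)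
  have hKD : K ⊆ D := inter_subset_left
  set G : (Fin n → ℂ) → ℂ := fun z => (fderiv ℂ F z).det * h (F z) with hG
  have hGd : DifferentiableOn ℂ G D :=
    (differentiableOn_clm_det (differentiableOn_fderiv hD hFd)).mul (hh.comp_differentiableOn hFd)
  let s : ℕ → ℝ := fun m => 1 - 1 / ((m : ℝ) + 1)
  have hs1 : ∀ m, s m < 1 := fun m => by
    have : (0:ℝ) < 1 / ((m : ℝ) + 1) := by positivity
    simp only [s]; linarith
  have hslim : Tendsto s atTop (𝓝 1) := by
    have := tendsto_one_div_add_atTop_nhds_zero_nat (𝕜 := ℝ)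
    simpa [s] using this.const_sub 1
  choose χ hχ0 hχ1 hχ2 hχ3 hχ4 hχ5 using fun m => exists_bump (n := n) hq (hs1 m)
  have hs'1 : ∀ m, (s m + 1) / 2 < 1 := fun m => by linarith [hs1 m]
  let K' : ℕ → Set (Fin n → ℂ) := fun m => D ∩ F ⁻¹' (Eset q ((s m + 1) / 2) n)
  have hK'c : ∀ m, IsCompact (K' m) := fun m => hFp _ (Eset_subset (hs'1 m)) (isCompact_Eset hq (hs'1 m).le)
  have hχK : ∀ m, ∀ z ∈ D, z ∉ K → χ m (dil 2 (F z)) = 0 := by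
    intro m z hz hzK
    refine hχ3 m _ fun hcon => hzK ⟨hz, ?_⟩
    have := Eset_dil hq (1/2) _ (Eset_mono (hs'1 m).le hcon)
    rw [dil_dil] at this
    norm_num [dil_one] at this
    rw [Set.mem_preimage, hs0]
    norm_num
    exact this
  have hχK' : ∀ m, ∀ z ∈ D, z ∉ K' m → χ m (F z) = 0 := by
    intro m z hz hzK
    exact hχ3 m _ fun hcon => hzK ⟨hz, hcon⟩
  have hc1 : ∀ m, ContinuousOn (fun z => (χ m (F z) : ℂ)) D := fun m =>
    (hχ5 m).continuous.comp_continuousOn hFd.continuousOn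
  have hc2 : ∀ m, ContinuousOn (fun z => (χ m (dil 2 (F z)) : ℂ)) D := fun m => by
    have : Continuous fun w : Fin n → ℂ => dil 2 w := by unfold dil; fun_prop
    exact ((hχ5 m).continuous.comp this).comp_continuousOn hFd.continuousOn
  have hcconj : ∀ k : (Fin n → ℂ) → ℂ, DifferentiableOn ℂ k D → ContinuousOn (fun z => (starRingEnd ℂ) (k z)) D :=
    fun k hk => Complex.continuous_conj.comp_continuousOn hk.continuousOn
  have hi1 : ∀ m, ∀ k : (Fin n → ℂ) → ℂ, DifferentiableOn ℂ k D →
      IntegrableOn (fun z => G z * χ m (F z) * (starRingEnd ℂ) (k z)) D := by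
    intro m k hk
    refine integrableOn_of_compact_zero hD (hK'c m) inter_subset_left
      ((hGd.continuousOn.mul (hc1 m)).mul (hcconj k hk)) fun z hz hzK => ?_
    rw [hχK' m z hz hzK]; simp
  have hi2 : ∀ m, ∀ k : (Fin n → ℂ) → ℂ, DifferentiableOn ℂ k D →
      IntegrableOn (fun z => G z * χ m (dil 2 (F z)) * (starRingEnd ℂ) (k z)) D := by
    intro m k hk
    refine integrableOn_of_compact_zero hD hKc hKD
      ((hGd.continuousOn.mul (hc2 m)).mul (hcconj k hk)) fun z hz hzK => ?_
    rw [hχK m z hz hzK]; simp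
  have hid : ∀ m, ∀ k : (Fin n → ℂ) → ℂ, DifferentiableOn ℂ k D →
      ∫ z in D, G z * χ m (F z) * (starRingEnd ℂ) (k z) =
        c0 * ∫ z in K, G z * χ m (dil 2 (F z)) * (starRingEnd ℂ) (k z) := by
    intro m k hk
    have h1 := bell_identity hD hFd (hK'c m) (fun c hc w hw => Eset_bal hq c hc w hw) (hχ5 m)
      (fun w hw => by rw [hχ3 m w hw]; simp) (fun c hc w => by rw [hχ4 m c hc]) hh hd hk
    have h2 : ∀ z, (fderiv ℂ F z).det * h (F z) * ((c0 : ℂ) * (χ m (dil 2 (F z)) : ℂ) - (χ m (F z) : ℂ)) * (starRingEnd ℂ) (k z)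
      = c0 * (G z * χ m (dil 2 (F z)) * (starRingEnd ℂ) (k z)) - G z * χ m (F z) * (starRingEnd ℂ) (k z) := by
      intro z; simp only [hG]; ring
    simp only [← hc0, h2] at h1
    rw [integral_sub ((hi2 m k hk).const_mul _) (hi1 m k hk), integral_const_mul] at h1
    rw [← sub_eq_zero.1 h1]
    congr 1
    refine setIntegral_eq_of_subset_of_forall_diff_eq_zero hD.measurableSet hKD fun z hz => ?_
    rw [hχK m z hz.1 hz.2]; simp
  have hGK : IntegrableOn (fun z => ‖G z‖) K := ((hGd.continuousOn.mono hKD).norm).integrableOn_compact hKc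
  have hGK2 : IntegrableOn (fun z => ‖G z‖ ^ 2) K := (((hGd.continuousOn.mono hKD).norm).pow 2).integrableOn_compact hKc
  have hnc0 : ‖(c0 : ℂ)‖ = c0 := by
    rw [Complex.norm_real, Real.norm_of_nonneg (Real.exp_pos _).le]
  have hbd : ∀ m, ∀ k : (Fin n → ℂ) → ℂ, DifferentiableOn ℂ k D → 
      ‖∫ z in D, G z * χ m (F z) * (starRingEnd ℂ) (k z)‖ ≤ c0 * ∫ z in K, ‖G z‖ * ‖k z‖ := by
    intro m k hk
    rw [hid m k hk, norm_mul, hnc0]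
    refine mul_le_mul_of_nonneg_left ?_ (Real.exp_pos _).le
    refine norm_integral_le_of_norm_le ?_ ?_
    · exact (((hGd.continuousOn.mono hKD).norm).mul ((hk.continuousOn.mono hKD).norm)).integrableOn_compact hKc
    · refine Eventually.of_forall fun z => ?_
      rw [norm_mul, norm_mul, RCLike.norm_conj, Complex.norm_real, Real.norm_of_nonneg (hχ0 _ _)]
      refine mul_le_mul_of_nonneg_right ?_ (norm_nonneg _)
      exact mul_le_of_le_one_right (norm_nonneg _) (hχ1 _ _)
  let φ : ℕ → Set (Fin n → ℂ) := fun m => D ∩ F ⁻¹' (Eset q (s m) n)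
  have hφc : ∀ m, IsCompact (φ m) := fun m => hFp _ (Eset_subset (hs1 m)) (isCompact_Eset hq (hs1 m).le)
  have hφev : ∀ z ∈ D, ∀ᶠ m in atTop, z ∈ φ m := by
    intro z hz
    obtain ⟨a, ha, haz⟩ := hFm hz
    have : ∀ᶠ m in atTop, rho q a < s m := hslim.eventually (lt_mem_nhds ha)
    filter_upwards [this] with m hm
    refine ⟨hz, ?_⟩
    rw [Set.mem_preimage, ← haz, mem_Eset]
    exact hm.le
  have hcov : AECover (volume.restrict D) atTop φ :=
    { ae_eventually_mem := (ae_restrict_iff' hD.measurableSet).2 (Eventually.of_forall hφev)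
      measurableSet := fun m => (hφc m).measurableSet }
  have hGsm : AEStronglyMeasurable G (volume.restrict D) := hGd.continuousOn.aestronglyMeasurable hD.measurableSet
  have hG2 : IntegrableOn (fun z => ‖G z‖ ^ 2) D := by
    refine hcov.integrable_of_integral_norm_bounded (c0 * ∫ z in K, ‖G z‖ * ‖G z‖) ?_ ?_
    · intro m
      have : IntegrableOn (fun z => ‖G z‖ ^ 2) (φ m) := (((hGd.continuousOn.mono inter_subset_left).norm).pow 2).integrableOn_compact (hφc m)
      exact Integrable.mono_measure this (Measure.restrict_mono_measure Measure.restrict_le_self _)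
    · refine Eventually.of_forall fun m => ?_
      refine le_trans ?_ (hbd m G hGd)
      have e1 : ∀ z, G z * χ m (F z) * (starRingEnd ℂ) (G z) = ((‖G z‖ ^ 2 * χ m (F z) : ℝ) : ℂ) := by
        intro z
        rw [mul_right_comm, Complex.mul_conj, Complex.normSq_eq_norm_sq]
        push_cast; rfl
      have hintg : IntegrableOn (fun z => ‖G z‖ ^ 2 * χ m (F z)) D := by
        have := (hi1 m G hGd).re
        refine this.congr (Eventually.of_forall fun z => ?_)
        change RCLike.re (G z * χ m (F z) * (starRingEnd ℂ) (G z)) = _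
        rw [e1]; exact RCLike.ofReal_re (K := ℂ) _
      simp only [e1]
      have e2 : ∫ z in D, ((‖G z‖ ^ 2 * χ m (F z) : ℝ) : ℂ) = ((∫ z in D, ‖G z‖ ^ 2 * χ m (F z) : ℝ) : ℂ) := integral_ofReal
      rw [e2]
      refine le_trans ?_ (le_abs_self _ |>.trans (by rw [← Real.norm_eq_abs]; exact (Complex.norm_real _).ge))
      rw [Measure.restrict_restrict (hφc m).measurableSet, inter_eq_self_of_subset_left (inter_subset_left : φ m ⊆ D)]
      calc ∫ z in φ m, ‖‖G z‖ ^ 2‖ = ∫ z in φ m, ‖G z‖ ^ 2 * χ m (F z) := by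
            refine setIntegral_congr_fun (hφc m).measurableSet fun z hz => ?_
            rw [hχ2 m _ hz.2, mul_one, Real.norm_of_nonneg (by positivity)]
        _ ≤ _ := by
            refine setIntegral_mono_set hintg ?_ (Eventually.of_forall (inter_subset_left : φ m ⊆ D))
            exact Eventually.of_forall fun z => mul_nonneg (by positivity) (hχ0 _ _)
  have hGi : IntegrableOn G D := by
    have h1 : IntegrableOn (fun _ : Fin n → ℂ => (1:ℝ)) D := integrableOn_const hDf.ne
    refine Integrable.mono' (h1.add hG2) hGsm (Eventually.of_forall fun z => ?_)
    simp only [Pi.add_apply]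
    nlinarith [sq_nonneg (‖G z‖ - 1), norm_nonneg (G z)]
  refine ⟨K, hKD, hKc, c0 * ∫ z in K, ‖G z‖, hGi, ?_⟩
  intro k hk M' hM' M hM
  have hlim : Tendsto (fun m => ∫ z in D, G z * χ m (F z) * (starRingEnd ℂ) (k z)) atTop
      (𝓝 (∫ z in D, G z * (starRingEnd ℂ) (k z))) := by
    refine tendsto_integral_of_dominated_convergence (fun z => ‖G z‖ * M') (fun m => (hi1 m k hk).1)
      (hGi.norm.mul_const _) ?_ ?_
    · intro m
      refine (ae_restrict_iff' hD.measurableSet).2 (Eventually.of_forall fun z hz => ?_)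
      rw [norm_mul, norm_mul, RCLike.norm_conj, Complex.norm_real, Real.norm_of_nonneg (hχ0 _ _)]
      refine mul_le_mul ?_ (hM' z hz) (norm_nonneg _) (norm_nonneg _)
      exact mul_le_of_le_one_right (norm_nonneg _) (hχ1 _ _)
    · refine (ae_restrict_iff' hD.measurableSet).2 (Eventually.of_forall fun z hz => ?_)
      refine tendsto_const_nhds.congr' ?_
      filter_upwards [hφev z hz] with m hm
      rw [hχ2 m _ hm.2]; simp
  refine le_of_tendsto hlim.norm (Eventually.of_forall fun m => (hbd m k hk).trans ?_)
  rw [mul_assoc]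
  refine mul_le_mul_of_nonneg_left ?_ (Real.exp_pos _).le
  rw [← integral_mul_const]
  refine setIntegral_mono_on ?_ (hGK.mul_const _) hKc.measurableSet fun z hz => mul_le_mul_of_nonneg_left (hM z hz) (norm_nonneg _)
  exact (((hGd.continuousOn.mono hKD).norm).mul ((hk.continuousOn.mono hKD).norm)).integrableOn_compact hKc

end SymEll

namespace SymEll
open Set Filter Topology MeasureTheory Metric

variable {n : ℕ}

/-- homogeneous component of degree `m` of the Taylor expansion at 0 -/
noncomputable def hom (G : (Fin n → ℂ) → ℂ) (m : ℕ) (z : Fin n → ℂ) : ℂ :=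
  ((m.factorial : ℂ))⁻¹ * iteratedFDeriv ℂ m G 0 (fun _ => z)

lemma hom_smul (G : (Fin n → ℂ) → ℂ) (m : ℕ) (c : ℂ) (z : Fin n → ℂ) :
    hom G m (c • z) = c ^ m * hom G m z := by
  unfold hom
  have := (iteratedFDeriv ℂ m G 0).map_smul_univ (fun _ => c) (fun _ => z)
  rw [this]
  simp
  ring

lemma hom_diff (G : (Fin n → ℂ) → ℂ) (m : ℕ) : Differentiable ℂ (hom G m) := by
  unfold hom
  have h1 : Differentiable ℂ (iteratedFDeriv ℂ m G 0) :=
    ((iteratedFDeriv ℂ m G 0).contDiff (n := 1)).differentiable (by norm_num)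
  have h2 : Differentiable ℂ (fun z : Fin n → ℂ => (fun _ : Fin m => z)) := by fun_prop
  exact (h1.comp h2).const_mul _

lemma hom_iter {G : (Fin n → ℂ) → ℂ} {D : Set (Fin n → ℂ)} (hD : IsOpen D) (h0 : (0 : Fin n → ℂ) ∈ D)
    (hG : DifferentiableOn ℂ G D) (m : ℕ) (z : Fin n → ℂ) :
    iteratedDeriv m (fun c : ℂ => G (c • z)) 0 = iteratedFDeriv ℂ m G 0 (fun _ => z) := by
  set g : ℂ →L[ℂ] (Fin n → ℂ) := ContinuousLinearMap.toSpanSingleton ℂ z with hg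
  have hg0 : g 0 = 0 := map_zero g
  have hO : IsOpen (g ⁻¹' D) := hD.preimage g.continuous
  have hx : g 0 ∈ D := by rw [hg0]; exact h0
  have h := g.iteratedFDerivWithin_comp_right (contDiffOn_nat m hD hG) hD.uniqueDiffOn
    hO.uniqueDiffOn hx (i := m) le_rfl
  rw [iteratedFDerivWithin_of_isOpen m hO hx, iteratedFDerivWithin_of_isOpen m hD hx, hg0] at h
  rw [iteratedDeriv_eq_iteratedFDeriv]
  have h3 : (fun c : ℂ => G (c • z)) = G ∘ g := by ext c; simp [hg]
  rw [h3, h]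
  simp [hg, ContinuousMultilinearMap.compContinuousLinearMap_apply]

lemma hom_hasSum {G : (Fin n → ℂ) → ℂ} {D : Set (Fin n → ℂ)} (hD : IsOpen D) (h0 : (0 : Fin n → ℂ) ∈ D)
    (hG : DifferentiableOn ℂ G D) {z : Fin n → ℂ} {r : ℝ} (hr : 1 < r)
    (hz : ∀ c : ℂ, ‖c‖ < r → c • z ∈ D) : HasSum (fun m => hom G m z) (G z) := by
  have hd : DifferentiableOn ℂ (fun c : ℂ => G (c • z)) (ball 0 r) := by
    refine hG.comp (by fun_prop) ?_
    intro c hc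
    exact hz c (by simpa using hc)
  have h := Complex.hasSum_taylorSeries_on_ball (c := 0) (r := r) (f := fun c : ℂ => G (c • z)) hd (z := 1)
    (by simpa using hr)
  simp only [one_smul] at h
  have h2 : ∀ m, hom G m z = ((m.factorial : ℂ))⁻¹ • ((1:ℂ) - 0) ^ m • iteratedDeriv m (fun c : ℂ => G (c • z)) 0 := by
    intro m
    rw [hom_iter hD h0 hG]
    simp [hom]
  simp_rw [h2]
  exact h

lemma hom_circle {G : (Fin n → ℂ) → ℂ} {D : Set (Fin n → ℂ)} (hD : IsOpen D) (h0 : (0 : Fin n → ℂ) ∈ D)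
    (hG : DifferentiableOn ℂ G D) {z : Fin n → ℂ}
    (hz : ∀ c : ℂ, ‖c‖ ≤ 1 → c • z ∈ D) (m : ℕ) :
    ∫ θ in (0:ℝ)..2 * Real.pi, G (Complex.exp (θ * Complex.I) • z) *
      (starRingEnd ℂ) (Complex.exp (θ * Complex.I) ^ m) = 2 * Real.pi * hom G m z := by
  have hd : DifferentiableOn ℂ (fun c : ℂ => G (c • z)) {c | c • z ∈ D} := by
    refine hG.comp (by fun_prop) ?_
    intro c hc
    exact hc
  have hO : IsOpen {c : ℂ | c • z ∈ D} := hD.preimage (by fun_prop)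
  have h := Complex.circleIntegral_one_div_sub_center_pow_smul_of_differentiable_on_off_countable
    (f := fun c : ℂ => G (c • z)) (c := 0) (R := 1) one_pos m (s := ∅) countable_empty
    (hd.continuousOn.mono fun c hc => hz c (by simpa using hc))
    (fun c hc => (hd c (hz c (by have := hc.1; simp at this; exact this.le))).differentiableAt
      (hO.mem_nhds (hz c (by have := hc.1; simp at this; exact this.le))))
  rw [hom_iter hD h0 hG] at h
  rw [circleIntegral] at h
  have h2 : ∀ θ : ℝ, deriv (circleMap 0 1) θ • (fun c : ℂ => (1 / (c - 0) ^ (m + 1)) • G (c • z)) (circleMap 0 1 θ)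
      = Complex.I * (G (Complex.exp (θ * Complex.I) • z) *
      (starRingEnd ℂ) (Complex.exp (θ * Complex.I) ^ m)) := by
    intro θ
    have hne := Complex.exp_ne_zero (θ * Complex.I)
    have hc : (starRingEnd ℂ) (Complex.exp (θ * Complex.I)) = (Complex.exp (θ * Complex.I))⁻¹ := by
      rw [← Complex.exp_conj, ← Complex.exp_neg]; simp
    simp only [deriv_circleMap, circleMap, map_pow, hc, smul_eq_mul]
    simp
    field_simp
    ring
  have h3 := intervalIntegral.integral_congr (μ := volume) (a := 0) (b := 2 * Real.pi) (fun θ _ => h2 θ)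
  rw [h3, intervalIntegral.integral_const_mul] at h
  have hI := Complex.I_ne_zero
  apply mul_left_cancel₀ hI
  rw [h]
  simp [hom]
  ring

lemma mp_rot (c : ℂ) (hc : ‖c‖ = 1) :
    MeasurePreserving (fun z : Fin n → ℂ => c • z) volume volume := by
  have h1 : MeasurePreserving (fun z : ℂ => c * z) volume volume := by
    have := (rotation (⟨c, by simpa [Submonoid.unitSphere] using hc⟩ : Circle)).measurePreserving
    exact this
  exact MeasureTheory.volume_preserving_pi (fun _ : Fin n => h1)

lemma rot_avg {S : Set (Fin n → ℂ)} (hS : IsOpen S) (hrot : ∀ c : ℂ, ‖c‖ = 1 → ∀ z, c • z ∈ S ↔ z ∈ S)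
    {H : (Fin n → ℂ) → ℂ} (hi : IntegrableOn H S) (hc : ContinuousOn H S) :
    (2 * Real.pi : ℂ) * ∫ z in S, H z =
      ∫ z in S, ∫ θ in (0:ℝ)..2 * Real.pi, H (Complex.exp (θ * Complex.I) • z) := by
  have hmp : ∀ θ : ℝ, MeasurePreserving (fun z : Fin n → ℂ => Complex.exp (θ * Complex.I) • z)
      (volume.restrict S) (volume.restrict S) := by
    intro θ
    have h1 := (mp_rot (n := n) (Complex.exp (θ * Complex.I)) (Complex.norm_exp_ofReal_mul_I θ)).restrict_preimage
      hS.measurableSet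
    have h2 : (fun z : Fin n → ℂ => Complex.exp (θ * Complex.I) • z) ⁻¹' S = S := by
      ext z; exact hrot _ (Complex.norm_exp_ofReal_mul_I θ) z
    rwa [h2] at h1
  have hme : ∀ θ : ℝ, MeasurableEmbedding (fun z : Fin n → ℂ => Complex.exp (θ * Complex.I) • z) := by
    intro θ
    exact (Homeomorph.smulOfNeZero _ (Complex.exp_ne_zero (θ * Complex.I))).measurableEmbedding
  have hval : ∀ θ : ℝ, ∫ z in S, H (Complex.exp (θ * Complex.I) • z) = ∫ z in S, H z := fun θ =>
    (hmp θ).integral_comp (hme θ) H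
  have hval2 : ∀ θ : ℝ, ∫ z in S, ‖H (Complex.exp (θ * Complex.I) • z)‖ = ∫ z in S, ‖H z‖ := fun θ =>
    (hmp θ).integral_comp (hme θ) (fun z => ‖H z‖)
  simp_rw [intervalIntegral.integral_of_le Real.two_pi_pos.le]
  have hintg : Integrable (Function.uncurry fun (θ : ℝ) (z : Fin n → ℂ) => H (Complex.exp (θ * Complex.I) • z))
      ((volume.restrict (Ioc 0 (2 * Real.pi))).prod (volume.restrict S)) := by
    have hmeas : AEStronglyMeasurable (Function.uncurry fun (θ : ℝ) (z : Fin n → ℂ) => H (Complex.exp (θ * Complex.I) • z))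
      ((volume.restrict (Ioc 0 (2 * Real.pi))).prod (volume.restrict S)) := by
      rw [Measure.prod_restrict]
      refine ContinuousOn.aestronglyMeasurable ?_ (measurableSet_Ioc.prod hS.measurableSet)
      refine hc.comp (f := fun x : ℝ × (Fin n → ℂ) => Complex.exp (x.1 * Complex.I) • x.2) (by fun_prop) ?_
      rintro ⟨θ, z⟩ hx
      exact (hrot _ (Complex.norm_exp_ofReal_mul_I θ) z).2 hx.2
    rw [integrable_prod_iff hmeas]
    refine ⟨Eventually.of_forall fun θ => ?_, ?_⟩
    · exact (hmp θ).integrable_comp_of_integrable hi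
    · simp only [Function.uncurry_apply_pair]
      simp_rw [hval2]
      exact integrable_const _
  rw [← integral_integral_swap hintg]
  simp_rw [hval]
  rw [integral_const]
  simp [Real.two_pi_pos.le]

lemma exists_ball_of_compact {K D : Set (Fin n → ℂ)} (hK : IsCompact K) (hD : IsOpen D) (h : K ⊆ D) :
    ∃ δ > 0, ∀ z ∈ K, ball z δ ⊆ D := by
  obtain ⟨δ, h0, h1⟩ := hK.exists_thickening_subset_open hD h
  exact ⟨δ, h0, fun z hz => (ball_subset_thickening hz δ).trans h1⟩

lemma exists_smul_of_compact {K D : Set (Fin n → ℂ)} (hK : IsCompact K) (hD : IsOpen D) (h : K ⊆ D) :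
    ∃ t : ℝ, 1 < t ∧ ∀ z ∈ K, (t : ℂ) • z ∈ D := by
  obtain ⟨δ, h0, h1⟩ := exists_ball_of_compact hK hD h
  obtain ⟨B, hB⟩ := hK.isBounded.exists_norm_le
  have hB1 : 0 < |B| + 1 := by positivity
  refine ⟨1 + δ / 2 / (|B| + 1), by linarith [show 0 < δ / 2 / (|B| + 1) by positivity], fun z hz => h1 z hz ?_⟩
  rw [mem_ball_iff_norm]
  have : ((1 + δ / 2 / (|B| + 1) : ℝ) : ℂ) • z - z = ((δ / 2 / (|B| + 1) : ℝ) : ℂ) • z := by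
    push_cast; module
  rw [this, norm_smul, Complex.norm_real, Real.norm_of_nonneg (by positivity)]
  have h3 : ‖z‖ ≤ |B| + 1 := (hB z hz).trans ((le_abs_self B).trans (by linarith))
  calc δ / 2 / (|B| + 1) * ‖z‖ ≤ δ / 2 / (|B| + 1) * (|B| + 1) := by gcongr
    _ = δ / 2 := by field_simp
    _ < δ := by linarith

lemma mean_ball {g : (Fin n → ℂ) → ℂ} (hg : Differentiable ℂ g) {δ : ℝ} (hδ : 0 < δ) :
    ∫ w in ball (0 : Fin n → ℂ) δ, g w = (volume (ball (0 : Fin n → ℂ) δ)).toReal * g 0 := by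
  have hrot : ∀ c : ℂ, ‖c‖ = 1 → ∀ z : Fin n → ℂ, c • z ∈ ball (0 : Fin n → ℂ) δ ↔ z ∈ ball (0 : Fin n → ℂ) δ := by
    intro c hc z
    simp [mem_ball_zero_iff, norm_smul, hc]
  have hi : IntegrableOn g (ball (0 : Fin n → ℂ) δ) :=
    (hg.continuous.continuousOn.integrableOn_compact (isCompact_closedBall (0 : Fin n → ℂ) δ)).mono_set
      ball_subset_closedBall
  have h := rot_avg isOpen_ball hrot hi hg.continuous.continuousOn
  have h2 : ∀ z : Fin n → ℂ, ∫ θ in (0:ℝ)..2 * Real.pi, g (Complex.exp (θ * Complex.I) • z) = 2 * Real.pi * g 0 := by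
    intro z
    have := hom_circle (D := univ) (G := g) isOpen_univ (mem_univ _) hg.differentiableOn (z := z)
      (fun _ _ => mem_univ _) 0
    simpa [hom] using this
  simp_rw [h2] at h
  rw [setIntegral_const] at h
  have hpi : (2 * Real.pi : ℂ) ≠ 0 := by
    exact_mod_cast Real.two_pi_pos.ne'
  apply mul_left_cancel₀ hpi
  rw [h]
  simp [Measure.real]
  ring

lemma sup_le_L2 {K D : Set (Fin n → ℂ)} (hK : IsCompact K) (hD : IsOpen D) (h : K ⊆ D) :
    ∃ C : ℝ, 0 ≤ C ∧ ∀ g : (Fin n → ℂ) → ℂ, Differentiable ℂ g → IntegrableOn (fun z => ‖g z‖ ^ 2) D →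
      ∀ z ∈ K, ‖g z‖ ^ 2 ≤ C * ∫ w in D, ‖g w‖ ^ 2 := by
  obtain ⟨δ, h0, h1⟩ := exists_ball_of_compact hK hD h
  set V := (volume (ball (0 : Fin n → ℂ) δ)).toReal with hV
  have hV0 : 0 < V := ENNReal.toReal_pos (measure_ball_pos _ _ h0).ne' measure_ball_lt_top.ne
  refine ⟨V⁻¹, by positivity, fun g hg hi z hz => ?_⟩
  have hm := mean_ball (g := fun w => g (z + w) ^ 2) (by fun_prop) h0
  rw [← hV] at hm
  have h2 : V * ‖g z‖ ^ 2 ≤ ∫ w in ball (0 : Fin n → ℂ) δ, ‖g (z + w)‖ ^ 2 := by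
    have : ‖∫ w in ball (0 : Fin n → ℂ) δ, g (z + w) ^ 2‖ = V * ‖g z‖ ^ 2 := by
      rw [hm]; simp [abs_of_pos hV0]
    rw [← this]
    refine (norm_integral_le_integral_norm _).trans (le_of_eq ?_)
    simp
  have h3 : ∫ w in ball (0 : Fin n → ℂ) δ, ‖g (z + w)‖ ^ 2 = ∫ w in ball z δ, ‖g w‖ ^ 2 := by
    have hp := (measurePreserving_add_left (volume : Measure (Fin n → ℂ)) z).setIntegral_preimage_emb
      (measurableEmbedding_addLeft z) (fun w => ‖g w‖ ^ 2) (ball z δ)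
    rw [← hp]
    congr 2
    ext w
    simp [mem_ball_iff_norm]
  have h4 : ∫ w in ball z δ, ‖g w‖ ^ 2 ≤ ∫ w in D, ‖g w‖ ^ 2 :=
    setIntegral_mono_set hi (Eventually.of_forall fun _ => by positivity) (h1 z hz).eventuallyLE
  rw [inv_mul_eq_div, le_div_iff₀ hV0]
  linarith

lemma extension {D : Set (Fin n → ℂ)} (hD : IsOpen D) (h0 : (0 : Fin n → ℂ) ∈ D)
    (hbal : ∀ c : ℂ, ‖c‖ ≤ 1 → ∀ z ∈ D, c • z ∈ D) (hbd : Bornology.IsBounded D)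
    {G : (Fin n → ℂ) → ℂ} (hG : DifferentiableOn ℂ G D) (hGi : IntegrableOn G D)
    {K : Set (Fin n → ℂ)} (hKD : K ⊆ D) (hK : IsCompact K) {C : ℝ}
    (hB : ∀ k : (Fin n → ℂ) → ℂ, DifferentiableOn ℂ k D → ∀ M' : ℝ, (∀ z ∈ D, ‖k z‖ ≤ M') →
        ∀ M : ℝ, (∀ z ∈ K, ‖k z‖ ≤ M) → ‖∫ z in D, G z * (starRingEnd ℂ) (k z)‖ ≤ C * M) :
    ∃ R : ℝ, 1 < R ∧ ∃ Gt : (Fin n → ℂ) → ℂ, DifferentiableOn ℂ Gt {z | ((R⁻¹ : ℝ) : ℂ) • z ∈ D} ∧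
      EqOn Gt G D := by
  have hbound : ∀ m, ∃ M' : ℝ, ∀ z ∈ closure D, ‖hom G m z‖ ≤ M' := fun m =>
    hbd.isCompact_closure.exists_bound_of_continuousOn (hom_diff G m).continuous.continuousOn
  have hvol : volume D < ⊤ := hbd.measure_lt_top
  have hrot : ∀ c : ℂ, ‖c‖ = 1 → ∀ z, c • z ∈ D ↔ z ∈ D := by
    intro c hc z
    have hc0 : c ≠ 0 := by rintro rfl; simp at hc
    refine ⟨fun hz => ?_, fun hz => hbal c hc.le z hz⟩
    have := hbal c⁻¹ (by simp [hc]) _ hz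
    rwa [smul_smul, inv_mul_cancel₀ hc0, one_smul] at this
  have hsqi : ∀ m, IntegrableOn (fun z => ‖hom G m z‖ ^ 2) D := by
    intro m
    exact (((hom_diff G m).continuous.norm.pow 2).continuousOn.integrableOn_compact
      hbd.isCompact_closure).mono_set subset_closure
  have hN : ∀ m, ∫ z in D, G z * (starRingEnd ℂ) (hom G m z) = ((∫ z in D, ‖hom G m z‖ ^ 2 : ℝ) : ℂ) := by
    intro m
    obtain ⟨M', hM'⟩ := hbound m
    have hcj : Continuous fun z => (starRingEnd ℂ) (hom G m z) :=
      Complex.continuous_conj.comp (hom_diff G m).continuous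
    have hi : IntegrableOn (fun z => G z * (starRingEnd ℂ) (hom G m z)) D := by
      refine Integrable.mul_bdd (c := M') hGi hcj.aestronglyMeasurable ?_
      refine (ae_restrict_iff' hD.measurableSet).2 (Eventually.of_forall fun z hz => ?_)
      rw [RCLike.norm_conj]; exact hM' z (subset_closure hz)
    have h := rot_avg hD hrot hi (hG.continuousOn.mul hcj.continuousOn)
    have h2 : ∀ z ∈ D, ∫ θ in (0:ℝ)..2 * Real.pi, G (Complex.exp (θ * Complex.I) • z) *
        (starRingEnd ℂ) (hom G m (Complex.exp (θ * Complex.I) • z)) =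
        (2 * Real.pi : ℂ) * ((‖hom G m z‖ ^ 2 : ℝ) : ℂ) := by
      intro z hz
      have h3 := hom_circle hD h0 hG (z := z) (fun c hc => hbal c hc z hz) m
      simp_rw [hom_smul, map_mul, ← mul_assoc]
      rw [intervalIntegral.integral_mul_const, h3, mul_assoc, Complex.mul_conj, Complex.normSq_eq_norm_sq]
    rw [setIntegral_congr_fun hD.measurableSet h2, integral_const_mul, integral_complex_ofReal] at h
    have hpi : (2 * Real.pi : ℂ) ≠ 0 := by
      exact_mod_cast Real.two_pi_pos.ne'
    exact mul_left_cancel₀ hpi h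
  obtain ⟨t, ht1, htK⟩ := exists_smul_of_compact hK hD hKD
  have ht0 : 0 < t := by linarith
  set K1 : Set (Fin n → ℂ) := (fun z => (t : ℂ) • z) '' K with hK1
  have hK1c : IsCompact K1 := hK.image (by fun_prop)
  have hK1D : K1 ⊆ D := by rintro _ ⟨z, hz, rfl⟩; exact htK z hz
  obtain ⟨C2, hC2, hsup⟩ := sup_le_L2 hK1c hD hK1D
  set N : ℕ → ℝ := fun m => ∫ z in D, ‖hom G m z‖ ^ 2 with hNdef
  have hN0 : ∀ m, 0 ≤ N m := fun m => integral_nonneg fun z => by positivity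
  have hNle : ∀ m, N m ≤ C ^ 2 * C2 * (t⁻¹ ^ m) ^ 2 := by
    intro m
    obtain ⟨M', hM'⟩ := hbound m
    have h1 := hB (hom G m) (hom_diff G m).differentiableOn M' (fun z hz => hM' z (subset_closure hz))
      (t⁻¹ ^ m * Real.sqrt (C2 * N m)) (by
        intro z hz
        have h2 := hsup (hom G m) (hom_diff G m) (hsqi m) ((t : ℂ) • z) ⟨z, hz, rfl⟩
        have h3 := Real.le_sqrt_of_sq_le h2
        rw [hom_smul, norm_mul, norm_pow, Complex.norm_real, Real.norm_of_nonneg ht0.le] at h3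
        rw [inv_pow, inv_mul_eq_div, le_div_iff₀ (by positivity)]
        linarith)
    rw [hN m, Complex.norm_real, Real.norm_of_nonneg (hN0 m)] at h1
    by_cases hz : N m = 0
    · rw [hz]; positivity
    have hpos : 0 < N m := lt_of_le_of_ne (hN0 m) (Ne.symm hz)
    have h4 : (N m) ^ 2 ≤ (C * (t⁻¹ ^ m * Real.sqrt (C2 * N m))) ^ 2 := by
      exact pow_le_pow_left₀ hpos.le h1 2
    rw [mul_pow, mul_pow, Real.sq_sqrt (by positivity)] at h4
    have h5 : N m * N m ≤ N m * (C ^ 2 * C2 * (t⁻¹ ^ m) ^ 2) := by nlinarith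
    exact le_of_mul_le_mul_left h5 hpos
  -- uniform bound on compacts
  have hcomp : ∀ K' : Set (Fin n → ℂ), IsCompact K' → K' ⊆ D → ∃ A : ℝ, ∀ m, ∀ z ∈ K', ‖hom G m z‖ ≤ A * t⁻¹ ^ m := by
    intro K' hK' hK'D
    obtain ⟨C', hC', hs'⟩ := sup_le_L2 hK' hD hK'D
    refine ⟨Real.sqrt (C' * (C ^ 2 * C2)), fun m z hz => ?_⟩
    have h1 := (hs' (hom G m) (hom_diff G m) (hsqi m) z hz).trans (mul_le_mul_of_nonneg_left (hNle m) hC')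
    have h2 : ‖hom G m z‖ ^ 2 ≤ (Real.sqrt (C' * (C ^ 2 * C2)) * t⁻¹ ^ m) ^ 2 := by
      rw [mul_pow, Real.sq_sqrt (by positivity)]; linarith
    exact le_of_sq_le_sq h2 (by positivity)
  set R := Real.sqrt t with hR
  have hR1 : 1 < R := by rw [hR]; exact Real.lt_sqrt_of_sq_lt (by simpa using ht1)
  have hRR : R * R = t := Real.mul_self_sqrt ht0.le
  have hR0 : 0 < R := by linarith
  have hR0c : (R : ℂ) ≠ 0 := by exact_mod_cast hR0.ne'
  refine ⟨R, hR1, fun z => ∑' m, hom G m z, ?_, ?_⟩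
  · have hO : IsOpen {z : Fin n → ℂ | ((R⁻¹ : ℝ) : ℂ) • z ∈ D} := hD.preimage (by fun_prop)
    intro z hz
    obtain ⟨δ', hδ', hsub⟩ := Metric.isOpen_iff.1 hO z hz
    set δ := δ' / 3 with hδ
    have hδ0 : 0 < δ := by positivity
    have hcb : closedBall z (2 * δ) ⊆ {z : Fin n → ℂ | ((R⁻¹ : ℝ) : ℂ) • z ∈ D} :=
      (closedBall_subset_ball (by rw [hδ]; linarith)).trans hsub
    obtain ⟨A, hA⟩ := hcomp ((fun z => ((R⁻¹ : ℝ) : ℂ) • z) '' closedBall z (2 * δ))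
      ((isCompact_closedBall z (2 * δ)).image (by fun_prop)) (by rintro _ ⟨w, hw, rfl⟩; exact hcb hw)
    have hA2 : ∀ m, ∀ w ∈ closedBall z (2 * δ), ‖hom G m w‖ ≤ A * R⁻¹ ^ m := by
      intro m w hw
      have h1 := hA m _ ⟨w, hw, rfl⟩
      simp only [] at h1
      rw [hom_smul, norm_mul, norm_pow, Complex.norm_real, Real.norm_of_nonneg (by positivity), ← hRR, mul_inv, mul_pow,
        inv_pow, inv_mul_eq_div, div_le_iff₀ (by positivity)] at h1
      rw [inv_pow]
      refine h1.trans (le_of_eq ?_)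
      field_simp
    have hR1' : R⁻¹ < 1 := inv_lt_one_of_one_lt₀ hR1
    have hsum : Summable fun m : ℕ => A * R⁻¹ ^ m :=
      (summable_geometric_of_lt_one (by positivity) hR1').mul_left A
    have hder := hasFDerivAt_tsum_of_isPreconnected (𝕜 := ℂ) (f := fun m w => hom G m w) (f' := fun m w => fderiv ℂ (hom G m) w)
      (s := ball z δ) (u := fun m => A * R⁻¹ ^ m / (δ / 2)) (x₀ := z) (x := z) (hsum.div_const _) isOpen_ball
      (convex_ball z δ).isPreconnected (fun m w _ => ((hom_diff G m) w).hasFDerivAt)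
      (fun m w hw => norm_fderiv_le_of_bound (by positivity) (hom_diff G m).differentiableOn (fun x hx => by
        refine hA2 m x ?_
        rw [mem_ball] at hx hw
        rw [mem_closedBall]
        have := dist_triangle x w z
        linarith)) (mem_ball_self hδ0)
      (Summable.of_norm_bounded hsum fun m => hA2 m z (mem_closedBall_self (by positivity))) (mem_ball_self hδ0)
    exact hder.differentiableAt.differentiableWithinAt
  · intro z hz
    obtain ⟨s, hs1, hs⟩ := exists_smul_of_compact (isCompact_singleton (x := z)) hD (by simpa using hz)
    have hs0 : (0:ℝ) < s := by linarith
    refine (hom_hasSum hD h0 hG hs1 ?_).tsum_eq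
    intro c hc
    have h2 := hbal (c / s) (by
      rw [norm_div, Complex.norm_real, Real.norm_of_nonneg hs0.le]; exact (div_le_one hs0).2 hc.le) _ (hs z rfl)
    rwa [smul_smul, div_mul_cancel₀ _ (by exact_mod_cast hs0.ne')] at h2

end SymEll

namespace SymEll
open Set Filter Topology MeasureTheory Metric

variable {n : ℕ}

lemma ell_bal {p : ℝ} (hp : 0 < p) (c : ℂ) (hc : ‖c‖ ≤ 1) (z : Fin n → ℂ) (hz : z ∈ ellipsoid p n) :
    c • z ∈ ellipsoid p n := by
  rw [mem_ellipsoid] at *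
  rw [rho_smul]
  have h1 : ‖c‖ ^ (2 * p) ≤ 1 := Real.rpow_le_one (norm_nonneg _) hc (by positivity)
  have h2 := rho_nonneg p z
  nlinarith

lemma ell_zero {p : ℝ} (hp : 0 < p) : (0 : Fin n → ℂ) ∈ ellipsoid p n := by
  rw [mem_ellipsoid]
  unfold rho
  simp [Real.zero_rpow (show 2 * p ≠ 0 by positivity)]

lemma ell_bdd {p : ℝ} (hp : 0 < p) : Bornology.IsBounded (ellipsoid p n) := by
  refine (Metric.isBounded_iff_subset_closedBall 0).2 ⟨1, fun z hz => ?_⟩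
  rw [mem_closedBall_zero_iff]
  exact norm_le_of_rho_le hp (mem_ellipsoid.1 hz).le

lemma ell_closure {p : ℝ} (hp : 0 < p) {z : Fin n → ℂ} : z ∈ closure (ellipsoid p n) ↔ rho p z ≤ 1 := by
  constructor
  · intro hz
    have : closure (ellipsoid p n) ⊆ {z : Fin n → ℂ | rho p z ≤ 1} :=
      closure_minimal (fun z hz => (mem_ellipsoid.1 hz).le) (isClosed_le (continuous_rho hp) continuous_const)
    exact this hz
  · intro hz
    have h1 : Tendsto (fun t : ℝ => (t : ℂ) • z) (𝓝[<] 1) (𝓝 z) := by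
      have : Continuous fun t : ℝ => (t : ℂ) • z := by fun_prop
      have h := (this.tendsto 1).mono_left (nhdsWithin_le_nhds (s := Iio 1))
      simpa using h
    refine mem_closure_of_tendsto h1 ?_
    have h3 : ∀ᶠ t : ℝ in 𝓝[<] 1, 0 < t := (eventually_gt_nhds (by norm_num)).filter_mono nhdsWithin_le_nhds
    filter_upwards [self_mem_nhdsWithin, h3] with t ht ht0
    rw [mem_ellipsoid, rho_smul, Complex.norm_real, Real.norm_of_nonneg ht0.le]
    have h4 : t ^ (2 * p) < 1 := Real.rpow_lt_one ht0.le ht (by positivity)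
    have h5 := rho_nonneg p z
    have h6 : 0 < t ^ (2 * p) := by positivity
    nlinarith

lemma ell_frontier {p : ℝ} (hp : 0 < p) {z : Fin n → ℂ} : z ∈ frontier (ellipsoid p n) ↔ rho p z = 1 := by
  rw [(isOpen_ellipsoid hp).frontier_eq, mem_diff, ell_closure hp, mem_ellipsoid]
  constructor
  · rintro ⟨h1, h2⟩; linarith
  · intro h; constructor <;> linarith

lemma ext_all {p q : ℝ} (hp : 0 < p) (hq : 0 < q) {F : (Fin n → ℂ) → (Fin n → ℂ)}
    (hF : IsProperHolomorphic F (ellipsoid p n) (symEllipsoid q n)) :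
    ∃ (U : Set (Fin n → ℂ)) (J : (Fin n → ℂ) → ℂ) (G : (Fin n → ℂ) → (Fin n → ℂ)), IsOpen U ∧
      closure (ellipsoid p n) ⊆ U ∧ DifferentiableOn ℂ J U ∧ DifferentiableOn ℂ G U ∧
      ∀ z ∈ ellipsoid p n, J z = (fderiv ℂ F z).det ∧ G z = J z • F z := by
  have hD := isOpen_ellipsoid (n := n) hp
  have key : ∀ h : (Fin n → ℂ) → ℂ, Differentiable ℂ h → ∀ d : ℝ, (∀ w, fderiv ℂ h w (eu w) = d * h w) →
      ∃ (U : Set (Fin n → ℂ)) (G : (Fin n → ℂ) → ℂ), IsOpen U ∧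
      closure (ellipsoid p n) ⊆ U ∧ DifferentiableOn ℂ G U ∧
      ∀ z ∈ ellipsoid p n, G z = (fderiv ℂ F z).det * h (F z) := by
    intro h hh d hd
    obtain ⟨K, hKD, hK, C, hi, hB⟩ := bell_bound hq hD (ell_bdd hp).measure_lt_top hF hh hd
    have hGd : DifferentiableOn ℂ (fun z => (fderiv ℂ F z).det * h (F z)) (ellipsoid p n) :=
      (differentiableOn_clm_det (differentiableOn_fderiv hD hF.1)).mul (hh.comp_differentiableOn hF.1)
    obtain ⟨R, hR, Gt, h1, h2⟩ := extension hD (ell_zero hp) (ell_bal hp) (ell_bdd hp) hGd hi hKD hK hB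
    refine ⟨_, Gt, hD.preimage (by fun_prop), ?_, h1, h2⟩
    intro z hz
    have hz1 := (ell_closure hp).1 hz
    have hR0 : 0 < R := by linarith
    rw [Set.mem_preimage, mem_ellipsoid, rho_smul, Complex.norm_real, Real.norm_of_nonneg (by positivity)]
    have h4 : (R⁻¹) ^ (2 * p) < 1 := Real.rpow_lt_one (by positivity) (inv_lt_one_of_one_lt₀ hR) (by positivity)
    have h5 := rho_nonneg p z
    have h6 : 0 < (R⁻¹) ^ (2 * p) := by positivity
    nlinarith
  obtain ⟨U0, J, hU0, hcl0, hJ, hJe⟩ := key (fun _ => 1) (differentiable_const _) 0 (by intro w; simp)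
  have hj : ∀ j : Fin n, ∃ (U : Set (Fin n → ℂ)) (G : (Fin n → ℂ) → ℂ), IsOpen U ∧
      closure (ellipsoid p n) ⊆ U ∧ DifferentiableOn ℂ G U ∧
      ∀ z ∈ ellipsoid p n, G z = (fderiv ℂ F z).det * (F z) j := by
    intro j
    refine key (fun w => w j) (by fun_prop) ((j.1 + 1 : ℕ) : ℝ) ?_
    intro w
    have : HasFDerivAt (fun w : Fin n → ℂ => w j) (ContinuousLinearMap.proj (R := ℂ) (φ := fun _ : Fin n => ℂ) j) w :=
      (ContinuousLinearMap.proj (R := ℂ) (φ := fun _ : Fin n => ℂ) j).hasFDerivAt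
    rw [this.fderiv]
    simp [eu]
  choose Uj Gj h1 h2 h3 h4 using hj
  refine ⟨U0 ∩ ⋂ j, Uj j, J, fun z j => Gj j z, hU0.inter (isOpen_iInter_of_finite h1),
    fun z hz => ⟨hcl0 hz, mem_iInter.2 fun j => h2 j hz⟩, hJ.mono inter_subset_left,
    differentiableOn_pi.2 fun j => (h3 j).mono fun z hz => mem_iInter.1 hz.2 j, fun z hz => ?_⟩
  have hJz : J z = (fderiv ℂ F z).det := by rw [hJe z hz, mul_one]
  refine ⟨hJz, ?_⟩
  funext j
  show Gj j z = _
  rw [h4 j z hz, Pi.smul_apply, hJz, smul_eq_mul]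

lemma disc_poly : ∃ Q : MvPolynomial (Fin n) ℂ, ∀ z, MvPolynomial.eval (piMap n z) Q =
    ∏ i, (z i * ∏ j, if j = i then 1 else z i - z j) := by
  classical
  set P : MvPolynomial (Fin n) ℂ := ∏ i, (MvPolynomial.X i * ∏ j, if j = i then 1 else MvPolynomial.X i - MvPolynomial.X j) with hP
  have hsym : P.IsSymmetric := by
    intro σ
    have h1 : MvPolynomial.rename σ P = ∏ i, (MvPolynomial.X (σ i) *
        ∏ j, if σ j = σ i then 1 else (MvPolynomial.X (σ i) - MvPolynomial.X (σ j) : MvPolynomial (Fin n) ℂ)) := by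
      rw [hP, map_prod]
      refine Finset.prod_congr rfl fun i _ => ?_
      rw [map_mul, map_prod, MvPolynomial.rename_X]
      congr 1
      refine Finset.prod_congr rfl fun j _ => ?_
      by_cases h : j = i
      · simp [h]
      · simp [h]
    rw [h1]
    have h2 : ∀ i : Fin n, ∏ j, (if σ j = σ i then 1 else (MvPolynomial.X (σ i) - MvPolynomial.X (σ j) : MvPolynomial (Fin n) ℂ))
        = ∏ j, (if j = σ i then 1 else (MvPolynomial.X (σ i) - MvPolynomial.X j)) := fun i =>
      Equiv.prod_comp σ (fun j => if j = σ i then 1 else (MvPolynomial.X (σ i) - MvPolynomial.X j : MvPolynomial (Fin n) ℂ))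
    simp_rw [h2]
    exact Equiv.prod_comp σ (fun i => (MvPolynomial.X i * ∏ j, if j = i then 1 else (MvPolynomial.X i - MvPolynomial.X j : MvPolynomial (Fin n) ℂ)))
  obtain ⟨Q, hQ⟩ := exists_poly_of_symmetric P hsym
  refine ⟨Q, fun z => ?_⟩
  rw [← hQ z, hP, map_prod]
  refine Finset.prod_congr rfl fun i _ => ?_
  rw [map_mul, map_prod, MvPolynomial.eval_X]
  congr 1
  refine Finset.prod_congr rfl fun j _ => ?_
  by_cases h : j = i
  · simp [h]
  · simp [h]

lemma disc_ne_zero {z : Fin n → ℂ} : (∏ i, (z i * ∏ j, if j = i then 1 else z i - z j)) ≠ 0 ↔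
    Function.Injective z ∧ ∀ i, z i ≠ 0 := by
  rw [Finset.prod_ne_zero_iff]
  constructor
  · intro h
    refine ⟨?_, fun i => (mul_ne_zero_iff.1 (h i (Finset.mem_univ i))).1⟩
    intro i j hij
    by_contra hne
    have := (mul_ne_zero_iff.1 (h i (Finset.mem_univ i))).2
    rw [Finset.prod_ne_zero_iff] at this
    have := this j (Finset.mem_univ j)
    rw [if_neg (Ne.symm hne), hij] at this
    simp at this
  · rintro ⟨h1, h2⟩ i _
    refine mul_ne_zero (h2 i) (Finset.prod_ne_zero_iff.2 fun j _ => ?_)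
    split_ifs with h
    · exact one_ne_zero
    · exact sub_ne_zero.2 fun h3 => h (h1 h3).symm

lemma mvpoly_diff (Q : MvPolynomial (Fin n) ℂ) : Differentiable ℂ (fun w : Fin n → ℂ => MvPolynomial.eval w Q) := by
  induction Q using MvPolynomial.induction_on with
  | C a => simp
  | add p q hp hq => simp only [map_add]; exact hp.add hq
  | mul_X p i hp => simp only [map_mul, MvPolynomial.eval_X]; exact hp.mul (differentiable_apply (𝕜 := ℂ) i)

lemma prod_vanish_aux {z₀ : Fin n → ℂ} (h : ∀ᶠ z in 𝓝 z₀, ∏ j, z j = 0) : False := by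
  have h1 := eqOn_zero_of_convex (f := fun z : Fin n → ℂ => ∏ j, z j) isOpen_univ convex_univ
    (by fun_prop) (mem_univ z₀) h (fun _ => 1) (mem_univ _)
  simp at h1

lemma disc_vanish_aux {Q : MvPolynomial (Fin n) ℂ} (hQ : ∀ z, MvPolynomial.eval (piMap n z) Q =
    ∏ i, (z i * ∏ j, if j = i then 1 else z i - z j)) {V : Set (Fin n → ℂ)} (hV : IsOpen V)
    {y : Fin n → ℂ} (hy : y ∈ V) : ∃ y1 ∈ V, MvPolynomial.eval y1 Q ≠ 0 := by
  by_contra hcon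
  push Not at hcon
  obtain ⟨z, rfl⟩ := piMap_surjective y
  have h1 := eqOn_zero_of_convex (f := fun z : Fin n → ℂ => MvPolynomial.eval (piMap n z) Q) isOpen_univ convex_univ
    ((mvpoly_diff Q).comp differentiable_piMap).differentiableOn (mem_univ z)
    (by
      have : ∀ᶠ x in 𝓝 z, piMap n x ∈ V := continuous_piMap.continuousAt.eventually (hV.mem_nhds hy)
      filter_upwards [this] with x hx using hcon _ hx) (fun j => ((j.1 + 1 : ℕ) : ℂ)) (mem_univ _)
  simp only [hQ] at h1
  revert h1
  rw [imp_false]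
  show _ ≠ _
  rw [disc_ne_zero]
  refine ⟨?_, fun i => Nat.cast_ne_zero.2 (Nat.succ_ne_zero i.1)⟩
  intro i j hij
  simp only [] at hij
  have : i.1 + 1 = j.1 + 1 := by exact_mod_cast hij
  exact Fin.ext (by omega)

lemma Ft_mem {p q : ℝ} (hp : 0 < p) (hq : 0 < q) {F : (Fin n → ℂ) → (Fin n → ℂ)}
    (hF : IsProperHolomorphic F (ellipsoid p n) (symEllipsoid q n))
    {U : Set (Fin n → ℂ)} {J : (Fin n → ℂ) → ℂ} {G : (Fin n → ℂ) → (Fin n → ℂ)} (hU : IsOpen U)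
    (hcl : closure (ellipsoid p n) ⊆ U) (hJ : DifferentiableOn ℂ J U) (hG : DifferentiableOn ℂ G U)
    (hJG : ∀ z ∈ ellipsoid p n, J z = (fderiv ℂ F z).det ∧ G z = J z • F z)
    {z : Fin n → ℂ} (hz : rho p z ≤ 1) (hJz : J z ≠ 0) :
    (J z)⁻¹ • G z ∈ Eset q 1 n ∧ (rho p z = 1 → (J z)⁻¹ • G z ∉ symEllipsoid q n) ∧
    (rho p z < 1 → (J z)⁻¹ • G z = F z) := by
  have hzc := (ell_closure hp).2 hz
  have hnb := mem_closure_iff_nhdsWithin_neBot.1 hzc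
  have hJc : ContinuousAt J z := (hJ.continuousOn z (hcl hzc)).continuousAt (hU.mem_nhds (hcl hzc))
  have hGc : ContinuousAt G z := (hG.continuousOn z (hcl hzc)).continuousAt (hU.mem_nhds (hcl hzc))
  have hc : ContinuousAt (fun z => (J z)⁻¹ • G z) z := (hJc.inv₀ hJz).smul hGc
  have hin : ∀ w ∈ ellipsoid p n, J w ≠ 0 → (J w)⁻¹ • G w = F w := by
    intro w hw hJw
    rw [(hJG w hw).2, smul_smul, inv_mul_cancel₀ hJw, one_smul]
  have hJne : ∀ᶠ w in 𝓝[ellipsoid p n] z, J w ≠ 0 :=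
    (hJc.eventually_ne hJz).filter_mono nhdsWithin_le_nhds
  refine ⟨?_, ?_, fun h => hin z h hJz⟩
  · refine (isCompact_Eset hq le_rfl).isClosed.mem_of_tendsto (hc.tendsto.mono_left (nhdsWithin_le_nhds (s := ellipsoid p n))) ?_
    filter_upwards [hJne, self_mem_nhdsWithin] with w hw1 hw2
    rw [hin w hw2 hw1]
    obtain ⟨a, ha, hb⟩ := hF.2.1 hw2
    exact ⟨a, (mem_ellipsoid.1 ha).le, hb⟩
  · intro h1 hmem
    obtain ⟨ε, hε, hball⟩ := Metric.isOpen_iff.1 (isOpen_symEllipsoid hq) _ hmem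
    set B := closedBall ((J z)⁻¹ • G z) (ε / 2) with hB
    have hK := hF.2.2 B ((closedBall_subset_ball (by linarith)).trans hball) (isCompact_closedBall _ _)
    have : z ∈ ellipsoid p n ∩ F ⁻¹' B := by
      refine hK.isClosed.mem_of_tendsto (tendsto_id.mono_left (nhdsWithin_le_nhds (s := ellipsoid p n))) ?_
      have hev : ∀ᶠ w in 𝓝[ellipsoid p n] z, (J w)⁻¹ • G w ∈ B :=
        (hc.eventually (closedBall_mem_nhds _ (by linarith))).filter_mono nhdsWithin_le_nhds
      filter_upwards [hJne, self_mem_nhdsWithin, hev] with w hw1 hw2 hw3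
      refine ⟨hw2, ?_⟩
      rw [Set.mem_preimage, id, ← hin w hw2 hw1]; exact hw3
    have h2 := mem_ellipsoid.1 this.1
    linarith

lemma bdy_point {p q : ℝ} (hn : 0 < n) (hp : 0 < p) (hq : 0 < q) {F : (Fin n → ℂ) → (Fin n → ℂ)}
    (hF : IsProperHolomorphic F (ellipsoid p n) (symEllipsoid q n))
    {U : Set (Fin n → ℂ)} {J : (Fin n → ℂ) → ℂ} {G : (Fin n → ℂ) → (Fin n → ℂ)} (hU : IsOpen U)
    (hcl : closure (ellipsoid p n) ⊆ U) (hJ : DifferentiableOn ℂ J U) (hG : DifferentiableOn ℂ G U)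
    (hJG : ∀ z ∈ ellipsoid p n, J z = (fderiv ℂ F z).det ∧ G z = J z • F z) 
    {Q : MvPolynomial (Fin n) ℂ} (hQ : ∀ z, MvPolynomial.eval (piMap n z) Q =
    ∏ i, (z i * ∏ j, if j = i then 1 else z i - z j)) :
    ∃ ζ : Fin n → ℂ, rho p ζ = 1 ∧ J ζ ≠ 0 ∧ (∀ j, ζ j ≠ 0) ∧ MvPolynomial.eval ((J ζ)⁻¹ • G ζ) Q ≠ 0 := by
  have hD := isOpen_ellipsoid (n := n) hp
  by_contra hcon
  push Not at hcon
  set H : (Fin n → ℂ) → ℂ := fun z => J z * ((∏ j, z j) * MvPolynomial.eval ((J z)⁻¹ • G z) Q) with hH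
  have hHD : ∀ z ∈ ellipsoid p n, H z = J z * ((∏ j, z j) * MvPolynomial.eval (F z) Q) := by
    intro z hz
    by_cases h : J z = 0
    · simp [hH, h]
    · simp only [hH, (hJG z hz).2, smul_smul, inv_mul_cancel₀ h, one_smul]
  have hdiff : DifferentiableOn ℂ H (ellipsoid p n) := by
    refine DifferentiableOn.congr ?_ hHD
    refine (hJ.mono (subset_closure.trans hcl)).mul (DifferentiableOn.mul (by fun_prop) ?_)
    exact (mvpoly_diff Q).comp_differentiableOn hF.1
  obtain ⟨M, hM⟩ := (isCompact_Eset (n := n) hq le_rfl).exists_bound_of_continuousOn (mvpoly_diff Q).continuous.continuousOn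
  have hcont : ContinuousOn H (closure (ellipsoid p n)) := by
    intro z hz
    have hJc : ContinuousAt J z := (hJ.continuousOn z (hcl hz)).continuousAt (hU.mem_nhds (hcl hz))
    have hGc : ContinuousAt G z := (hG.continuousOn z (hcl hz)).continuousAt (hU.mem_nhds (hcl hz))
    by_cases h : J z = 0
    · have hz0 : H z = 0 := by simp [hH, h]
      rw [ContinuousWithinAt, hz0]
      have hb : ∀ᶠ w in 𝓝[closure (ellipsoid p n)] z, ‖H w‖ ≤ ‖J w‖ * (‖∏ j, w j‖ * M) := by
        filter_upwards [self_mem_nhdsWithin] with w hw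
        by_cases hw0 : J w = 0
        · simp [hH, hw0]
        · simp only [hH, norm_mul]
          gcongr
          exact hM _ (Ft_mem hp hq hF hU hcl hJ hG hJG ((ell_closure hp).1 hw) hw0).1
      refine squeeze_zero_norm' hb ?_
      have hp' : Continuous fun w : Fin n → ℂ => ‖∏ j, w j‖ * M := by fun_prop
      have := (hJc.norm.mul hp'.continuousAt).tendsto.mono_left (nhdsWithin_le_nhds (s := closure (ellipsoid p n)))
      rw [show ((fun x => ‖J x‖) * fun w : Fin n → ℂ => ‖∏ j, w j‖ * M) z = 0 by simp [h]] at this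
      exact this
    · refine ContinuousAt.continuousWithinAt ?_
      refine hJc.mul (ContinuousAt.mul (by fun_prop) ?_)
      exact ((mvpoly_diff Q).continuous.continuousAt).comp ((hJc.inv₀ h).smul hGc)
  haveI : Nonempty (Fin n) := ⟨⟨0, hn⟩⟩
  have hzero : ∀ z ∈ ellipsoid p n, H z = 0 := by
    intro z hz
    have := Complex.norm_le_of_forall_mem_frontier_norm_le (C := 0) (ell_bdd hp) ⟨hdiff, hcont⟩ (by
      intro w hw
      rw [norm_le_zero_iff]
      by_cases h : J w = 0
      · simp [hH, h]
      by_cases h2 : ∀ j, w j ≠ 0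
      · have := hcon w ((ell_frontier hp).1 hw) h h2
        simp [hH, this]
      · push Not at h2
        obtain ⟨j, hj⟩ := h2
        simp [hH, Finset.prod_eq_zero (Finset.mem_univ j) hj]) (subset_closure hz)
    exact norm_le_zero_iff.1 this
  obtain ⟨z1, hz1, hd1⟩ := exists_det_ne_zero hD ⟨0, ell_zero hp⟩ hF.1 (fun w => by
    by_cases hw : w ∈ ellipsoid p n
    · left; exact hF.2.2 _ (by simpa using hF.2.1 hw) isCompact_singleton
    · right; exact hw)
  have hJ1 : J z1 ≠ 0 := by rw [(hJG z1 hz1).1]; exact hd1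
  have hJc1 : ContinuousAt J z1 := (hJ.continuousOn z1 (hcl (subset_closure hz1))).continuousAt (hU.mem_nhds (hcl (subset_closure hz1)))
  obtain ⟨U1, hU1s, hU1o, hz1U⟩ := _root_.eventually_nhds_iff.1 ((hJc1.eventually_ne hJ1).and (hD.mem_nhds hz1))
  obtain ⟨g, V, W, hV, hW, hzW, hWU, hFW, hgV, hgF, hFg, hgd⟩ := local_inverse hU1o
    (hF.1.mono fun x hx => (hU1s x hx).2) hz1U hd1
  obtain ⟨y1, hy1, hQy1⟩ := disc_vanish_aux hQ hV (hFW hzW)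
  have hgy := hgV hy1
  have hFc : ContinuousAt F (g y1) :=
    (hF.1.continuousOn _ (hU1s _ (hWU hgy)).2).continuousAt (hD.mem_nhds (hU1s _ (hWU hgy)).2)
  have hQc : ContinuousAt (fun z => MvPolynomial.eval (F z) Q) (g y1) :=
    (mvpoly_diff Q).continuous.continuousAt.comp hFc
  refine prod_vanish_aux (z₀ := g y1) ?_
  filter_upwards [hQc.eventually_ne (by rw [hFg y1 hy1]; exact hQy1), hW.mem_nhds hgy] with x hx1 hx2
  have h1 := hU1s x (hWU hx2)
  have h2 := hzero x h1.2
  rw [hHD x h1.2] at h2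
  simpa [h1.1, hx1] using h2

end SymEll

namespace SymEll
open Set Filter Topology MeasureTheory Metric

variable {n : ℕ}

lemma clm_det_ne_zero {A : (Fin n → ℂ) →L[ℂ] (Fin n → ℂ)} (h : ∀ v, A v = 0 → v = 0) : A.det ≠ 0 := by
  have h1 : Function.Injective (A : (Fin n → ℂ) →ₗ[ℂ] (Fin n → ℂ)) :=
    (injective_iff_map_eq_zero _).2 h
  have h2 : IsUnit (A : (Fin n → ℂ) →ₗ[ℂ] (Fin n → ℂ)) :=
    (Module.End.isUnit_iff _).2 ⟨h1, LinearMap.injective_iff_surjective.1 h1⟩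
  exact ((LinearMap.isUnit_iff_isUnit_det _).1 h2).ne_zero

lemma lift_local {p q : ℝ} (hn : 0 < n) (hp : 0 < p) (hq : 0 < q) {F : (Fin n → ℂ) → (Fin n → ℂ)}
    (hF : IsProperHolomorphic F (ellipsoid p n) (symEllipsoid q n)) :
    ∃ (ζ : Fin n → ℂ) (U : Set (Fin n → ℂ)) (L : (Fin n → ℂ) → (Fin n → ℂ)), IsOpen U ∧ ζ ∈ U ∧
      rho p ζ = 1 ∧ (∀ j, ζ j ≠ 0) ∧ (∀ j, L ζ j ≠ 0) ∧ DifferentiableOn ℂ L U ∧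
      (∀ v, fderiv ℂ L ζ v = 0 → v = 0) ∧
      (∀ z ∈ U, rho p z < 1 → F z = piMap n (L z) ∧ rho q (L z) < 1) ∧
      (∀ z ∈ U, rho p z = 1 → rho q (L z) = 1) := by
  have hD := isOpen_ellipsoid (n := n) hp
  obtain ⟨U, J, G, hU, hcl, hJ, hG, hJG⟩ := ext_all hp hq hF
  obtain ⟨Q, hQ⟩ := disc_poly (n := n)
  obtain ⟨ζ, hζ1, hJζ, hζ0, hQζ⟩ := bdy_point hn hp hq hF hU hcl hJ hG hJG hQ
  have hζc := (ell_closure hp).2 hζ1.le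
  set U1 : Set (Fin n → ℂ) := U ∩ J ⁻¹' {0}ᶜ with hU1
  have hU1o : IsOpen U1 := hJ.continuousOn.isOpen_inter_preimage hU isOpen_compl_singleton
  have hζU1 : ζ ∈ U1 := ⟨hcl hζc, hJζ⟩
  set Ft : (Fin n → ℂ) → (Fin n → ℂ) := fun z => (J z)⁻¹ • G z with hFt
  have hFtd : DifferentiableOn ℂ Ft U1 :=
    ((hJ.mono inter_subset_left).inv (fun z hz => hz.2)).smul (hG.mono inter_subset_left)
  have hmem : ∀ z ∈ U1, rho p z ≤ 1 → _ := fun z hz h => Ft_mem hp hq hF hU hcl hJ hG hJG h hz.2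
  -- determinant at ζ
  have hdet : (fderiv ℂ Ft ζ).det = J ζ := by
    have hnb := mem_closure_iff_nhdsWithin_neBot.1 hζc
    have hdc : ContinuousAt (fun z => (fderiv ℂ Ft z).det) ζ :=
      ((differentiableOn_clm_det (differentiableOn_fderiv hU1o hFtd)).continuousOn ζ hζU1).continuousAt (hU1o.mem_nhds hζU1)
    have hJc : ContinuousAt J ζ := (hJ.continuousOn ζ (hcl hζc)).continuousAt (hU.mem_nhds (hcl hζc))
    refine tendsto_nhds_unique_of_eventuallyEq (l := 𝓝[ellipsoid p n] ζ) (hdc.tendsto.mono_left nhdsWithin_le_nhds)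
      (hJc.tendsto.mono_left nhdsWithin_le_nhds) ?_
    filter_upwards [self_mem_nhdsWithin, mem_nhdsWithin_of_mem_nhds (hU1o.mem_nhds hζU1)] with w hw1 hw2
    rw [(hJG w hw1).1]
    have : Ft =ᶠ[𝓝 w] F := by
      filter_upwards [hD.mem_nhds hw1, hU1o.mem_nhds hw2] with x hx1 hx2
      exact (hmem x hx2 (mem_ellipsoid.1 hx1).le).2.2 hx1
    rw [this.fderiv_eq]
  obtain ⟨κ, hκ⟩ := piMap_surjective (Ft ζ)
  have hκ' := hQ κ
  rw [hκ] at hκ'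
  have hκ2 := disc_ne_zero.1 (hκ' ▸ hQζ)
  have hπd : (fderiv ℂ (piMap n) κ).det ≠ 0 := clm_det_ne_zero fun v hv => fderiv_piMap_injective hκ2.1 hv
  obtain ⟨g, V, W, hV, hW, hκW, -, hπW, hgV, hgπ, hπg, hgd⟩ := local_inverse isOpen_univ
    differentiable_piMap.differentiableOn (mem_univ κ) hπd
  set U2 := U1 ∩ Ft ⁻¹' V with hU2
  have hU2o : IsOpen U2 := hFtd.continuousOn.isOpen_inter_preimage hU1o hV
  have hζU2 : ζ ∈ U2 := ⟨hζU1, by rw [Set.mem_preimage, ← hκ]; exact hπW hκW⟩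
  have hLd : DifferentiableOn ℂ (g ∘ Ft) U2 := hgd.comp (hFtd.mono inter_subset_left) fun z hz => hz.2
  have hπL : ∀ z ∈ U2, piMap n (g (Ft z)) = Ft z := fun z hz => hπg _ hz.2
  have hLζ : g (Ft ζ) = κ := by rw [← hκ]; exact hgπ κ hκW
  refine ⟨ζ, U2, g ∘ Ft, hU2o, hζU2, hζ1, hζ0, ?_, hLd, ?_, ?_, ?_⟩
  · intro j; rw [Function.comp, hLζ]; exact hκ2.2 j
  · intro v hv
    have hLat : DifferentiableAt ℂ (g ∘ Ft) ζ := (hLd ζ hζU2).differentiableAt (hU2o.mem_nhds hζU2)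
    have h1 : Ft =ᶠ[𝓝 ζ] (piMap n) ∘ (g ∘ Ft) := by
      filter_upwards [hU2o.mem_nhds hζU2] with z hz using (hπL z hz).symm
    have h2 : fderiv ℂ Ft ζ v = 0 := by
      rw [h1.fderiv_eq, fderiv_comp ζ (differentiable_piMap _) hLat, ContinuousLinearMap.comp_apply, hv, map_zero]
    exact (clm_bijective (hdet ▸ hJζ)).1 (h2.trans (map_zero _).symm)
  · intro z hz h
    have h1 := (hmem z hz.1 h.le).2.2 h
    refine ⟨by rw [Function.comp, hπL z hz]; exact h1.symm, ?_⟩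
    rw [← piMap_mem_symEllipsoid, Function.comp, hπL z hz, hFt]
    simp only [] at h1 ⊢
    rw [h1]
    exact hF.2.1 h
  · intro z hz h
    have h1 := hmem z hz.1 h.le
    have h2 : rho q (g (Ft z)) ≤ 1 := by rw [← mem_Eset, hπL z hz]; exact h1.1
    have h3 : ¬ rho q (g (Ft z)) < 1 := by rw [← piMap_mem_symEllipsoid, hπL z hz]; exact h1.2.1 h
    show rho q (g (Ft z)) = 1
    linarith

/-- coordinatewise power map -/
noncomputable def pw (s : ℝ) (μ x0 x : Fin n → ℂ) : Fin n → ℂ :=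
  fun j => Complex.exp (s * (μ j + Complex.log (x j / x0 j)))

def pwd (x0 : Fin n → ℂ) : Set (Fin n → ℂ) := {x | ∀ j, x j / x0 j ∈ Complex.slitPlane}

lemma pwd_open (x0 : Fin n → ℂ) : IsOpen (pwd x0) := by
  have : pwd x0 = ⋂ j, (fun x : Fin n → ℂ => x j / x0 j) ⁻¹' Complex.slitPlane := by
    ext x; simp [pwd]
  rw [this]
  exact isOpen_iInter_of_finite fun j => Complex.isOpen_slitPlane.preimage (by fun_prop)

lemma pwd_self {x0 : Fin n → ℂ} (h : ∀ j, x0 j ≠ 0) : x0 ∈ pwd x0 := by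
  intro j; rw [div_self (h j)]; exact Complex.one_mem_slitPlane

lemma lg_diff (μ x0 : Fin n → ℂ) :
    DifferentiableOn ℂ (fun x : Fin n → ℂ => fun j => μ j + Complex.log (x j / x0 j)) (pwd x0) := by
  refine differentiableOn_pi.2 fun j => ?_
  refine DifferentiableOn.const_add _ (DifferentiableOn.clog (by fun_prop) fun x hx => hx j)

lemma pw_diff (s : ℝ) (μ x0 : Fin n → ℂ) : DifferentiableOn ℂ (pw s μ x0) (pwd x0) := by
  have := lg_diff μ x0
  rw [differentiableOn_pi] at this
  exact differentiableOn_pi.2 fun j => ((this j).const_mul _).cexp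

lemma pwd_ne {x0 x : Fin n → ℂ} (hx : x ∈ pwd x0) (j : Fin n) : x j ≠ 0 := by
  intro h
  have := Complex.slitPlane_ne_zero (hx j)
  simp [h] at this

lemma pw_norm (s : ℝ) {μ x0 x : Fin n → ℂ} (h0 : ∀ j, x0 j ≠ 0) (hμ : ∀ j, Complex.exp (μ j) = x0 j)
    (hx : x ∈ pwd x0) (j : Fin n) : ‖pw s μ x0 x j‖ = ‖x j‖ ^ s := by
  have hx0 := pwd_ne hx j
  have h1 : Complex.exp (μ j + Complex.log (x j / x0 j)) = x j := by
    rw [Complex.exp_add, hμ, Complex.exp_log (div_ne_zero hx0 (h0 j)), mul_div_cancel₀ _ (h0 j)]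
  have h2 : ‖x j‖ = Real.exp (μ j + Complex.log (x j / x0 j)).re := by
    rw [← Complex.norm_exp, h1]
  rw [pw, Complex.norm_exp, h2, ← Real.exp_mul]
  simp [mul_comm]

lemma pw_inj {s : ℝ} (hs : s ≠ 0) {μ x0 : Fin n → ℂ} (h0 : ∀ j, x0 j ≠ 0) {v : Fin n → ℂ}
    (hv : fderiv ℂ (pw s μ x0) x0 v = 0) : v = 0 := by
  have hd : DifferentiableAt ℂ (pw s μ x0) x0 :=
    ((pw_diff s μ x0) x0 (pwd_self h0)).differentiableAt ((pwd_open x0).mem_nhds (pwd_self h0))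
  funext j
  have h1 : HasDerivAt (fun t : ℂ => x0 + t • v) v 0 := by
    simpa using ((hasDerivAt_id (0 : ℂ)).smul_const v).const_add x0
  have h2 : HasDerivAt (fun t : ℂ => pw s μ x0 (x0 + t • v)) 0 0 := by
    have := HasFDerivAt.comp_hasDerivAt (l := pw s μ x0) (f := fun t : ℂ => x0 + t • v) (0 : ℂ)
      (l' := fderiv ℂ (pw s μ x0) x0) (by simpa using hd.hasFDerivAt) h1
    rwa [hv] at this
  have h3 := (hasDerivAt_pi.1 h2) j
  have h4 : HasDerivAt (fun t : ℂ => pw s μ x0 (x0 + t • v) j)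
      (Complex.exp (s * (μ j + Complex.log ((x0 j + 0 * v j) / x0 j))) * (s * ((v j / x0 j) / ((x0 j + 0 * v j) / x0 j)))) 0 := by
    have h5 : HasDerivAt (fun t : ℂ => (x0 j + t * v j) / x0 j) (v j / x0 j) 0 := by
      have := (((hasDerivAt_id (0 : ℂ)).mul_const (v j)).const_add (x0 j)).div_const (x0 j)
      simpa using this
    have h6 := (((h5.clog (by simpa [div_self (h0 j)] using Complex.one_mem_slitPlane)).const_add (μ j)).const_mul (s : ℂ)).cexp
    exact h6
  have h5 := h3.unique h4
  have hs' : (s : ℂ) ≠ 0 := by exact_mod_cast hs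
  simpa [h0 j, hs'] using h5.symm

lemma local_data {p q : ℝ} (hn : 0 < n) (hp : 0 < p) (hq : 0 < q) {F : (Fin n → ℂ) → (Fin n → ℂ)}
    (hF : IsProperHolomorphic F (ellipsoid p n) (symEllipsoid q n)) :
    ∃ (ξ0 : Fin n → ℂ) (U : Set (Fin n → ℂ)) (G : (Fin n → ℂ) → (Fin n → ℂ)) (U' : Set (Fin n → ℂ))
      (ℓ : (Fin n → ℂ) → (Fin n → ℂ)), IsOpen U ∧ (fun j => Complex.exp (p * ξ0 j)) ∈ U ∧
      DifferentiableOn ℂ G U ∧ (∀ v, fderiv ℂ G (fun j => Complex.exp (p * ξ0 j)) v = 0 → v = 0) ∧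
      ∑ j, ‖Complex.exp (p * ξ0 j)‖ ^ 2 = 1 ∧
      (∀ x ∈ U, ∑ j, ‖x j‖ ^ 2 < 1 → ∑ j, ‖G x j‖ ^ 2 < 1) ∧
      (∀ x ∈ U, ∑ j, ‖x j‖ ^ 2 = 1 → ∑ j, ‖G x j‖ ^ 2 = 1) ∧
      IsOpen U' ∧ ξ0 ∈ U' ∧ DifferentiableOn ℂ ℓ U' ∧
      ∀ ξ ∈ U', (fun j => Complex.exp (p * ξ j)) ∈ U ∧
        (∀ j, G (fun j => Complex.exp (p * ξ j)) j = Complex.exp (q * ℓ ξ j)) ∧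
        (rho p (fun j => Complex.exp (ξ j)) < 1 → F (fun j => Complex.exp (ξ j)) = piMap n (fun j => Complex.exp (ℓ ξ j))) := by
  obtain ⟨ζ, U0, L, hU0, hζU0, hζ1, hζ0, hLζ0, hLd, hLinj, hin, hbd⟩ := lift_local hn hp hq hF
  have hpC : (p : ℂ) ≠ 0 := by exact_mod_cast hp.ne'
  set κ := L ζ with hκ
  set ξ0 : Fin n → ℂ := fun j => Complex.log (ζ j) with hξ0
  have hξζ : ∀ j, Complex.exp (ξ0 j) = ζ j := fun j => Complex.exp_log (hζ0 j)
  set μ : Fin n → ℂ := fun j => Complex.log (κ j) with hμ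
  have hμκ : ∀ j, Complex.exp (μ j) = κ j := fun j => Complex.exp_log (hLζ0 j)
  set x0 : Fin n → ℂ := fun j => Complex.exp (p * ξ0 j) with hx0
  have hx00 : ∀ j, x0 j ≠ 0 := fun j => Complex.exp_ne_zero _
  set μ0 : Fin n → ℂ := fun j => p * ξ0 j with hμ0
  set b := pw (1 / p) μ0 x0 with hb
  have hbx0 : b x0 = ζ := by
    funext j
    simp only [hb, pw, div_self (hx00 j), Complex.log_one, add_zero, hμ0, ← hξζ]
    congr 1
    push_cast
    field_simp
  set U1 := U0 ∩ L ⁻¹' pwd κ with hU1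
  have hU1o : IsOpen U1 := hLd.continuousOn.isOpen_inter_preimage hU0 (pwd_open κ)
  have hζU1 : ζ ∈ U1 := ⟨hζU0, pwd_self hLζ0⟩
  set U := pwd x0 ∩ b ⁻¹' U1 with hU
  have hUo : IsOpen U := (pw_diff _ _ _).continuousOn.isOpen_inter_preimage (pwd_open x0) hU1o
  have hx0U : x0 ∈ U := ⟨pwd_self hx00, by rw [Set.mem_preimage, hbx0]; exact hζU1⟩
  have hbd1 : DifferentiableOn ℂ b U := (pw_diff _ _ _).mono inter_subset_left
  have hLb : DifferentiableOn ℂ (fun x => L (b x)) U := (hLd.mono inter_subset_left).comp hbd1 fun x hx => hx.2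
  set G : (Fin n → ℂ) → (Fin n → ℂ) := fun x => pw q μ κ (L (b x)) with hG
  have hGd : DifferentiableOn ℂ G U := (pw_diff q μ κ).comp hLb fun x hx => hx.2.2
  have hbn : ∀ x ∈ U, rho p (b x) = ∑ j, ‖x j‖ ^ 2 := by
    intro x hx
    unfold rho
    refine Finset.sum_congr rfl fun j _ => ?_
    rw [hb, pw_norm (1 / p) hx00 (fun j => rfl) hx.1, ← Real.rpow_mul (norm_nonneg _), ← Real.rpow_natCast]
    congr 1
    push_cast
    field_simp
  have hGn : ∀ x ∈ U, ∑ j, ‖G x j‖ ^ 2 = rho q (L (b x)) := by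
    intro x hx
    unfold rho
    refine Finset.sum_congr rfl fun j _ => ?_
    rw [hG, pw_norm q hLζ0 hμκ hx.2.2, ← Real.rpow_natCast, ← Real.rpow_mul (norm_nonneg _)]
    congr 1
    push_cast
    ring
  set E : (Fin n → ℂ) → (Fin n → ℂ) := fun ξ j => Complex.exp (ξ j) with hE
  have hEd : Differentiable ℂ E := by
    refine differentiable_pi.2 fun j => ?_
    exact (differentiable_apply (𝕜 := ℂ) j).cexp
  set P : (Fin n → ℂ) → (Fin n → ℂ) := fun ξ j => Complex.exp (p * ξ j) with hP
  have hPc : Continuous P := continuous_pi fun j => by fun_prop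
  set U' : Set (Fin n → ℂ) := (⋂ j, {ξ : Fin n → ℂ | |(p * (ξ j - ξ0 j) : ℂ).im| < Real.pi}) ∩ (P ⁻¹' pwd x0 ∩ E ⁻¹' U1) with hU'
  have hU'o : IsOpen U' := by
    refine (isOpen_iInter_of_finite fun j => ?_).inter (((pwd_open x0).preimage hPc).inter (hU1o.preimage hEd.continuous))
    refine isOpen_lt ?_ continuous_const
    exact (Complex.continuous_im.comp (by fun_prop)).abs
  have hEζ : E ξ0 = ζ := funext hξζ
  have hbP : ∀ ξ ∈ U', b (P ξ) = E ξ := by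
    intro ξ hξ
    funext j
    have h1 : |(p * (ξ j - ξ0 j) : ℂ).im| < Real.pi := by
      have := mem_iInter.1 hξ.1 j; exact this
    rw [abs_lt] at h1
    simp only [hb, pw, hP, hE, hx0, hμ0]
    rw [← Complex.exp_sub, ← mul_sub, Complex.log_exp h1.1 h1.2.le]
    congr 1
    push_cast
    field_simp
    ring
  refine ⟨ξ0, U, G, U', fun ξ j => μ j + Complex.log (L (E ξ) j / κ j), hUo, hx0U, hGd, ?_, ?_, ?_, ?_, hU'o, ?_, ?_, ?_⟩
  · intro v hv
    have hb' : DifferentiableAt ℂ b x0 := (hbd1 x0 hx0U).differentiableAt (hUo.mem_nhds hx0U)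
    have hL' : DifferentiableAt ℂ L (b x0) := by
      rw [hbx0]; exact (hLd ζ hζU0).differentiableAt (hU0.mem_nhds hζU0)
    have hpw' : DifferentiableAt ℂ (pw q μ κ) (L (b x0)) := by
      rw [hbx0]; exact ((pw_diff q μ κ) κ (pwd_self hLζ0)).differentiableAt ((pwd_open κ).mem_nhds (pwd_self hLζ0))
    have h1 : HasFDerivAt G ((fderiv ℂ (pw q μ κ) (L (b x0))).comp ((fderiv ℂ L (b x0)).comp (fderiv ℂ b x0))) x0 :=
      HasFDerivAt.comp (g := pw q μ κ) (f := L ∘ b) x0 hpw'.hasFDerivAt (HasFDerivAt.comp x0 hL'.hasFDerivAt hb'.hasFDerivAt)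
    rw [h1.fderiv] at hv
    simp only [ContinuousLinearMap.comp_apply] at hv
    rw [hbx0] at hv
    have h2 := pw_inj hq.ne' hLζ0 hv
    exact pw_inj (by positivity) hx00 (hLinj _ h2)
  · have := hbn x0 hx0U
    rw [hbx0, hζ1] at this
    exact this.symm
  · intro x hx h
    rw [hGn x hx]
    exact (hin _ hx.2.1 (by rw [hbn x hx]; exact h)).2
  · intro x hx h
    rw [hGn x hx]
    exact (hbd _ hx.2.1 (by rw [hbn x hx]; exact h))
  · refine ⟨mem_iInter.2 fun j => ?_, pwd_self hx00, by rw [Set.mem_preimage, hEζ]; exact hζU1⟩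
    simp [Real.pi_pos]
  · refine (lg_diff μ κ).comp (hLd.comp hEd.differentiableOn fun ξ hξ => hξ.2.2.1) fun ξ hξ => hξ.2.2.2
  · intro ξ hξ
    have h1 := hbP ξ hξ
    refine ⟨⟨hξ.2.1, by rw [Set.mem_preimage]; exact h1 ▸ hξ.2.2⟩, ?_, ?_⟩
    · intro j
      show pw q μ κ (L (b (P ξ))) j = _
      rw [h1]
      rfl
    · intro h
      rw [(hin _ hξ.2.2.1 h).1]
      congr 1
      funext j
      rw [Complex.exp_add, hμκ, Complex.exp_log (div_ne_zero (pwd_ne hξ.2.2.2 j) (hLζ0 j)), mul_div_cancel₀ _ (hLζ0 j)]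

end SymEll

namespace SymEll
open Set Filter Topology MeasureTheory Metric
variable {n : ℕ}

/-- The Hermitian form `∑ x_j conj y_j`. -/
noncomputable def ip (x y : Fin n → ℂ) : ℂ := ∑ j, x j * (starRingEnd ℂ) (y j)

lemma ip_add_left (x y z : Fin n → ℂ) : ip (x + y) z = ip x z + ip y z := by
  simp only [ip, Pi.add_apply, add_mul, Finset.sum_add_distrib]

lemma ip_smul_left (c : ℂ) (x z : Fin n → ℂ) : ip (c • x) z = c * ip x z := by
  simp only [ip, Pi.smul_apply, smul_eq_mul, mul_assoc, Finset.mul_sum]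

lemma ip_conj (x y : Fin n → ℂ) : (starRingEnd ℂ) (ip x y) = ip y x := by
  simp only [ip, map_sum, map_mul, Complex.conj_conj, mul_comm]

lemma ip_add_right (x y z : Fin n → ℂ) : ip z (x + y) = ip z x + ip z y := by
  rw [← ip_conj, ip_add_left, map_add, ip_conj, ip_conj]

lemma ip_smul_right (c : ℂ) (x z : Fin n → ℂ) : ip z (c • x) = (starRingEnd ℂ) c * ip z x := by
  rw [← ip_conj, ip_smul_left, map_mul, ip_conj]

lemma ip_sub_left (x y z : Fin n → ℂ) : ip (x - y) z = ip x z - ip y z := by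
  simp only [ip, Pi.sub_apply, sub_mul, Finset.sum_sub_distrib]

lemma ip_sub_right (x y z : Fin n → ℂ) : ip z (x - y) = ip z x - ip z y := by
  rw [← ip_conj, ip_sub_left, map_sub, ip_conj, ip_conj]

lemma ip_self (x : Fin n → ℂ) : ip x x = ((∑ j, ‖x j‖ ^ 2 : ℝ) : ℂ) := by
  simp only [ip, Complex.mul_conj']
  push_cast
  rfl

lemma ip_zero_left (y : Fin n → ℂ) : ip 0 y = 0 := by simp [ip]
lemma ip_zero_right (y : Fin n → ℂ) : ip y 0 = 0 := by simp [ip]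

lemma ip_single_left (k : Fin n) (y : Fin n → ℂ) :
    ip (Pi.single k 1) y = (starRingEnd ℂ) (y k) := by
  classical
  simp only [ip]
  rw [Finset.sum_eq_single k]
  · simp
  · intro b _ hb; simp [Pi.single_eq_of_ne hb]
  · simp

lemma ip_single_right (k : Fin n) (y : Fin n → ℂ) : ip y (Pi.single k 1) = y k := by
  rw [← ip_conj, ip_single_left, Complex.conj_conj]

lemma continuous_ip : Continuous fun z : (Fin n → ℂ) × (Fin n → ℂ) => ip z.1 z.2 := by
  unfold ip
  apply continuous_finset_sum
  intro j _
  exact ((continuous_apply j).comp continuous_fst).mul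
    (Complex.continuous_conj.comp ((continuous_apply j).comp continuous_snd))

/-- `ip · y` as a continuous linear map. -/
noncomputable def ipL (y : Fin n → ℂ) : (Fin n → ℂ) →L[ℂ] ℂ :=
  LinearMap.toContinuousLinearMap
    { toFun := fun x => ip x y
      map_add' := fun a b => ip_add_left a b y
      map_smul' := fun c a => ip_smul_left c a y }

lemma ipL_apply (x y : Fin n → ℂ) : ipL y x = ip x y := rfl

lemma segre_P {x y : Fin n → ℂ} {c : ℂ} {x0 : Fin n → ℂ} {ρ : ℝ}
    (hx : x ∈ ball x0 (ρ/3)) (hy : y ∈ ball x0 (ρ/3)) (hc : ‖c‖ ≤ 1) :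
    x + c • (y - x) ∈ ball x0 ρ := by
  rw [mem_ball, dist_eq_norm] at *
  have e : x + c • (y - x) - x0 = (x - x0) + c • ((y - x0) - (x - x0)) := by
    rw [sub_sub_sub_cancel_right]; abel
  rw [e]
  calc _ ≤ ‖x - x0‖ + ‖c • ((y - x0) - (x - x0))‖ := norm_add_le _ _
    _ ≤ ‖x - x0‖ + 1 * (‖y - x0‖ + ‖x - x0‖) := by
      rw [norm_smul]; gcongr; exact norm_sub_le _ _
    _ < ρ := by linarith

lemma frac_norm_le {m : ℂ} {s : ℝ} (hm : 0 ≤ m.re) (hs : 0 < s) : ‖m / (m + s)‖ ≤ 1 := by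
  rw [norm_div]
  apply div_le_one_of_le₀ _ (norm_nonneg _)
  rw [Complex.norm_def, Complex.norm_def]
  apply Real.sqrt_le_sqrt
  simp only [Complex.normSq_apply, Complex.add_re, Complex.add_im, Complex.ofReal_re, Complex.ofReal_im]
  nlinarith

lemma frac_ne {m : ℂ} {s : ℝ} (hm : 0 ≤ m.re) (hs : 0 < s) : m + s ≠ 0 := by
  intro h
  have := congrArg Complex.re h
  simp at this
  linarith

theorem segre {G : (Fin n → ℂ) → (Fin n → ℂ)} {x0 : Fin n → ℂ} {ρ : ℝ}
    (hG : DifferentiableOn ℂ G (ball x0 ρ))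
    (hS : ∀ x ∈ ball x0 ρ, ∑ j, ‖x j‖^2 = 1 → ∑ j, ‖G x j‖^2 = 1)
    {x y : Fin n → ℂ} (hx : x ∈ ball x0 (ρ/3)) (hy : y ∈ ball x0 (ρ/3))
    (hx1 : ∑ j, ‖x j‖^2 < 1) (hxy : ip x y = 1) : ip (G x) (G y) = 1 := by
  have hρ : 0 < ρ := by
    have := pos_of_mem_ball hx; linarith
  set X := ∑ j, ‖x j‖^2 with hX
  set Y := ∑ j, ‖y j‖^2 with hY
  have hyx : ip y x = 1 := by rw [← ip_conj, hxy, map_one]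
  have hXY : 0 ≤ X - 2 + Y := by
    have h1 : ip (x - y) (x - y) = ((X - 2 + Y : ℝ) : ℂ) := by
      rw [ip_sub_left, ip_sub_right, ip_sub_right, hxy, hyx, ip_self, ip_self, ← hX, ← hY]
      push_cast; ring
    rw [ip_self] at h1
    have h2 := Complex.ofReal_injective h1
    rw [← h2]; positivity
  set s := (1 - X) / (Y - 1) with hs
  have hY1 : 0 < Y - 1 := by linarith
  have hs0 : 0 < s := div_pos (by linarith) hY1
  have hsY : s * (Y - 1) = 1 - X := div_mul_cancel₀ _ hY1.ne'
  set P : ℂ → (Fin n → ℂ) := fun m => x + (m / (m + (1:ℝ))) • (y - x) with hP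
  set P2 : ℂ → (Fin n → ℂ) := fun m => y + (m / (m + s)) • (x - y) with hP2
  set H : Set ℂ := {m | 0 < m.re} with hH
  have hHo : IsOpen H := isOpen_lt continuous_const Complex.continuous_re
  have hHc : Convex ℝ H := convex_halfSpace_re_gt 0
  have hPd : ∀ m : ℂ, 0 ≤ m.re → DifferentiableAt ℂ P m := by
    intro m hm
    have := frac_ne hm one_pos
    simp only [hP]
    fun_prop (disch := assumption)
  have hP2d : ∀ m : ℂ, 0 ≤ m.re → DifferentiableAt ℂ P2 m := by
    intro m hm
    have := frac_ne hm hs0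
    simp only [hP2]
    fun_prop (disch := assumption)
  have hPb : ∀ m : ℂ, 0 ≤ m.re → P m ∈ ball x0 ρ := fun m hm =>
    segre_P hx hy (frac_norm_le hm one_pos)
  have hP2b : ∀ m : ℂ, 0 ≤ m.re → P2 m ∈ ball x0 ρ := fun m hm =>
    segre_P hy hx (frac_norm_le hm hs0)
  have hGat : ∀ z ∈ ball x0 ρ, DifferentiableAt ℂ G z := fun z hz =>
    hG.differentiableAt (isOpen_ball.mem_nhds hz)
  set N : ℂ → ℂ := fun m => ip (G (P m)) (G (P2 ((starRingEnd ℂ) m))) - 1 with hN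
  have hNd : ∀ m : ℂ, 0 ≤ m.re → DifferentiableAt ℂ N m := by
    intro m hm
    simp only [hN, ip]
    apply DifferentiableAt.sub_const
    apply DifferentiableAt.fun_sum
    intro j _
    have h1 : DifferentiableAt ℂ (fun m => G (P m) j) m := by
      have := (hGat _ (hPb m hm)).comp m (hPd m hm)
      exact differentiableAt_pi.1 this j
    have hcm : 0 ≤ ((starRingEnd ℂ) m).re := by simpa using hm
    have h2 : DifferentiableAt ℂ (fun m => G (P2 m) j) ((starRingEnd ℂ) m) := by
      have := (hGat _ (hP2b _ hcm)).comp _ (hP2d _ hcm)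
      exact differentiableAt_pi.1 this j
    have h3 := h2.conj_conj
    rw [Complex.conj_conj] at h3
    exact h1.mul h3
  have hNz : ∀ m : ℂ, 0 < m.re → m * (starRingEnd ℂ) m = s → N m = 0 := by
    intro m hm hms
    have hm1 : m + (1:ℝ) ≠ 0 := frac_ne hm.le one_pos
    have hcm : 0 ≤ ((starRingEnd ℂ) m).re := by simpa using hm.le
    have hm2 : (starRingEnd ℂ) m + (s:ℂ) ≠ 0 := frac_ne hcm hs0
    have hm3 : (starRingEnd ℂ) m + (1:ℝ) ≠ 0 := frac_ne hcm one_pos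
    have e : P2 ((starRingEnd ℂ) m) = P m := by
      simp only [hP, hP2]
      have : (starRingEnd ℂ) m / ((starRingEnd ℂ) m + s) = 1 - m / (m + (1:ℝ)) := by
        rw [← hms] at hm2 ⊢
        rw [eq_sub_iff_add_eq, div_add_div _ _ hm2 hm1, div_eq_one_iff_eq (mul_ne_zero hm2 hm1)]
        push_cast; ring
      rw [this]
      module
    have e2 : ip (P m) (P m) = 1 := by
      simp only [hP]
      simp only [ip_add_left, ip_add_right, ip_smul_left, ip_smul_right, ip_sub_left, ip_sub_right, hxy, hyx, map_div₀, map_add, Complex.conj_ofReal]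
      rw [ip_self, ip_self, ← hX, ← hY]
      have h4 : (m * (starRingEnd ℂ) m) * ((Y:ℂ) - 1) = 1 - X := by
        rw [hms]; exact_mod_cast congrArg (fun r : ℝ => (r:ℂ)) hsY
      push_cast at hm1 hm3 ⊢
      field_simp
      linear_combination h4
    have e3 : ∑ j, ‖P m j‖^2 = 1 := by
      rw [ip_self] at e2; exact_mod_cast e2
    have e4 := hS _ (hPb m hm.le) e3
    simp only [hN]
    rw [e, ip_self, e4]; simp
  have hNan : AnalyticOnNhd ℂ N H :=
    DifferentiableOn.analyticOnNhd (fun m hm => (hNd m (le_of_lt hm)).differentiableWithinAt) hHo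
  have hsq : 0 < Real.sqrt s := Real.sqrt_pos.2 hs0
  have hfreq : ∃ᶠ m in 𝓝[≠] ((Real.sqrt s : ℝ) : ℂ), N m = 0 := by
    have hd : HasDerivAt (fun z : ℂ => (Real.sqrt s : ℂ) * Complex.exp (z * Complex.I))
        ((Real.sqrt s : ℂ) * (Complex.exp (0 * Complex.I) * (1 * Complex.I))) 0 :=
      (((hasDerivAt_id (0:ℂ)).mul_const Complex.I).cexp).const_mul _
    have ht := hd.tendsto_nhdsNE (by simp [hsq.ne'])
    have ht2 : Tendsto (fun r : ℝ => (r : ℂ)) (𝓝[≠] 0) (𝓝[≠] (0:ℂ)) := by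
      apply tendsto_nhdsWithin_of_tendsto_nhds_of_eventually_within
      · exact (Complex.continuous_ofReal.tendsto' 0 0 (by simp)).mono_left nhdsWithin_le_nhds
      · filter_upwards [self_mem_nhdsWithin] with r hr
        simpa using hr
    have ht3 := ht.comp ht2
    simp only [zero_mul, Complex.exp_zero, mul_one] at ht3
    apply ht3.frequently
    apply Eventually.frequently
    have : ∀ᶠ r : ℝ in 𝓝[≠] 0, 0 < Real.cos r := by
      apply nhdsWithin_le_nhds
      exact Real.continuous_cos.continuousAt.eventually (lt_mem_nhds (by simp))
    filter_upwards [this] with r hr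
    apply hNz
    · simp [Complex.exp_ofReal_mul_I_re, hsq, hr]
    · simp only [Function.comp]
      rw [map_mul, Complex.conj_ofReal, mul_mul_mul_comm, Complex.mul_conj', Complex.norm_exp_ofReal_mul_I]
      norm_cast
      rw [Real.mul_self_sqrt hs0.le]; simp
  have hNzero := hNan.eqOn_zero_of_preconnected_of_frequently_eq_zero hHc.isPreconnected
    (show ((Real.sqrt s : ℝ) : ℂ) ∈ H by simpa [hH] using hs0) hfreq
  have hlim : Tendsto (fun r : ℝ => N (r : ℂ)) (𝓝[>] 0) (𝓝 (N 0)) := by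
    have h1 : ContinuousAt (fun r : ℝ => N (r:ℂ)) 0 := by
      apply ContinuousAt.comp (g := N)
      · simpa using (hNd 0 (by simp)).continuousAt
      · exact Complex.continuous_ofReal.continuousAt
    have := h1.tendsto
    simp only [Complex.ofReal_zero] at this
    exact this.mono_left nhdsWithin_le_nhds
  have hlim0 : Tendsto (fun r : ℝ => N (r : ℂ)) (𝓝[>] 0) (𝓝 0) := by
    apply tendsto_const_nhds.congr'
    filter_upwards [self_mem_nhdsWithin] with r hr
    have : (r:ℂ) ∈ H := by simpa [hH] using hr
    exact (hNzero this).symm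
  have := tendsto_nhds_unique hlim hlim0
  simp [hN, hP, hP2] at this
  linear_combination this

end SymEll

namespace SymEll
open Set Filter Topology MeasureTheory Metric
variable {n : ℕ}

lemma hyper_frac {G : (Fin n → ℂ) → (Fin n → ℂ)} {x0 : Fin n → ℂ} {ρ : ℝ}
    (hG : DifferentiableOn ℂ G (ball x0 ρ))
    (hS : ∀ x ∈ ball x0 ρ, ∑ j, ‖x j‖^2 = 1 → ∑ j, ‖G x j‖^2 = 1)
    {x : Fin n → ℂ} (hx : x ∈ ball x0 (ρ/3)) (hd : (fderiv ℂ G x).det ≠ 0) :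
    ∃ (u0 : Fin n → ℂ) (u : Fin n → Fin n → ℂ), ∀ y ∈ ball x0 (ρ/3), ∑ j, ‖y j‖^2 < 1 → ip y x = 1 →
      ip y u0 ≠ 0 ∧ ∀ k, G y k * ip y u0 = ip y (u k) := by
  have hρ : 0 < ρ := by
    have := pos_of_mem_ball hx; linarith
  obtain ⟨u0, hu0⟩ := (clm_bijective hd).2 (G x)
  choose u hu using fun k : Fin n => (clm_bijective hd).2 (Pi.single k 1)
  refine ⟨u0, u, fun y hy hy1 hyx => ?_⟩
  have hxy : ip x y = 1 := by rw [← ip_conj, hyx, map_one]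
  have hseg : ∀ x' ∈ ball x0 (ρ/3), ip x' y = 1 → ip (G x') (G y) = 1 := by
    intro x' hx' h
    rw [← ip_conj, segre hG hS hy hx' hy1 (by rw [← ip_conj, h, map_one]), map_one]
  have hxρ : x ∈ ball x0 ρ := ball_subset_ball (by linarith) hx
  have hGx : HasFDerivAt G (fderiv ℂ G x) x :=
    (hG.differentiableAt (isOpen_ball.mem_nhds hxρ)).hasFDerivAt
  have hker : ∀ w, ip w y = 0 → ip (fderiv ℂ G x w) (G y) = 0 := by
    intro w hw
    have h1 : HasDerivAt (fun s : ℂ => x + s • w) w 0 := by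
      simpa using ((hasDerivAt_id (0:ℂ)).smul_const w).const_add x
    have h2 : HasDerivAt (fun s : ℂ => ip (G (x + s • w)) (G y)) (ip (fderiv ℂ G x w) (G y)) 0 := by
      have hg : HasFDerivAt G (fderiv ℂ G x) (x + (0:ℂ) • w) := by simpa using hGx
      have := (ipL (G y)).hasFDerivAt.comp_hasDerivAt (0:ℂ) (hg.comp_hasDerivAt (0:ℂ) h1)
      exact this
    have h3 : HasDerivAt (fun s : ℂ => ip (G (x + s • w)) (G y)) 0 0 := by
      apply (hasDerivAt_const (0:ℂ) (1:ℂ)).congr_of_eventuallyEq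
      have : ∀ᶠ s : ℂ in 𝓝 0, x + s • w ∈ ball x0 (ρ/3) := by
        apply h1.continuousAt.eventually
        simp only [zero_smul, add_zero]
        exact isOpen_ball.mem_nhds hx
      filter_upwards [this] with s hs
      apply hseg _ hs
      rw [ip_add_left, ip_smul_left, hw, hxy]; simp
    exact h2.unique h3
  set κ := ip (fderiv ℂ G x x) (G y) with hκ
  have hall : ∀ w, ip (fderiv ℂ G x w) (G y) = ip w y * κ := by
    intro w
    have := hker (w - (ip w y) • x) (by rw [ip_sub_left, ip_smul_left, hxy]; ring)
    rw [map_sub, map_smul, ip_sub_left, ip_smul_left] at this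
    linear_combination this
  have h0 := hall u0
  rw [hu0, hseg x hx hxy] at h0
  have hu0y : ip u0 y ≠ 0 := by
    intro h; rw [h] at h0; simp at h0
  refine ⟨fun h => hu0y (by rw [← ip_conj, h, map_zero]), fun k => ?_⟩
  have hk := hall (u k)
  rw [hu, ip_single_left] at hk
  rw [← ip_conj u0, ← ip_conj (u k), ← Complex.conj_conj (G y k), ← map_mul, hk]
  congr 1
  linear_combination (-ip (u k) y) * h0

/-- Second order consequence of being projective on a line. -/
lemma line_frac {G : (Fin n → ℂ) → (Fin n → ℂ)} {W : Set (Fin n → ℂ)} (hW : IsOpen W)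
    (hG : DifferentiableOn ℂ G W) {y0 v : Fin n → ℂ} (hy0 : y0 ∈ W)
    {u0 : Fin n → ℂ} {u : Fin n → Fin n → ℂ} {T : Set ℂ} (hT : T ∈ 𝓝 (0:ℂ))
    (h : ∀ t ∈ T, ip (y0 + t • v) u0 ≠ 0 ∧ ∀ k, G (y0 + t • v) k * ip (y0 + t • v) u0 = ip (y0 + t • v) (u k)) :
    ∃ θ : ℂ, (∀ t ∈ T, (1 - t * θ) • (G (y0 + t • v) - G y0) = t • fderiv ℂ G y0 v) ∧
      fderiv ℂ (fderiv ℂ G) y0 v v = (2 * θ) • fderiv ℂ G y0 v := by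
  set a := ip y0 u0
  set b := ip v u0
  have h0 := h 0 (mem_of_mem_nhds hT)
  simp only [zero_smul, add_zero] at h0
  have ha : a ≠ 0 := h0.1
  set g : ℂ → (Fin n → ℂ) := fun t => G (y0 + t • v) with hg
  have hline : ∀ t, HasDerivAt (fun s : ℂ => y0 + s • v) v t := fun t => by
    simpa using ((hasDerivAt_id t).smul_const v).const_add y0
  have hev : ∀ᶠ t : ℂ in 𝓝 0, y0 + t • v ∈ W := by
    apply (hline 0).continuousAt.eventually
    simpa using hW.mem_nhds hy0
  have hgd : ∀ t, y0 + t • v ∈ W → HasDerivAt g (fderiv ℂ G (y0 + t • v) v) t := by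
    intro t ht
    have := (hG.differentiableAt (hW.mem_nhds ht)).hasFDerivAt.comp_hasDerivAt t (hline t)
    exact this
  have hgd0 : HasDerivAt g (fderiv ℂ G y0 v) 0 := by
    have := hgd 0 (by simpa using hy0)
    simpa using this
  set θ := -b / a with hθ
  set d : Fin n → ℂ := fun k => ip v (u k) / a with hd
  have hTe : ∀ t ∈ T, (1 - t * θ) • g t = G y0 + t • d := by
    intro t ht
    funext k
    have h1 := (h t ht).2 k
    have h2 := h0.2 k
    simp only [ip_add_left, ip_smul_left] at h1
    simp only [hg, hd, hθ, Pi.smul_apply, Pi.add_apply, smul_eq_mul]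
    field_simp
    linear_combination h1 - h2
  have hd' : fderiv ℂ G y0 v - θ • G y0 = d := by
    have h1 : HasDerivAt (fun t : ℂ => (1 - t * θ) • g t)
        ((1 - 0 * θ) • fderiv ℂ G y0 v + (-(1 * θ)) • g 0) 0 :=
      HasDerivAt.smul (((hasDerivAt_id (0:ℂ)).mul_const θ).const_sub 1) hgd0
    have h2 : HasDerivAt (fun t : ℂ => (1 - t * θ) • g t) d 0 := by
      have : HasDerivAt (fun t : ℂ => G y0 + t • d) d 0 := by
        simpa using ((hasDerivAt_id (0:ℂ)).smul_const d).const_add (G y0)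
      apply this.congr_of_eventuallyEq
      filter_upwards [hT] with t ht using hTe t ht
    have := h1.unique h2
    rw [← this]
    simp only [hg, zero_smul, add_zero]
    module
  have hfin : ∀ t ∈ T, (1 - t * θ) • (g t - G y0) = t • fderiv ℂ G y0 v := by
    intro t ht
    rw [smul_sub, hTe t ht, ← hd']
    module
  refine ⟨θ, hfin, ?_⟩
  -- first derivative identity near 0
  have hD1 : ∀ᶠ t in 𝓝 (0:ℂ), (1 - t * θ) • fderiv ℂ G (y0 + t • v) v + (-(1 * θ)) • (g t - G y0)
      = fderiv ℂ G y0 v := by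
    filter_upwards [hev, eventually_eventually_nhds.2 (show ∀ᶠ t in 𝓝 (0:ℂ), t ∈ T from hT)] with t ht1 ht2
    have h1 : HasDerivAt (fun t : ℂ => (1 - t * θ) • (g t - G y0))
        ((1 - t * θ) • fderiv ℂ G (y0 + t • v) v + (-(1 * θ)) • (g t - G y0)) t :=
      HasDerivAt.smul (((hasDerivAt_id t).mul_const θ).const_sub 1) ((hgd t ht1).sub_const _)
    have h2 : HasDerivAt (fun t : ℂ => (1 - t * θ) • (g t - G y0)) (fderiv ℂ G y0 v) t := by
      have : HasDerivAt (fun t : ℂ => t • fderiv ℂ G y0 v) (fderiv ℂ G y0 v) t := by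
        simpa using ((hasDerivAt_id t).smul_const (fderiv ℂ G y0 v))
      apply this.congr_of_eventuallyEq
      filter_upwards [ht2] with s hs using hfin s hs
    exact h1.unique h2
  have hDG : HasFDerivAt (fderiv ℂ G) (fderiv ℂ (fderiv ℂ G) y0) y0 :=
    ((differentiableOn_fderiv hW hG).differentiableAt (hW.mem_nhds hy0)).hasFDerivAt
  have hDGl : HasDerivAt (fun t : ℂ => fderiv ℂ G (y0 + t • v) v) (fderiv ℂ (fderiv ℂ G) y0 v v) 0 := by
    have hh : HasFDerivAt (fderiv ℂ G) (fderiv ℂ (fderiv ℂ G) y0) (y0 + (0:ℂ) • v) := by simpa using hDG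
    have := hh.comp_hasDerivAt (0:ℂ) (hline 0)
    have h2 := this.clm_apply (hasDerivAt_const (0:ℂ) v)
    simpa using h2
  have h1 : HasDerivAt (fun t : ℂ => (1 - t * θ) • fderiv ℂ G (y0 + t • v) v + (-(1 * θ)) • (g t - G y0))
      (((1 - 0 * θ) • fderiv ℂ (fderiv ℂ G) y0 v v + (-(1 * θ)) • fderiv ℂ G (y0 + (0:ℂ) • v) v)
        + (-(1 * θ)) • fderiv ℂ G y0 v) 0 :=
    (HasDerivAt.smul (((hasDerivAt_id (0:ℂ)).mul_const θ).const_sub 1) hDGl).add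
      ((hgd0.sub_const _).const_smul (-(1 * θ)))
  have h2 : HasDerivAt (fun t : ℂ => (1 - t * θ) • fderiv ℂ G (y0 + t • v) v + (-(1 * θ)) • (g t - G y0))
      0 0 := by
    apply (hasDerivAt_const (0:ℂ) (fderiv ℂ G y0 v)).congr_of_eventuallyEq
    filter_upwards [hD1] with t ht using ht
  have h3 := h1.unique h2
  simp only [zero_smul, add_zero, zero_mul, sub_zero, one_smul, one_mul] at h3
  have : fderiv ℂ (fderiv ℂ G) y0 v v = (2 * θ) • fderiv ℂ G y0 v +
    (fderiv ℂ (fderiv ℂ G) y0 v v + -θ • fderiv ℂ G y0 v + -θ • fderiv ℂ G y0 v) := by module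
  rw [this, h3, add_zero]

/-- A quadratic map proportional to the identity is linear times the identity. -/
lemma quad_linear (hn : 2 ≤ n) (B : (Fin n → ℂ) →L[ℂ] (Fin n → ℂ) →L[ℂ] (Fin n → ℂ))
    {v0 : Fin n → ℂ} (θ : (Fin n → ℂ) → ℂ) {i : Fin n} (hi : v0 i ≠ 0)
    (h : ∀ᶠ v in 𝓝 v0, B v v = (2 * θ v) • v) :
    ∃ L : (Fin n → ℂ) →L[ℂ] ℂ, ∀ᶠ v in 𝓝 v0, θ v = L v := by
  classical
  have hall : ∀ j, ∀ v, B v v i * v j = B v v j * v i := by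
    intro j v
    have hB : Differentiable ℂ fun v => B v v := B.differentiable.clm_apply differentiable_id
    have hB' := differentiable_pi.1 hB
    have hd : Differentiable ℂ (fun v => B v v i * v j - B v v j * v i) :=
      ((hB' i).mul (differentiable_apply j)).sub ((hB' j).mul (differentiable_apply i))
    have hev : ∀ᶠ v in 𝓝 v0, B v v i * v j - B v v j * v i = 0 := by
      filter_upwards [h] with v hv
      rw [hv]; simp only [Pi.smul_apply, smul_eq_mul]; ring
    have := eqOn_zero_of_convex isOpen_univ convex_univ hd.differentiableOn (mem_univ v0) hev v (mem_univ v)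
    exact sub_eq_zero.1 this
  have hz : ∀ v, v i = 0 → B v v i = 0 := by
    intro v hv
    by_cases hv0 : v = 0
    · simp [hv0]
    · obtain ⟨j, hj⟩ := Function.ne_iff.1 hv0
      have := hall j v
      rw [hv, mul_zero] at this
      exact (mul_eq_zero.1 this).resolve_right hj
  set e : Fin n → ℂ := Pi.single i 1 with he
  have hei : e i = 1 := by simp [he]
  set pr : (Fin n → ℂ) →L[ℂ] ℂ := ContinuousLinearMap.proj i with hpr
  refine ⟨(2:ℂ)⁻¹ • (pr ∘L (B e) + pr ∘L (B.flip e) - (B e e i) • pr), ?_⟩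
  filter_upwards [h, (continuous_apply i).continuousAt.eventually_ne hi] with v hv hvi
  have h1 := hz (v - v i • e) (by simp [hei])
  have h2 := congrFun hv i
  simp only [map_sub, map_smul, ContinuousLinearMap.sub_apply, ContinuousLinearMap.smul_apply,
    Pi.sub_apply, Pi.smul_apply, smul_eq_mul] at h1 h2
  simp only [hpr, ContinuousLinearMap.smul_apply, ContinuousLinearMap.sub_apply, ContinuousLinearMap.add_apply,
    ContinuousLinearMap.comp_apply, ContinuousLinearMap.proj_apply, ContinuousLinearMap.flip_apply, smul_eq_mul]
  apply mul_left_cancel₀ hvi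
  linear_combination (1/2) * h1 - (1/2) * h2

theorem lin_frac (hn : 2 ≤ n) {G : (Fin n → ℂ) → (Fin n → ℂ)} {U : Set (Fin n → ℂ)} {x0 : Fin n → ℂ}
    (hU : IsOpen U) (hx0 : x0 ∈ U) (hG : DifferentiableOn ℂ G U)
    (hinj : ∀ v, fderiv ℂ G x0 v = 0 → v = 0) (hsph : ∑ j, ‖x0 j‖^2 = 1)
    (hS : ∀ x ∈ U, ∑ j, ‖x j‖^2 = 1 → ∑ j, ‖G x j‖^2 = 1) :
    ∃ (y0 : Fin n → ℂ) (r : ℝ) (θ : (Fin n → ℂ) →L[ℂ] ℂ), 0 < r ∧ ball x0 r ⊆ U ∧ y0 ∈ ball x0 r ∧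
      ∑ j, ‖y0 j‖^2 < 1 ∧ (fderiv ℂ G y0).det ≠ 0 ∧
      ∀ y ∈ ball x0 r, (1 - θ (y - y0)) • (G y - G y0) = fderiv ℂ G y0 (y - y0) := by
  have hdc : ContinuousAt (fun x => (fderiv ℂ G x).det) x0 :=
    ((differentiableOn_clm_det (differentiableOn_fderiv hU hG)).continuousOn x0 hx0).continuousAt (hU.mem_nhds hx0)
  obtain ⟨ρ, hρ, hρU⟩ : ∃ ρ > 0, ball x0 ρ ⊆ U ∩ {x | (fderiv ℂ G x).det ≠ 0} :=
    Metric.mem_nhds_iff.1 (inter_mem (hU.mem_nhds hx0) (hdc.eventually_ne (clm_det_ne_zero hinj)))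
  have hGb : DifferentiableOn ℂ G (ball x0 ρ) := hG.mono fun x hx => (hρU hx).1
  have hSb : ∀ x ∈ ball x0 ρ, ∑ j, ‖x j‖^2 = 1 → ∑ j, ‖G x j‖^2 = 1 := fun x hx => hS x (hρU hx).1
  have hx00 : ip x0 x0 = 1 := by rw [ip_self, hsph]; simp
  have hb3 : ball x0 (ρ/3) ⊆ ball x0 ρ := ball_subset_ball (by linarith)
  obtain ⟨c, hc0, hc1, hcb, hcb'⟩ : ∃ c : ℝ, 0 < c ∧ c < 1 ∧ (c:ℂ) • x0 ∈ ball x0 (ρ/3) ∧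
      ((c:ℂ)⁻¹) • x0 ∈ ball x0 (ρ/3) := by
    have h1 : ContinuousAt (fun c : ℝ => (c:ℂ) • x0) 1 := by fun_prop
    have h2 : ContinuousAt (fun c : ℝ => ((c:ℂ)⁻¹) • x0) 1 := by
      refine ContinuousAt.fun_smul ?_ continuousAt_const
      apply ContinuousAt.inv₀ (by fun_prop) (by simp)
    have hm : ball x0 (ρ/3) ∈ 𝓝 x0 := ball_mem_nhds _ (by linarith)
    have e1 : ∀ᶠ c : ℝ in 𝓝 1, (c:ℂ) • x0 ∈ ball x0 (ρ/3) := h1 (by simpa using hm)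
    have e2 : ∀ᶠ c : ℝ in 𝓝 1, ((c:ℂ)⁻¹) • x0 ∈ ball x0 (ρ/3) := h2 (by simpa using hm)
    have e3 : ∀ᶠ c : ℝ in 𝓝 1, 0 < c := lt_mem_nhds one_pos
    obtain ⟨c, ⟨⟨⟨h1, h2⟩, h3⟩, h4⟩⟩ := (((((e1.and e2).and e3).filter_mono nhdsWithin_le_nhds).and
      (self_mem_nhdsWithin : Iio (1:ℝ) ∈ 𝓝[<] 1)).exists)
    exact ⟨c, h3, h4, h1, h2⟩
  have hcC : (c:ℂ) ≠ 0 := by exact_mod_cast hc0.ne'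
  set y0 : Fin n → ℂ := (c:ℂ) • x0 with hy0
  set x1 : Fin n → ℂ := ((c:ℂ)⁻¹) • x0 with hx1
  have hyx : ip y0 x1 = 1 := by
    rw [ip_smul_left, ip_smul_right, hx00, map_inv₀, Complex.conj_ofReal, mul_one, mul_inv_cancel₀ hcC]
  have hy1 : ∑ j, ‖y0 j‖^2 < 1 := by
    have : ∑ j, ‖y0 j‖^2 = c^2 * ∑ j, ‖x0 j‖^2 := by
      simp only [hy0, Pi.smul_apply, norm_smul, mul_pow, Finset.mul_sum, Complex.norm_real, Real.norm_eq_abs, sq_abs]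
    rw [this, hsph]; nlinarith
  obtain ⟨v0, hv0, hv0x⟩ : ∃ v0 : Fin n → ℂ, v0 ≠ 0 ∧ ip v0 x0 = 0 := by
    have : LinearMap.ker (ipL x0 : (Fin n → ℂ) →ₗ[ℂ] ℂ) ≠ ⊥ := by
      apply LinearMap.ker_ne_bot_of_finrank_lt
      simp; omega
    obtain ⟨v, hv, hv0⟩ := Submodule.exists_mem_ne_zero_of_ne_bot this
    exact ⟨v, hv0, hv⟩
  have hx1v : ip x1 v0 = 0 := by
    rw [ip_smul_left, ← ip_conj, hv0x]; simp
  clear_value y0 x1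
  obtain ⟨i, hi⟩ := Function.ne_iff.1 hv0
  have hv0v : ip v0 v0 ≠ 0 := by
    rw [ip_self]
    have : 0 < ∑ j, ‖v0 j‖^2 := Finset.sum_pos' (fun j _ => by positivity) ⟨i, mem_univ i, by
      have : 0 < ‖v0 i‖ := norm_pos_iff.2 hi
      positivity⟩
    exact_mod_cast this.ne'
  set W : Set (Fin n → ℂ) := ball x0 (ρ/3) ∩ {y | ∑ j, ‖y j‖^2 < 1} with hW
  have hWo : IsOpen W := isOpen_ball.inter (isOpen_lt (by fun_prop) continuous_const)
  have hy0W : y0 ∈ W := ⟨hcb, hy1⟩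
  set zv : (Fin n → ℂ) → (Fin n → ℂ) := fun v => x1 - (ip x1 v / ip v v) • v with hzv
  have hzc : ContinuousAt zv v0 := by
    apply continuousAt_const.sub
    refine ContinuousAt.fun_smul ?_ continuousAt_id
    refine ContinuousAt.div (f := fun v => ip x1 v) (g := fun v => ip v v) ?_ ?_ hv0v
    · exact (continuous_ip.comp (Continuous.prodMk continuous_const continuous_id)).continuousAt
    · exact (continuous_ip.comp (Continuous.prodMk continuous_id continuous_id)).continuousAt
  have hz0 : zv v0 = x1 := by simp [hzv, hx1v]
  have hpc : ContinuousAt (fun v => ip y0 (zv v)) v0 :=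
    (continuous_ip.continuousAt (x := (y0, zv v0))).comp (f := fun v => (y0, zv v)) (continuousAt_const.prodMk hzc)
  set xv : (Fin n → ℂ) → (Fin n → ℂ) := fun v => ((starRingEnd ℂ) (ip y0 (zv v)))⁻¹ • zv v with hxv
  have hxc : ContinuousAt xv v0 := by
    refine ContinuousAt.fun_smul ?_ hzc
    apply ContinuousAt.inv₀
    · exact Complex.continuous_conj.continuousAt.comp hpc
    · rw [hz0, hyx]; simp
  have hxv0 : xv v0 = x1 := by simp only [hxv, hz0, hyx]; simp
  have hvv : ∀ᶠ v in 𝓝 v0, ip v v ≠ 0 :=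
    ((continuous_ip.comp (Continuous.prodMk continuous_id continuous_id)).continuousAt (x := v0)).eventually_ne hv0v
  have hpne : ∀ᶠ v in 𝓝 v0, ip y0 (zv v) ≠ 0 := hpc.eventually_ne (by rw [hz0, hyx]; exact one_ne_zero)
  have hxvb : ∀ᶠ v in 𝓝 v0, xv v ∈ ball x0 (ρ/3) := hxc (by rw [hxv0]; exact isOpen_ball.mem_nhds hcb')
  have hline : ∀ᶠ v in 𝓝 v0, ∃ θ : ℂ,
      (∀ t ∈ {t : ℂ | y0 + t • v ∈ W}, (1 - t * θ) • (G (y0 + t • v) - G y0) = t • fderiv ℂ G y0 v) ∧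
      fderiv ℂ (fderiv ℂ G) y0 v v = (2 * θ) • fderiv ℂ G y0 v := by
    filter_upwards [hvv, hpne, hxvb] with v h1 h2 h3
    obtain ⟨u0, u, hu⟩ := hyper_frac hGb hSb h3 (hρU (hb3 h3)).2
    apply line_frac isOpen_ball hGb (hb3 hcb) (u0 := u0) (u := u)
    · have : ContinuousAt (fun t : ℂ => y0 + t • v) 0 := by fun_prop
      exact this (by simp only [zero_smul, add_zero]; exact hWo.mem_nhds hy0W)
    · intro t ht
      apply hu _ ht.1 ht.2
      have e1 : ip y0 (xv v) = 1 := by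
        simp only [hxv]
        rw [ip_smul_right, map_inv₀, Complex.conj_conj, inv_mul_cancel₀ h2]
      have e2 : ip v (zv v) = 0 := by
        simp only [hzv]
        rw [ip_sub_right, ip_smul_right, map_div₀, ip_conj, ip_conj, div_mul_cancel₀ _ h1, sub_self]
      have e3 : ip v (xv v) = 0 := by
        simp only [hxv]; rw [ip_smul_right, e2, mul_zero]
      rw [ip_add_left, ip_smul_left, e1, e3]; simp
  obtain ⟨θ, hθ⟩ := hline.choice
  have hdet : (fderiv ℂ G y0).det ≠ 0 := (hρU (hb3 hcb)).2
  obtain ⟨Di, hDi⟩ : ∃ Di : (Fin n → ℂ) →L[ℂ] (Fin n → ℂ), ∀ v, Di (fderiv ℂ G y0 v) = v := by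
    have hinj : LinearMap.ker (fderiv ℂ G y0 : (Fin n → ℂ) →ₗ[ℂ] (Fin n → ℂ)) = ⊥ :=
      LinearMap.ker_eq_bot.2 (clm_bijective hdet).1
    obtain ⟨g, hg⟩ := LinearMap.exists_leftInverse_of_injective _ hinj
    exact ⟨LinearMap.toContinuousLinearMap g, fun v => LinearMap.congr_fun hg v⟩
  obtain ⟨L, hL⟩ := quad_linear hn
    ((ContinuousLinearMap.compL ℂ (Fin n → ℂ) (Fin n → ℂ) (Fin n → ℂ) Di) ∘L (fderiv ℂ (fderiv ℂ G) y0))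
    θ hi (by
      filter_upwards [hθ] with v hv
      have := congrArg Di hv.2
      rw [map_smul, hDi] at this
      exact this)
  obtain ⟨t0, ht0W, ht0⟩ : ∃ t0 : ℂ, y0 + t0 • v0 ∈ W ∧ t0 ≠ 0 := by
    have h1 : ContinuousAt (fun t : ℂ => y0 + t • v0) 0 := by fun_prop
    have e1 : ∀ᶠ t : ℂ in 𝓝 0, y0 + t • v0 ∈ W := h1 (by simpa using hWo.mem_nhds hy0W)
    exact ((e1.filter_mono nhdsWithin_le_nhds).and (self_mem_nhdsWithin : {(0:ℂ)}ᶜ ∈ 𝓝[≠] 0)).exists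
  refine ⟨y0, ρ, L, hρ, fun x hx => (hρU hx).1, hb3 hcb, hy1, hdet, ?_⟩
  have hfd : DifferentiableOn ℂ (fun y => (1 - L (y - y0)) • (G y - G y0) - fderiv ℂ G y0 (y - y0)) (ball x0 ρ) := by
    have h1 : Differentiable ℂ fun y => L (y - y0) := L.differentiable.comp (differentiable_id.sub_const y0)
    have h2 : Differentiable ℂ fun y => fderiv ℂ G y0 (y - y0) :=
      (fderiv ℂ G y0).differentiable.comp (differentiable_id.sub_const y0)
    exact ((h1.const_sub 1).differentiableOn.smul (hGb.sub_const _)).sub h2.differentiableOn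
  have hev : ∀ᶠ y in 𝓝 (y0 + t0 • v0), (1 - L (y - y0)) • (G y - G y0) - fderiv ℂ G y0 (y - y0) = 0 := by
    have hcont : ContinuousAt (fun y : Fin n → ℂ => t0⁻¹ • (y - y0)) (y0 + t0 • v0) := by fun_prop
    have hval : t0⁻¹ • (y0 + t0 • v0 - y0) = v0 := by
      rw [add_sub_cancel_left, smul_smul, inv_mul_cancel₀ ht0, one_smul]
    have e1 : ∀ᶠ y in 𝓝 (y0 + t0 • v0), _ :=
      hcont.eventually (by simp only [hval]; exact hθ.and hL)
    filter_upwards [e1, hWo.mem_nhds ht0W] with y hy hyW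
    have hyy : y0 + t0 • (t0⁻¹ • (y - y0)) = y := by
      rw [smul_smul, mul_inv_cancel₀ ht0, one_smul]; abel
    have h1 := hy.1.1 t0 (by simpa only [Set.mem_setOf_eq, hyy] using hyW)
    rw [hyy, hy.2, map_smul, map_smul, smul_smul, mul_inv_cancel₀ ht0, one_smul, smul_eq_mul, mul_inv_cancel_left₀ ht0] at h1
    rw [h1, sub_self]
  intro y hy
  have := eqOn_zero_of_convex isOpen_ball (convex_ball x0 ρ) hfd (hb3 ht0W.1) hev y hy
  exact sub_eq_zero.1 this

end SymEll

namespace SymEll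
open Set Filter Topology MeasureTheory Metric
variable {n : ℕ}

lemma ip_self_eq_zero {x : Fin n → ℂ} (h : ∑ j, ‖x j‖^2 = 0) : x = 0 := by
  funext j
  have := (Finset.sum_eq_zero_iff_of_nonneg (fun j _ => by positivity)).1 h j (mem_univ j)
  simpa using this

theorem auto_form (hn : 2 ≤ n) {G : (Fin n → ℂ) → (Fin n → ℂ)} {U : Set (Fin n → ℂ)} {x0 : Fin n → ℂ}
    (hU : IsOpen U) (hx0 : x0 ∈ U) (hG : DifferentiableOn ℂ G U)
    (hinj : ∀ v, fderiv ℂ G x0 v = 0 → v = 0) (hsph : ∑ j, ‖x0 j‖^2 = 1)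
    (hI : ∀ x ∈ U, ∑ j, ‖x j‖^2 < 1 → ∑ j, ‖G x j‖^2 < 1)
    (hS : ∀ x ∈ U, ∑ j, ‖x j‖^2 = 1 → ∑ j, ‖G x j‖^2 = 1) :
    ∃ (A : (Fin n → ℂ) → (Fin n → ℂ)) (A0 : (Fin n → ℂ) → ℂ) (M : (Fin n → ℂ) →L[ℂ] (Fin n → ℂ))
      (m : (Fin n → ℂ) →L[ℂ] ℂ) (c r : ℝ), 0 < c ∧ 0 < r ∧
      (∀ x, A x = A 0 + M x) ∧ (∀ x, A0 x = A0 0 + m x) ∧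
      (∀ x y, ip (A x) (A y) - A0 x * (starRingEnd ℂ) (A0 y) = c * (ip x y - 1)) ∧
      (∀ y ∈ ball x0 r, A0 y • G y = A y) ∧ ∃ a, ∑ j, ‖a j‖^2 < 1 ∧ A a = 0 := by
  obtain ⟨y0, r, θ, hr, hrU, hy0, hy1, hdet, hlf⟩ := lin_frac hn hU hx0 hG hinj hsph hS
  set g0 := G y0 with hg0
  set D := fderiv ℂ G y0 with hD
  set A0 : (Fin n → ℂ) → ℂ := fun y => 1 - θ (y - y0) with hA0
  set A : (Fin n → ℂ) → (Fin n → ℂ) := fun y => (1 - θ (y - y0)) • g0 + D (y - y0) with hA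
  set M : (Fin n → ℂ) →L[ℂ] (Fin n → ℂ) := D - θ.smulRight g0 with hM
  have hAM : ∀ x w, A (x + w) = A x + M w := by
    intro x w
    simp only [hA, hM, ContinuousLinearMap.sub_apply, ContinuousLinearMap.smulRight_apply,
      add_sub_right_comm x w y0, map_add]
    module
  have hA0m : ∀ x w, A0 (x + w) = A0 x + (-θ) w := by
    intro x w
    simp only [hA0, ContinuousLinearMap.neg_apply, add_sub_right_comm x w y0, map_add]
    ring
  have hAG : ∀ y ∈ ball x0 r, A0 y • G y = A y := by
    intro y hy
    have := hlf y hy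
    simp only [hA0, hA]
    rw [← this]; module
  set h : (Fin n → ℂ) → (Fin n → ℂ) → ℂ := fun x y => ip (A x) (A y) - A0 x * (starRingEnd ℂ) (A0 y) with hh
  have hherm : ∀ x y, (starRingEnd ℂ) (h x y) = h y x := by
    intro x y
    simp only [hh, map_sub, map_mul, ip_conj, Complex.conj_conj]; ring
  have hadd : ∀ x w y, h (x + w) y = h x y + (ip (M w) (A y) + θ w * (starRingEnd ℂ) (A0 y)) := by
    intro x w y
    simp only [hh, hAM, hA0m, ip_add_left, ContinuousLinearMap.neg_apply]; ring
  have hGb : DifferentiableOn ℂ G (ball x0 r) := hG.mono hrU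
  have hb3 : ball x0 (r/3) ⊆ ball x0 r := ball_subset_ball (by linarith)
  have hzero : ∀ x ∈ ball x0 (r/3), ∀ y ∈ ball x0 (r/3), ∑ j, ‖y j‖^2 < 1 → ip x y = 1 → h x y = 0 := by
    intro x hx y hy hyi hxy
    have h1 : ip (G x) (G y) = 1 := by
      rw [← ip_conj, segre hGb (fun x hx => hS x (hrU hx)) hy hx hyi (by rw [← ip_conj, hxy, map_one]), map_one]
    simp only [hh]
    rw [← hAG x (hb3 hx), ← hAG y (hb3 hy), ip_smul_left, ip_smul_right, h1]; ring
  have hx00 : ip x0 x0 = 1 := by rw [ip_self, hsph]; simp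
  obtain ⟨c, hc0, hc1, hcb, hcb'⟩ : ∃ c : ℝ, 0 < c ∧ c < 1 ∧ (c:ℂ) • x0 ∈ ball x0 (r/3) ∧
      ((c:ℂ)⁻¹) • x0 ∈ ball x0 (r/3) := by
    have h1 : ContinuousAt (fun c : ℝ => (c:ℂ) • x0) 1 := by fun_prop
    have h2 : ContinuousAt (fun c : ℝ => ((c:ℂ)⁻¹) • x0) 1 := by
      refine ContinuousAt.fun_smul ?_ continuousAt_const
      apply ContinuousAt.inv₀ (by fun_prop) (by simp)
    have hm : ball x0 (r/3) ∈ 𝓝 x0 := ball_mem_nhds _ (by linarith)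
    have e1 : ∀ᶠ c : ℝ in 𝓝 1, (c:ℂ) • x0 ∈ ball x0 (r/3) := h1 (by simpa using hm)
    have e2 : ∀ᶠ c : ℝ in 𝓝 1, ((c:ℂ)⁻¹) • x0 ∈ ball x0 (r/3) := h2 (by simpa using hm)
    have e3 : ∀ᶠ c : ℝ in 𝓝 1, 0 < c := lt_mem_nhds one_pos
    obtain ⟨c, ⟨⟨⟨h1, h2⟩, h3⟩, h4⟩⟩ := (((((e1.and e2).and e3).filter_mono nhdsWithin_le_nhds).and
      (self_mem_nhdsWithin : Iio (1:ℝ) ∈ 𝓝[<] 1)).exists)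
    exact ⟨c, h3, h4, h1, h2⟩
  have hcC : (c:ℂ) ≠ 0 := by exact_mod_cast hc0.ne'
  obtain ⟨x1, hx1⟩ : ∃ x1, x1 = ((c:ℂ)⁻¹) • x0 := ⟨_, rfl⟩
  obtain ⟨y1, hy1e⟩ : ∃ y1, y1 = (c:ℂ) • x0 := ⟨_, rfl⟩
  have hyx : ip x1 y1 = 1 := by
    rw [hx1, hy1e, ip_smul_left, ip_smul_right, hx00, Complex.conj_ofReal, mul_one, inv_mul_cancel₀ hcC]
  have hy1i : ∑ j, ‖y1 j‖^2 < 1 := by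
    have : ∑ j, ‖y1 j‖^2 = c^2 * ∑ j, ‖x0 j‖^2 := by
      simp only [hy1e, Pi.smul_apply, norm_smul, mul_pow, Finset.mul_sum, Complex.norm_real, Real.norm_eq_abs, sq_abs]
    rw [this, hsph]; nlinarith
  rw [← hx1] at hcb'
  rw [← hy1e] at hcb
  have hloc : ∀ᶠ y in 𝓝 y1, ∀ x, h x y = - h 0 y * (ip x y - 1) := by
    have hpc : ContinuousAt (fun y => ip x1 y) y1 :=
      (continuous_ip.comp (Continuous.prodMk continuous_const continuous_id)).continuousAt
    have hxc : ContinuousAt (fun y => (ip x1 y)⁻¹ • x1) y1 :=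
      ContinuousAt.fun_smul (hpc.inv₀ (by rw [hyx]; exact one_ne_zero)) continuousAt_const
    have e1 : ∀ᶠ y in 𝓝 y1, (ip x1 y)⁻¹ • x1 ∈ ball x0 (r/3) :=
      hxc (by simp only [hyx, inv_one, one_smul]; exact isOpen_ball.mem_nhds hcb')
    have e2 : ∀ᶠ y in 𝓝 y1, ip x1 y ≠ 0 := hpc.eventually_ne (by rw [hyx]; exact one_ne_zero)
    have e3 : ∀ᶠ y in 𝓝 y1, ∑ j, ‖y j‖^2 < 1 :=
      (isOpen_lt (f := fun y : Fin n → ℂ => ∑ j, ‖y j‖^2) (by fun_prop) continuous_const).mem_nhds hy1i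
    filter_upwards [e1, e2, e3, isOpen_ball.mem_nhds hcb] with y h1 h2 h3 h4 x
    set xy := (ip x1 y)⁻¹ • x1 with hxy
    have hxyy : ip xy y = 1 := by rw [hxy, ip_smul_left, inv_mul_cancel₀ h2]
    clear_value xy
    set lam : (Fin n → ℂ) → ℂ := fun w => ip (M w) (A y) + θ w * (starRingEnd ℂ) (A0 y) with hlam
    have hlsm : ∀ (s : ℂ) w, lam (s • w) = s * lam w := by
      intro s w
      simp only [hlam, map_smul, ip_smul_left, smul_eq_mul]; ring
    have hladd : ∀ w w', lam (w - w') = lam w - lam w' := by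
      intro w w'
      simp only [hlam, map_sub, ip_sub_left]; ring
    have hk : ∀ w, ip w y = 0 → lam w = 0 := by
      intro w hw
      have hcs : ContinuousAt (fun s : ℂ => xy + s • w) 0 := by fun_prop
      have e : ∀ᶠ s : ℂ in 𝓝 0, xy + s • w ∈ ball x0 (r/3) :=
        hcs (by simp only [zero_smul, add_zero]; exact isOpen_ball.mem_nhds h1)
      obtain ⟨s, hs, hs0⟩ := ((e.filter_mono nhdsWithin_le_nhds).and
        (self_mem_nhdsWithin : {(0:ℂ)}ᶜ ∈ 𝓝[≠] 0)).exists
      have z1 := hzero _ hs y h4 h3 (by rw [ip_add_left, ip_smul_left, hw, hxyy]; simp)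
      have z2 := hzero _ h1 y h4 h3 hxyy
      rw [hadd, z2, zero_add] at z1
      have z3 : s * lam w = 0 := by rw [← hlsm]; exact z1
      exact (mul_eq_zero.1 z3).resolve_left hs0
    have hl : ∀ w, lam w = ip w y * lam xy := by
      intro w
      have := hk (w - (ip w y) • xy) (by rw [ip_sub_left, ip_smul_left, hxyy]; ring)
      rw [hladd, hlsm] at this
      linear_combination this
    have z2 := hzero _ h1 y h4 h3 hxyy
    have z3 := hadd 0 xy y
    have z4 := hadd 0 x y
    rw [zero_add] at z3 z4
    rw [z2] at z3
    change 0 = h 0 y + lam xy at z3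
    change h x y = h 0 y + lam x at z4
    rw [z4, hl x]
    linear_combination (-ip x y) * z3
  have hAd : Differentiable ℂ A := by
    have : A = fun x => A 0 + M x := by funext x; simpa using hAM 0 x
    rw [this]; exact M.differentiable.const_add _
  have hA0d : Differentiable ℂ A0 := by
    have : A0 = fun x => A0 0 + (-θ) x := by funext x; simpa using hA0m 0 x
    rw [this]; exact (-θ).differentiable.const_add _
  have hhd : ∀ x, Differentiable ℂ fun y => h y x := by
    intro x
    simp only [hh]
    exact ((ipL (A x)).differentiable.comp hAd).sub (hA0d.mul_const _)
  have hglob : ∀ x y, h y x = - h y 0 * (ip y x - 1) := by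
    intro x y
    have hd : Differentiable ℂ fun y => h y x + h y 0 * (ip y x - 1) :=
      (hhd x).add ((hhd 0).mul ((ipL x).differentiable.sub_const 1))
    have := eqOn_zero_of_convex isOpen_univ convex_univ hd.differentiableOn (mem_univ y1) (by
      filter_upwards [hloc] with y hy
      have := congrArg (starRingEnd ℂ) (hy x)
      rw [hherm, map_mul, map_neg, hherm, map_sub _ (ip x y), map_one, ip_conj] at this
      rw [this]; ring) y (mem_univ y)
    linear_combination this
  have hconst : ∀ x, h 0 x = h 0 0 := by
    intro x
    have h1 := hglob x 0
    rw [ip_zero_left] at h1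
    linear_combination h1
  have hreal : (starRingEnd ℂ) (h 0 0) = h 0 0 := hherm 0 0
  obtain ⟨cc, hcc⟩ : ∃ cc : ℝ, h 0 0 = -(cc:ℂ) := by
    obtain ⟨t, ht⟩ := Complex.conj_eq_iff_real.1 hreal
    exact ⟨-t, by rw [ht]; simp⟩
  have hstar : ∀ x y, h x y = cc * (ip x y - 1) := by
    intro x y
    rw [hglob y x, ← hherm 0 x, hconst x, hreal, hcc]; ring
  have hA0y0 : A0 y0 = 1 := by simp [hA0]
  have hAy0 : A y0 = g0 := by simp [hA]
  have hg1 : ∑ j, ‖g0 j‖^2 < 1 := hI y0 (hrU hy0) hy1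
  have hccpos : 0 < cc := by
    have h1 := hstar y0 y0
    simp only [hh, hA0y0, hAy0, ip_self, map_one, mul_one] at h1
    have h2 : (∑ j, ‖g0 j‖^2) - 1 = cc * ((∑ j, ‖y0 j‖^2) - 1) := by exact_mod_cast h1
    by_contra hneg
    nlinarith
  refine ⟨A, A0, M, -θ, cc, r, hccpos, hr, fun x => by simpa using hAM 0 x, fun x => by simpa using hA0m 0 x,
    hstar, hAG, ?_⟩
  obtain ⟨e, he⟩ := (clm_bijective hdet).2 g0
  have hθe : θ e ≠ 1 := by
    intro h1
    have a1 : A (y0 + e) = g0 := by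
      simp only [hA, add_sub_cancel_left, h1, sub_self, zero_smul, zero_add]; exact he
    have a2 : A0 (y0 + e) = 0 := by simp only [hA0, add_sub_cancel_left, h1, sub_self]
    have s1 := hstar (y0 + e) (y0 + e)
    have s2 := hstar (y0 + e) y0
    have s3 := hstar y0 (y0 + e)
    have s4 := hstar y0 y0
    simp only [hh, a1, a2, hA0y0, hAy0, ip_add_left, ip_add_right, map_one, map_zero] at s1 s2 s3 s4
    have s5 : (cc:ℂ) * ip e e = -1 := by linear_combination -s1 + s2 + s3 - s4
    rw [ip_self] at s5
    have s6 : cc * ∑ j, ‖e j‖^2 = -1 := by exact_mod_cast s5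
    have s7 : 0 ≤ cc * ∑ j, ‖e j‖^2 := by positivity
    linarith
  have hne : 1 - θ e ≠ 0 := sub_ne_zero.2 hθe.symm
  set a := y0 + (-(1 - θ e)⁻¹) • e with ha
  have hAa : A a = 0 := by
    simp only [hA, ha, add_sub_cancel_left, map_smul, smul_eq_mul]
    rw [show D e = g0 from he, ← add_smul]
    rw [show (1 - -(1 - θ e)⁻¹ * θ e + -(1 - θ e)⁻¹) = 0 by field_simp; ring, zero_smul]
  have hA0a : A0 a ≠ 0 := by
    simp only [hA0, ha, add_sub_cancel_left, map_smul, smul_eq_mul]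
    rw [show (1 - -(1 - θ e)⁻¹ * θ e) = (1 - θ e)⁻¹ by field_simp; ring]
    exact inv_ne_zero hne
  refine ⟨a, ?_, hAa⟩
  have s := hstar a a
  simp only [hh, hAa, ip_zero_left, Complex.mul_conj'] at s
  rw [ip_self] at s
  have s' : 0 - ‖A0 a‖^2 = cc * ((∑ j, ‖a j‖^2) - 1) := by exact_mod_cast s
  have : 0 < ‖A0 a‖^2 := by
    have := norm_pos_iff.2 hA0a
    positivity
  by_contra hneg
  nlinarith

end SymEll

namespace SymEll
open Set Filter Topology MeasureTheory Metric
variable {n : ℕ}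

lemma order_lemma {u w : ℂ → ℂ} {β : ℂ} (hu : AnalyticAt ℂ u 0) (hnz : ¬ ∀ᶠ z in 𝓝 0, u z = 0)
    (hw : AnalyticAt ℂ w 0) (hw0 : w 0 = 0) (hw1 : deriv w 0 ≠ 0)
    (h : ∀ᶠ z in 𝓝[≠] (0:ℂ), w z * deriv u z = β * u z * deriv w z) : ∃ m : ℕ, β = m := by
  obtain ⟨m, g, hg, hg0, hgu⟩ := hu.exists_eventuallyEq_pow_smul_nonzero_iff.2 hnz
  refine ⟨m, ?_⟩
  simp only [sub_zero, smul_eq_mul] at hgu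
  have hgd := hg.differentiableAt
  have hder : ∀ᶠ z in 𝓝 (0:ℂ), z * deriv u z = z ^ m * (m * g z + z * deriv g z) := by
    filter_upwards [eventually_eventually_nhds.2 hgu, hg.eventually_analyticAt] with z hz hgz
    have e : deriv u z = deriv (fun z => z ^ m * g z) z := Filter.EventuallyEq.deriv_eq hz
    have e2 : HasDerivAt (fun z => z ^ m * g z) _ z :=
      (hasDerivAt_pow m z).mul hgz.differentiableAt.hasDerivAt
    rw [e, e2.deriv]
    rcases m with _ | m
    · simp
    · simp only [Nat.add_sub_cancel]; push_cast; ring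
  have hid : ∀ᶠ z in 𝓝 (0:ℂ), w z * (m * g z + z * deriv g z) = z * (β * g z * deriv w z) := by
    have h' := eventually_nhdsWithin_iff.1 h
    filter_upwards [h', hder, hgu] with z h1 h2 h3
    by_cases hz : z = 0
    · rw [hz, hw0]; simp
    · have h4 := h1 hz
      apply mul_left_cancel₀ (pow_ne_zero m hz)
      rw [h3] at h4
      linear_combination z * h4 - w z * h2
  have hL : HasDerivAt (fun z => w z * (m * g z + z * deriv g z))
      (deriv w 0 * (m * g 0 + 0 * deriv g 0) + w 0 * (m * deriv g 0 + (1 * deriv g 0 + 0 * deriv (deriv g) 0))) 0 :=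
    hw.differentiableAt.hasDerivAt.mul ((hgd.hasDerivAt.const_mul (m:ℂ)).add
      ((hasDerivAt_id (0:ℂ)).mul hg.deriv.differentiableAt.hasDerivAt))
  have hRd : DifferentiableAt ℂ (fun z => β * g z * deriv w z) 0 :=
    (hgd.const_mul β).mul hw.deriv.differentiableAt
  have hR : HasDerivAt (fun z => z * (β * g z * deriv w z))
      (1 * (β * g 0 * deriv w 0) + 0 * deriv (fun z => β * g z * deriv w z) 0) 0 :=
    (hasDerivAt_id (0:ℂ)).mul hRd.hasDerivAt
  have := (hL.congr_of_eventuallyEq (hid.mono fun z hz => hz.symm)).unique hR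
  rw [hw0] at this
  have h2 : (deriv w 0 * g 0) * ((m:ℂ) - β) = 0 := by linear_combination this
  exact (sub_eq_zero.1 ((mul_eq_zero.1 h2).resolve_left (mul_ne_zero hw1 hg0))).symm

/-- Coordinatewise exponential. -/
noncomputable def ex (ξ : Fin n → ℂ) : Fin n → ℂ := fun j => Complex.exp (ξ j)

/-- Coordinatewise exponential of `p ξ`. -/
noncomputable def Xp (p : ℝ) (ξ : Fin n → ℂ) : Fin n → ℂ := fun j => Complex.exp (p * ξ j)

/-- The tube domain over the ellipsoid. -/
def Om (p : ℝ) (n : ℕ) : Set (Fin n → ℂ) := {ξ | ∑ j, ‖Xp p ξ j‖ ^ 2 < 1}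

lemma norm_Xp (p : ℝ) (ξ : Fin n → ℂ) (j : Fin n) : ‖Xp p ξ j‖ ^ 2 = Real.exp (2 * p * (ξ j).re) := by
  rw [Xp, Complex.norm_exp, ← Real.exp_nat_mul]
  simp; ring_nf

lemma rho_ex (p : ℝ) (ξ : Fin n → ℂ) : rho p (ex ξ) = ∑ j, ‖Xp p ξ j‖ ^ 2 := by
  unfold rho
  refine Finset.sum_congr rfl fun j _ => ?_
  rw [norm_Xp, ex, Complex.norm_exp, ← Real.exp_mul]
  ring_nf

lemma differentiable_ex : Differentiable ℂ (ex (n := n)) := by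
  unfold ex; fun_prop

lemma differentiable_Xp (p : ℝ) : Differentiable ℂ (Xp (n := n) p) := by
  unfold Xp; fun_prop

lemma isOpen_Om (p : ℝ) : IsOpen (Om p n) := by
  have := (differentiable_Xp (n := n) p).continuous
  unfold Om
  apply isOpen_lt _ continuous_const
  fun_prop

lemma convex_Om (p : ℝ) : Convex ℝ (Om p n) := by
  have : ConvexOn ℝ Set.univ (fun ξ : Fin n → ℂ => ∑ j, Real.exp (2 * p * (ξ j).re)) := by
    refine ⟨convex_univ, fun x _ y _ a b ha hb hab => ?_⟩
    simp only [smul_eq_mul, Finset.mul_sum, ← Finset.sum_add_distrib]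
    apply Finset.sum_le_sum
    intro j _
    have := convexOn_exp.2 (mem_univ (2 * p * (x j).re)) (mem_univ (2 * p * (y j).re)) ha hb hab
    simp only [smul_eq_mul] at this
    refine le_trans (le_of_eq ?_) this
    congr 1
    simp; ring
  have h2 := this.convex_lt 1
  unfold Om
  simp only [norm_Xp]
  simpa using h2

lemma ex_mem {p : ℝ} {ξ : Fin n → ℂ} (h : ξ ∈ Om p n) : ex ξ ∈ ellipsoid p n := by
  rw [mem_ellipsoid, rho_ex]; exact h

lemma ex_log {z : Fin n → ℂ} (h : ∀ j, z j ≠ 0) : ex (fun j => Complex.log (z j)) = z := by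
  funext j; simp [ex, Complex.exp_log (h j)]

lemma log_mem {p : ℝ} {z : Fin n → ℂ} (hz : z ∈ ellipsoid p n) (h : ∀ j, z j ≠ 0) :
    (fun j => Complex.log (z j)) ∈ Om p n := by
  rw [mem_ellipsoid, ← ex_log h, rho_ex] at hz; exact hz

lemma Xp_log {p : ℝ} (hp : 0 < p) {x : Fin n → ℂ} (h : ∀ j, x j ≠ 0) :
    Xp p (fun j => Complex.log (x j) / p) = x := by
  have : (p:ℂ) ≠ 0 := by exact_mod_cast hp.ne'
  funext j; simp only [Xp]; rw [mul_div_cancel₀ _ this, Complex.exp_log (h j)]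

lemma ex_shift (ξ : Fin n → ℂ) (s : ℂ) : ex (ξ + s • (1 : Fin n → ℂ)) = Complex.exp s • ex ξ := by
  funext j; simp [ex, Complex.exp_add, mul_comm]

lemma Xp_shift (p : ℝ) (ξ : Fin n → ℂ) (s : ℂ) :
    Xp p (ξ + s • (1 : Fin n → ℂ)) = Complex.exp (p * s) • Xp p ξ := by
  funext j; simp [Xp, mul_add, Complex.exp_add, mul_comm]

lemma piMap_first (hn : 0 < n) (z : Fin n → ℂ) : piMap n z ⟨0, hn⟩ = ∑ j, z j := by
  simp [piMap, Finset.powersetCard_one]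

lemma piMap_last (hn : n - 1 < n) (z : Fin n → ℂ) : piMap n z ⟨n - 1, hn⟩ = ∏ j, z j := by
  have h : n - 1 + 1 = (Finset.univ : Finset (Fin n)).card := by simp; omega
  simp only [piMap]
  rw [h, Finset.powersetCard_self]; simp

/-- points with nonzero coordinates are dense -/
lemma eventually_coord_ne (z : Fin n → ℂ) : ∀ᶠ t : ℂ in 𝓝[≠] 0, ∀ j, (z + t • (1 : Fin n → ℂ)) j ≠ 0 := by
  rw [Filter.eventually_all]
  intro j
  by_cases hj : z j = 0
  · filter_upwards [self_mem_nhdsWithin] with t ht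
    simpa [hj] using ht
  · apply nhdsWithin_le_nhds
    have : ContinuousAt (fun t : ℂ => (z + t • (1 : Fin n → ℂ)) j) 0 := by
      simp only [Pi.add_apply, Pi.smul_apply]; fun_prop
    exact this.eventually_ne (by simpa using hj)

lemma tendsto_line (z v : Fin n → ℂ) : Tendsto (fun t : ℂ => z + t • v) (𝓝[≠] 0) (𝓝 z) := by
  have : ContinuousAt (fun t : ℂ => z + t • v) 0 := by fun_prop
  have h := this.tendsto
  simp only [zero_smul, add_zero] at h
  exact h.mono_left nhdsWithin_le_nhds

lemma exists_coord_ne_zero {p q : ℝ} (hp : 0 < p) {F : (Fin n → ℂ) → (Fin n → ℂ)}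
    (hF : IsProperHolomorphic F (ellipsoid p n) (symEllipsoid q n)) (k : Fin n) :
    ∃ z ∈ ellipsoid p n, (∀ j, z j ≠ 0) ∧ F z k ≠ 0 := by
  have hD := isOpen_ellipsoid (n := n) hp
  obtain ⟨z1, hz1, hd1⟩ := exists_det_ne_zero hD ⟨0, ell_zero hp⟩ hF.1 (fun w => by
    by_cases hw : w ∈ ellipsoid p n
    · left; exact hF.2.2 _ (by simpa using hF.2.1 hw) isCompact_singleton
    · right; exact hw)
  obtain ⟨z2, hz2, hk2⟩ : ∃ z ∈ ellipsoid p n, F z k ≠ 0 := by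
    by_contra hcon
    push Not at hcon
    obtain ⟨v, hv⟩ := (clm_bijective hd1).2 (Pi.single k 1)
    have h1 : HasFDerivAt F (fderiv ℂ F z1) z1 := (hF.1.differentiableAt (hD.mem_nhds hz1)).hasFDerivAt
    have h2 := hasFDerivAt_pi'.1 h1 k
    have h3 : HasFDerivAt (fun z => F z k) (0 : (Fin n → ℂ) →L[ℂ] ℂ) z1 := by
      apply (hasFDerivAt_const (0:ℂ) z1).congr_of_eventuallyEq
      filter_upwards [hD.mem_nhds hz1] with z hz using hcon z hz
    have h4 := DFunLike.congr_fun (h2.unique h3) v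
    simp [hv] at h4
  have hc : ContinuousAt (fun z => F z k) z2 :=
    (continuous_apply k).continuousAt.comp (hF.1.differentiableAt (hD.mem_nhds hz2)).continuousAt
  have e1 := (tendsto_line z2 1).eventually ((hc.eventually_ne hk2).and (hD.mem_nhds hz2))
  obtain ⟨t, ⟨h1, h2⟩, h3⟩ := (e1.and (eventually_coord_ne z2)).exists
  exact ⟨_, h2, h3, h1⟩

end SymEll

namespace SymEll
open Set Filter Topology MeasureTheory Metric
variable {n : ℕ}

/-- Case `a = 0`: Euler's identity for the first coordinate. -/
lemma case_zero (hn : 0 < n) {p q : ℝ} (hp : 0 < p) (hq : 0 < q) {F : (Fin n → ℂ) → (Fin n → ℂ)}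
    (hF : IsProperHolomorphic F (ellipsoid p n) (symEllipsoid q n))
    {M : (Fin n → ℂ) →L[ℂ] (Fin n → ℂ)} {k : ℂ} (hk : k ≠ 0) {O : Set (Fin n → ℂ)} (hO : IsOpen O)
    (hOne : O.Nonempty) (hOsub : O ⊆ Om p n) {ℓ : (Fin n → ℂ) → (Fin n → ℂ)} (hℓ : DifferentiableOn ℂ ℓ O)
    (h1 : ∀ ξ ∈ O, ∀ j, k * Complex.exp (q * ℓ ξ j) = M (Xp p ξ) j)
    (h2 : ∀ ξ ∈ O, F (ex ξ) = piMap n (fun j => Complex.exp (ℓ ξ j))) :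
    ∃ m : ℕ, p / q = m := by
  have hqC : (q:ℂ) ≠ 0 := by exact_mod_cast hq.ne'
  set i0 : Fin n := ⟨0, hn⟩ with hi0
  set f : (Fin n → ℂ) → ℂ := fun ξ => F (ex ξ) i0 with hf
  have hD := isOpen_ellipsoid (n := n) hp
  have hfd : DifferentiableOn ℂ f (Om p n) := by
    have := hF.1.comp differentiable_ex.differentiableOn (fun ξ hξ => ex_mem hξ)
    exact differentiableOn_pi.1 this i0
  have hfat : ∀ ξ ∈ Om p n, HasFDerivAt f (fderiv ℂ f ξ) ξ := fun ξ hξ =>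
    (hfd.differentiableAt ((isOpen_Om p).mem_nhds hξ)).hasFDerivAt
  have hline : ∀ (ξ : Fin n → ℂ) t, HasDerivAt (fun s : ℂ => ξ + s • (1 : Fin n → ℂ)) 1 t := fun ξ t => by
    simpa using ((hasDerivAt_id t).smul_const (1 : Fin n → ℂ)).const_add ξ
  have heul0 : ∀ ξ ∈ O, fderiv ℂ f ξ 1 - (p / q) * f ξ = 0 := by
    intro ξ hξ
    have hfl : HasDerivAt (fun s : ℂ => f (ξ + s • (1 : Fin n → ℂ))) (fderiv ℂ f ξ 1) 0 := by
      have hg : HasFDerivAt f (fderiv ℂ f ξ) (ξ + (0:ℂ) • (1 : Fin n → ℂ)) := by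
        simpa using hfat ξ (hOsub hξ)
      exact hg.comp_hasDerivAt (0:ℂ) (hline ξ 0)
    have hev : ∀ᶠ s : ℂ in 𝓝 0, ξ + s • (1 : Fin n → ℂ) ∈ O := by
      apply (hline ξ 0).continuousAt.eventually
      simp only [zero_smul, add_zero]
      exact hO.mem_nhds hξ
    have hℓd : HasDerivAt (fun s : ℂ => ℓ (ξ + s • (1 : Fin n → ℂ))) (fderiv ℂ ℓ ξ 1) 0 := by
      have hg : HasFDerivAt ℓ (fderiv ℂ ℓ ξ) (ξ + (0:ℂ) • (1 : Fin n → ℂ)) := by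
        simpa using (hℓ.differentiableAt (hO.mem_nhds hξ)).hasFDerivAt
      exact hg.comp_hasDerivAt (0:ℂ) (hline ξ 0)
    have hℓj := fun j => hasDerivAt_pi.1 hℓd j
    have hdj : ∀ j, fderiv ℂ ℓ ξ 1 j = p / q := by
      intro j
      have e1 : HasDerivAt (fun s : ℂ => k * Complex.exp (q * ℓ (ξ + s • (1 : Fin n → ℂ)) j))
          (k * (Complex.exp (q * ℓ (ξ + (0:ℂ) • (1 : Fin n → ℂ)) j) * (q * fderiv ℂ ℓ ξ 1 j))) 0 :=
        (((hℓj j).const_mul (q:ℂ)).cexp).const_mul k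
      have e2 : HasDerivAt (fun s : ℂ => k * Complex.exp (q * ℓ (ξ + s • (1 : Fin n → ℂ)) j))
          (Complex.exp (p * 0) * (p * 1) * M (Xp p ξ) j) 0 := by
        have e3 : HasDerivAt (fun s : ℂ => Complex.exp (p * s) * M (Xp p ξ) j)
            (Complex.exp (p * 0) * (p * 1) * M (Xp p ξ) j) 0 :=
          (((hasDerivAt_id (0:ℂ)).const_mul (p:ℂ)).cexp).mul_const _
        apply e3.congr_of_eventuallyEq
        filter_upwards [hev] with s hs
        rw [h1 _ hs, Xp_shift, map_smul]; simp
      have e4 := e1.unique e2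
      rw [← h1 ξ hξ j] at e4
      simp only [zero_smul, add_zero, mul_zero, Complex.exp_zero, one_mul, mul_one] at e4
      rw [eq_div_iff hqC]
      apply mul_left_cancel₀ (mul_ne_zero hk (Complex.exp_ne_zero (q * ℓ ξ j)))
      linear_combination e4
    have hfl2 : HasDerivAt (fun s : ℂ => f (ξ + s • (1 : Fin n → ℂ)))
        (∑ j, Complex.exp (ℓ (ξ + (0:ℂ) • (1 : Fin n → ℂ)) j) * fderiv ℂ ℓ ξ 1 j) 0 := by
      have e5 : HasDerivAt (fun s : ℂ => ∑ j, Complex.exp (ℓ (ξ + s • (1 : Fin n → ℂ)) j))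
          (∑ j, Complex.exp (ℓ (ξ + (0:ℂ) • (1 : Fin n → ℂ)) j) * fderiv ℂ ℓ ξ 1 j) 0 :=
        HasDerivAt.fun_sum fun j _ => (hℓj j).cexp
      apply e5.congr_of_eventuallyEq
      filter_upwards [hev] with s hs
      simp only [hf, h2 _ hs, hi0, piMap_first hn]
    have e6 := hfl.unique hfl2
    rw [e6]
    simp only [hf, h2 _ hξ, hi0, piMap_first hn, hdj, zero_smul, add_zero, ← Finset.sum_mul]
    ring
  obtain ⟨ξ1, hξ1⟩ := hOne
  have heul : ∀ ξ ∈ Om p n, fderiv ℂ f ξ 1 - (p / q) * f ξ = 0 := by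
    apply eqOn_zero_of_convex (isOpen_Om p) (convex_Om p) _ (hOsub hξ1)
    · filter_upwards [hO.mem_nhds hξ1] with ξ hξ using heul0 ξ hξ
    · exact (differentiableOn_fderiv_apply (isOpen_Om p) hfd 1).sub (hfd.const_mul _)
  obtain ⟨z, hz, hzj, hFz⟩ := exists_coord_ne_zero hp hF i0
  obtain ⟨R, hR1, hRz⟩ : ∃ R : ℝ, 1 < R ∧ (R:ℂ) • z ∈ ellipsoid p n := by
    have hc : ContinuousAt (fun R : ℝ => (R:ℂ) • z) 1 := by fun_prop
    have e : ∀ᶠ R : ℝ in 𝓝 1, (R:ℂ) • z ∈ ellipsoid p n :=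
      hc (by simp only [Complex.ofReal_one, one_smul]; exact hD.mem_nhds hz)
    obtain ⟨R, h1, h2⟩ := ((e.filter_mono nhdsWithin_le_nhds).and (self_mem_nhdsWithin : Ioi (1:ℝ) ∈ 𝓝[>] 1)).exists
    exact ⟨R, h2, h1⟩
  have hR0 : (R:ℂ) ≠ 0 := by exact_mod_cast (by linarith : R ≠ 0)
  set z2 := (R:ℂ) • z with hz2
  have hz2j : ∀ j, z2 j ≠ 0 := fun j => by
    simp only [hz2, Pi.smul_apply, smul_eq_mul]; exact mul_ne_zero hR0 (hzj j)
  set g : ℂ → ℂ := fun t => F (t • z2) i0 with hg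
  have hgD : ∀ t : ℂ, t ∈ ball (0:ℂ) 1 → t • z2 ∈ ellipsoid p n := fun t ht =>
    ell_bal hp t (by simpa using (mem_ball_zero_iff.1 ht).le) _ hRz
  have hgd : DifferentiableOn ℂ g (ball 0 1) := by
    have : DifferentiableOn ℂ (fun t : ℂ => F (t • z2)) (ball 0 1) :=
      hF.1.comp (f := fun t : ℂ => t • z2) (by fun_prop) hgD
    exact differentiableOn_pi.1 this i0
  have hgan := hgd.analyticOnNhd isOpen_ball
  have h0b : (0:ℂ) ∈ ball (0:ℂ) 1 := mem_ball_self one_pos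
  have hgnz : ¬ ∀ᶠ t in 𝓝 0, g t = 0 := by
    intro hcon
    have := eqOn_zero_of_convex isOpen_ball (convex_ball (0:ℂ) 1) hgd h0b hcon ((R:ℂ)⁻¹) (by
      rw [mem_ball_zero_iff, norm_inv, Complex.norm_real, Real.norm_eq_abs, abs_of_pos (by linarith)]
      exact inv_lt_one_of_one_lt₀ hR1)
    simp only [hg, hz2, smul_smul, inv_mul_cancel₀ hR0, one_smul] at this
    exact hFz this
  obtain ⟨m, hm⟩ := order_lemma (u := g) (w := fun t => t) (β := (p:ℂ) / q) (hgan 0 h0b) hgnz analyticAt_id rfl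
    (by simp) (by
      have e1 : ∀ᶠ t : ℂ in 𝓝[≠] 0, t ∈ ball (0:ℂ) 1 := nhdsWithin_le_nhds (isOpen_ball.mem_nhds h0b)
      filter_upwards [e1, self_mem_nhdsWithin] with t ht ht0
      have ht0' : t ≠ 0 := ht0
      set ξ : Fin n → ℂ := fun j => Complex.log (z2 j) with hξ
      have hexξ : ex ξ = z2 := ex_log hz2j
      set s := Complex.log t
      have hes : Complex.exp s = t := Complex.exp_log ht0'
      have hfg : ∀ s : ℂ, f (ξ + s • (1 : Fin n → ℂ)) = g (Complex.exp s) := by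
        intro s; simp only [hf, hg, ex_shift, hexξ]
      have hmem : ξ + s • (1 : Fin n → ℂ) ∈ Om p n := by
        have : ex (ξ + s • (1 : Fin n → ℂ)) ∈ ellipsoid p n := by
          rw [ex_shift, hexξ, hes]; exact hgD t ht
        rw [mem_ellipsoid, rho_ex] at this; exact this
      have d1 : HasDerivAt (fun s : ℂ => f (ξ + s • (1 : Fin n → ℂ))) (fderiv ℂ f (ξ + s • (1 : Fin n → ℂ)) 1) s :=
        HasFDerivAt.comp_hasDerivAt (l := f) (f := fun s : ℂ => ξ + s • (1 : Fin n → ℂ)) s (hfat _ hmem) (hline ξ s)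
      have d2 : HasDerivAt (fun s : ℂ => g (Complex.exp s)) (deriv g (Complex.exp s) * Complex.exp s) s := by
        have hgt : HasDerivAt g (deriv g (Complex.exp s)) (Complex.exp s) := by
          rw [hes]
          exact (hgd.differentiableAt (isOpen_ball.mem_nhds ht)).hasDerivAt
        exact hgt.comp s (Complex.hasDerivAt_exp s)
      have d3 : deriv g (Complex.exp s) * Complex.exp s = fderiv ℂ f (ξ + s • (1 : Fin n → ℂ)) 1 := by
        apply HasDerivAt.unique d2
        simpa only [hfg] using d1
      have d4 := heul _ hmem
      rw [hfg, ← d3, hes] at d4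
      simp only [deriv_id'', mul_one]
      linear_combination d4)
  refine ⟨m, ?_⟩
  exact_mod_cast hm

end SymEll

namespace SymEll
open Set Filter Topology MeasureTheory Metric
variable {n : ℕ}

lemma exists_dir {M : (Fin n → ℂ) →L[ℂ] (Fin n → ℂ)} (hM : Function.Surjective M) {a : Fin n → ℂ}
    {j : Fin n} (hj : M a j ≠ 0) :
    ∃ v, M v j = 0 ∧ (∀ i, i ≠ j → M v i ≠ 0) ∧ (∀ k, a k = 0 → v k ≠ 0) := by
  let P : Fin n → Module.Dual ℂ (Fin n → ℂ) := fun i => LinearMap.proj i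
  let f : {i // i ≠ j} ⊕ {k // a k = 0} → Module.Dual ℂ (Fin n → ℂ) :=
    Sum.elim (fun i => (P i.1).comp (M : (Fin n → ℂ) →ₗ[ℂ] (Fin n → ℂ))) (fun k => P k.1)
  obtain ⟨v, hv, hf⟩ := Module.Dual.exists_forall_mem_ne_zero_of_forall_exists
    (LinearMap.ker ((P j).comp (M : (Fin n → ℂ) →ₗ[ℂ] (Fin n → ℂ)))) f (by
      rintro (⟨i, hi⟩ | ⟨k, hk⟩)
      · obtain ⟨w, hw⟩ := hM (Pi.single i 1)
        refine ⟨w, ?_, ?_⟩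
        · simp [P, hw, Pi.single_apply, hi.symm]
        · simp [f, P, hw]
      · refine ⟨Pi.single k 1 - (M (Pi.single k 1) j / M a j) • a, ?_, ?_⟩
        · simp [P, map_sub, map_smul, hj]
        · simp [f, P, hk])
  refine ⟨v, ?_, ?_, ?_⟩
  · simpa [P] using hv
  · intro i hi
    simpa [f, P] using hf (Sum.inl ⟨i, hi⟩)
  · intro k hk
    simpa [f, P] using hf (Sum.inr ⟨k, hk⟩)

lemma hasDerivAt_Xp_line (p : ℝ) (ξ v : Fin n → ℂ) (t : ℂ) :
    HasDerivAt (fun s : ℂ => Xp p (ξ + s • v)) (fun j => Xp p (ξ + t • v) j * (p * v j)) t := by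
  rw [hasDerivAt_pi]
  intro j
  have h1 : HasDerivAt (fun s : ℂ => (p:ℂ) * (ξ j + s * v j)) (p * (1 * v j)) t :=
    ((((hasDerivAt_id t).mul_const (v j))).const_add (ξ j)).const_mul (p:ℂ)
  have h2 := h1.cexp
  simpa [Xp] using h2

/-- Case `a ≠ 0`, first step: `1/q` is an integer. -/
lemma inv_q_nat (hn : 0 < n) {p q : ℝ} (hp : 0 < p) (hq : 0 < q) {F : (Fin n → ℂ) → (Fin n → ℂ)}
    (hF : IsProperHolomorphic F (ellipsoid p n) (symEllipsoid q n))
    {A : (Fin n → ℂ) → (Fin n → ℂ)} {A0 : (Fin n → ℂ) → ℂ} {M : (Fin n → ℂ) →L[ℂ] (Fin n → ℂ)}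
    {m : (Fin n → ℂ) →L[ℂ] ℂ} (hA : ∀ x, A x = A 0 + M x) (hA0 : ∀ x, A0 x = A0 0 + m x)
    (hA0n : ∀ x : Fin n → ℂ, ∑ j, ‖x j‖^2 < 1 → A0 x ≠ 0)
    (hM : Function.Surjective M) {a : Fin n → ℂ} (ha1 : ∑ j, ‖a j‖^2 < 1) (hAa : A a = 0) (hA00 : A 0 ≠ 0)
    {O : Set (Fin n → ℂ)} (hO : IsOpen O)
    (hOne : O.Nonempty) (hOsub : O ⊆ Om p n) {ℓ : (Fin n → ℂ) → (Fin n → ℂ)} (hℓ : DifferentiableOn ℂ ℓ O)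
    (h1 : ∀ ξ ∈ O, ∀ j, A0 (Xp p ξ) * Complex.exp (q * ℓ ξ j) = A (Xp p ξ) j)
    (h2 : ∀ ξ ∈ O, F (ex ξ) = piMap n (fun j => Complex.exp (ℓ ξ j))) :
    ∃ b : ℕ, 1 / q = b := by
  have hqC : (q:ℂ) ≠ 0 := by exact_mod_cast hq.ne'
  have hpC : (p:ℂ) ≠ 0 := by exact_mod_cast hp.ne'
  have hn1 : n - 1 < n := by omega
  obtain ⟨j, hj⟩ : ∃ j, A 0 j ≠ 0 := by
    by_contra! h; exact hA00 (funext h)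
  have hMa : ∀ i, M a i = - A 0 i := fun i => by
    have := congrFun (hA a) i
    rw [hAa] at this
    simp only [Pi.zero_apply, Pi.add_apply] at this
    linear_combination -this
  obtain ⟨v, hv1, hv2, hv3⟩ := exists_dir hM (a := a) (j := j) (by rw [hMa]; simpa using hj)
  have hAv : ∀ (t : ℂ) i, A (a + t • v) i = t * M v i := fun t i => by
    rw [hA, Pi.add_apply, map_add, map_smul, Pi.add_apply, hMa]; simp
  -- the point `x`
  obtain ⟨x, hx1, hx2, hx3, hx4⟩ : ∃ x : Fin n → ℂ, ∑ j, ‖x j‖^2 < 1 ∧ (∀ k, x k ≠ 0) ∧ A x j = 0 ∧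
      ∀ i, i ≠ j → A x i ≠ 0 := by
    have e1 : ∀ᶠ t : ℂ in 𝓝[≠] 0, ∑ j, ‖(a + t • v) j‖^2 < 1 := by
      have hc : Continuous fun x : Fin n → ℂ => ∑ j, ‖x j‖^2 := by fun_prop
      exact (tendsto_line a v).eventually ((isOpen_lt hc continuous_const).mem_nhds ha1)
    have e2 : ∀ᶠ t : ℂ in 𝓝[≠] 0, ∀ k, (a + t • v) k ≠ 0 := by
      rw [Filter.eventually_all]
      intro k
      by_cases hk : a k = 0
      · filter_upwards [self_mem_nhdsWithin] with t ht
        simpa [hk] using ⟨ht, hv3 k hk⟩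
      · have := ((continuous_apply k).tendsto a).comp (tendsto_line a v)
        exact this.eventually_ne hk
    obtain ⟨t, ⟨ht1, ht2⟩, ht0⟩ := ((e1.and e2).and self_mem_nhdsWithin).exists
    refine ⟨a + t • v, ht1, ht2, by rw [hAv, hv1, mul_zero], fun i hi => ?_⟩
    rw [hAv]; exact mul_ne_zero ht0 (hv2 i hi)
  obtain ⟨ξs, hξs⟩ : ∃ ξ, ξ = fun j => Complex.log (x j) / p := ⟨_, rfl⟩
  have hXs : Xp p ξs = x := by rw [hξs]; exact Xp_log hp hx2
  have hξsO : ξs ∈ Om p n := by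
    show ∑ j, ‖Xp p ξs j‖ ^ 2 < 1
    rw [hXs]; exact hx1
  -- the direction
  obtain ⟨ξ1, hξ1, hdir⟩ : ∃ ξ1 ∈ O, M (fun k => x k * (p * (ξ1 - ξs) k)) j ≠ 0 := by
    obtain ⟨ξ1, hξ1⟩ := hOne
    by_cases hc : M (fun k => x k * (p * (ξ1 - ξs) k)) j ≠ 0
    · exact ⟨ξ1, hξ1, hc⟩
    push Not at hc
    obtain ⟨y, hy⟩ := hM (Pi.single j 1)
    obtain ⟨v0, hv0⟩ : ∃ v0 : Fin n → ℂ, v0 = fun k => y k / (x k * p) := ⟨_, rfl⟩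
    have e1 : ∀ᶠ t : ℂ in 𝓝[≠] 0, ξ1 + t • v0 ∈ O := (tendsto_line ξ1 v0).eventually (hO.mem_nhds hξ1)
    obtain ⟨t, ht1, ht0⟩ := (e1.and self_mem_nhdsWithin).exists
    refine ⟨_, ht1, ?_⟩
    have : (fun k => x k * (p * (ξ1 + t • v0 - ξs) k)) = (fun k => x k * (p * (ξ1 - ξs) k)) + t • y := by
      funext k
      have := hx2 k
      simp only [Pi.add_apply, Pi.sub_apply, Pi.smul_apply, smul_eq_mul, hv0]
      field_simp
      ring
    rw [this, map_add, map_smul, hy, Pi.add_apply, hc]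
    simpa using ht0
  obtain ⟨d, hd⟩ : ∃ d, d = ξ1 - ξs := ⟨_, rfl⟩
  rw [← hd] at hdir
  have hd1 : ξs + (1:ℂ) • d = ξ1 := by rw [hd]; simp
  obtain ⟨Λ, hΛ⟩ : ∃ Λ : Set ℂ, Λ = (fun s : ℂ => ξs + s • d) ⁻¹' Om p n := ⟨_, rfl⟩
  have hΛm : ∀ s, s ∈ Λ ↔ ξs + s • d ∈ Om p n := fun s => by rw [hΛ]; rfl
  have hcl : Continuous (fun s : ℂ => ξs + s • d) := by fun_prop
  have hΛo : IsOpen Λ := by rw [hΛ]; exact (isOpen_Om p).preimage hcl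
  have hΛc : Convex ℝ Λ := by
    intro s hs t ht α β hα hβ hαβ
    rw [hΛm] at hs ht ⊢
    have := convex_Om p hs ht hα hβ hαβ
    convert this using 1
    funext k
    have hab : (α:ℂ) + β = 1 := by exact_mod_cast hαβ
    simp only [Pi.add_apply, Pi.smul_apply, smul_eq_mul, Complex.real_smul]
    linear_combination -(ξs k) * hab
  have h0Λ : (0:ℂ) ∈ Λ := by rw [hΛm]; simpa using hξsO
  have h1Λ : (1:ℂ) ∈ Λ := by rw [hΛm, hd1]; exact hOsub hξ1
  obtain ⟨u, hu⟩ : ∃ u : ℂ → ℂ, u = fun s => F (ex (ξs + s • d)) ⟨n-1, hn1⟩ := ⟨_, rfl⟩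
  obtain ⟨w, hw⟩ : ∃ w : ℂ → ℂ, w = fun s => ∏ i, (A (Xp p (ξs + s • d)) i / A0 (Xp p (ξs + s • d))) := ⟨_, rfl⟩
  have hud : DifferentiableOn ℂ u Λ := by
    have e1 : DifferentiableOn ℂ (fun s : ℂ => F (ex (ξs + s • d))) Λ := by
      apply hF.1.comp (f := fun s : ℂ => ex (ξs + s • d))
      · exact (differentiable_ex.comp (f := fun s : ℂ => ξs + s • d) (by fun_prop)).differentiableOn
      · intro s hs; exact ex_mem ((hΛm s).1 hs)
    rw [hu]; exact differentiableOn_pi.1 e1 _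
  have hAd : Differentiable ℂ A := by
    have : A = fun x => A 0 + M x := funext hA
    rw [this]; fun_prop
  have hA0d : Differentiable ℂ A0 := by
    have : A0 = fun x => A0 0 + m x := funext hA0
    rw [this]; fun_prop
  have hXd : Differentiable ℂ (fun s : ℂ => Xp p (ξs + s • d)) := fun s => (hasDerivAt_Xp_line p ξs d s).differentiableAt
  have hAl : Differentiable ℂ (fun s : ℂ => A (Xp p (ξs + s • d))) := hAd.comp hXd
  have hA0l : Differentiable ℂ (fun s : ℂ => A0 (Xp p (ξs + s • d))) := hA0d.comp hXd
  have hA0Λ : ∀ s ∈ Λ, A0 (Xp p (ξs + s • d)) ≠ 0 := fun s hs => hA0n _ ((hΛm s).1 hs)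
  have hφd : ∀ i, DifferentiableOn ℂ (fun s : ℂ => A (Xp p (ξs + s • d)) i / A0 (Xp p (ξs + s • d))) Λ := fun i =>
    (differentiable_pi.1 hAl i).differentiableOn.fun_div hA0l.differentiableOn hA0Λ
  have hwd : DifferentiableOn ℂ w Λ := by
    rw [hw]; exact DifferentiableOn.fun_finset_prod fun i _ => hφd i
  have hudd : DifferentiableOn ℂ (deriv u) Λ := hud.deriv hΛo
  have hwdd : DifferentiableOn ℂ (deriv w) Λ := hwd.deriv hΛo
  have hℓ1 : ∀ᶠ s : ℂ in 𝓝 1, ξs + s • d ∈ O := by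
    apply hcl.continuousAt.eventually
    simp only [hd1]; exact hO.mem_nhds hξ1
  have hus : ∀ s, ξs + s • d ∈ O → u s = Complex.exp (∑ i, ℓ (ξs + s • d) i) := by
    intro s hs
    rw [hu]
    show F (ex (ξs + s • d)) ⟨n-1, hn1⟩ = _
    rw [h2 _ hs, piMap_last, Complex.exp_sum]
  have hws : ∀ s, ξs + s • d ∈ O → w s = Complex.exp (q * ∑ i, ℓ (ξs + s • d) i) := by
    intro s hs
    rw [hw, Finset.mul_sum, Complex.exp_sum]
    refine Finset.prod_congr rfl fun i _ => ?_
    rw [← h1 _ hs i, mul_div_cancel_left₀ _ (hA0n _ (hOsub hs))]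
  have hid : ∀ s ∈ Λ, q * (w s * deriv u s) - u s * deriv w s = 0 := by
    apply eqOn_zero_of_convex hΛo hΛc _ h1Λ
    · filter_upwards [hℓ1.eventually_nhds] with s hs
      have hsO := hs.self_of_nhds
      have hS : DifferentiableAt ℂ (fun s : ℂ => ∑ i, ℓ (ξs + s • d) i) s := by
        have e : DifferentiableAt ℂ (fun s : ℂ => ℓ (ξs + s • d)) s :=
          DifferentiableAt.comp (g := ℓ) (f := fun s : ℂ => ξs + s • d) s
            (hℓ.differentiableAt (hO.mem_nhds hsO)) (by fun_prop)
        exact DifferentiableAt.fun_sum fun i _ => differentiableAt_pi.1 e i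
      have e1 : deriv u s = Complex.exp (∑ i, ℓ (ξs + s • d) i) * deriv (fun s : ℂ => ∑ i, ℓ (ξs + s • d) i) s := by
        have : HasDerivAt u _ s := hS.hasDerivAt.cexp.congr_of_eventuallyEq (by
          filter_upwards [hs] with t ht using hus t ht)
        exact this.deriv
      have e2 : deriv w s = Complex.exp (q * ∑ i, ℓ (ξs + s • d) i) * (q * deriv (fun s : ℂ => ∑ i, ℓ (ξs + s • d) i) s) := by
        have : HasDerivAt w _ s := (hS.hasDerivAt.const_mul (q:ℂ)).cexp.congr_of_eventuallyEq (by
          filter_upwards [hs] with t ht using hws t ht)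
        exact this.deriv
      rw [e1, e2, hus s hsO, hws s hsO]
      ring
    · exact ((hwd.mul hudd).const_mul _).sub (hud.mul hwdd)
  have hlin0 : ξs + (0:ℂ) • d = ξs := by simp
  have hX0 : Xp p (ξs + (0:ℂ) • d) = x := by rw [hlin0, hXs]
  have hw00 : w 0 = 0 := by
    rw [hw]
    apply Finset.prod_eq_zero (Finset.mem_univ j)
    rw [hX0, hx3, zero_div]
  have hw1 : deriv w 0 ≠ 0 := by
    obtain ⟨h, hh⟩ : ∃ h : ℂ → ℂ, h = fun s => (A0 (Xp p (ξs + s • d)))⁻¹ *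
      ∏ i ∈ Finset.univ.erase j, (A (Xp p (ξs + s • d)) i / A0 (Xp p (ξs + s • d))) := ⟨_, rfl⟩
    have hwh : w = fun s => A (Xp p (ξs + s • d)) j * h s := by
      rw [hw, hh]
      funext s
      rw [← Finset.mul_prod_erase Finset.univ _ (Finset.mem_univ j)]
      ring
    have hhd : DifferentiableAt ℂ h 0 := by
      rw [hh]
      apply DifferentiableAt.fun_mul
      · exact (hA0l 0).fun_inv (hA0Λ 0 h0Λ)
      · exact DifferentiableAt.fun_finset_prod fun i _ => (hφd i).differentiableAt (hΛo.mem_nhds h0Λ)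
    have hAj : HasDerivAt (fun s : ℂ => A (Xp p (ξs + s • d)) j) (M (fun k => x k * (p * d k)) j) 0 := by
      have e1 := hasDerivAt_Xp_line p ξs d 0
      rw [hX0] at e1
      have e2 : HasDerivAt (fun s : ℂ => M (Xp p (ξs + s • d))) (M (fun k => x k * (p * d k))) 0 :=
        M.hasFDerivAt.comp_hasDerivAt (0:ℂ) e1
      have e3 := (hasDerivAt_pi.1 e2 j).const_add (A 0 j)
      refine e3.congr_of_eventuallyEq (Eventually.of_forall fun s => ?_)
      show A (Xp p (ξs + s • d)) j = A 0 j + M (Xp p (ξs + s • d)) j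
      rw [hA (Xp p (ξs + s • d))]; rfl
    have e4 := (hAj.fun_mul hhd.hasDerivAt).deriv
    rw [hwh, e4]
    simp only [hX0, hx3, zero_mul, add_zero]
    apply mul_ne_zero hdir
    rw [hh]
    simp only [hX0]
    apply mul_ne_zero (inv_ne_zero (hA0n x hx1))
    rw [Finset.prod_ne_zero_iff]
    intro i hi
    exact div_ne_zero (hx4 i (Finset.ne_of_mem_erase hi)) (hA0n x hx1)
  have hunz : ¬ ∀ᶠ z in 𝓝 0, u z = 0 := by
    intro hcon
    have := eqOn_zero_of_convex hΛo hΛc hud h0Λ hcon 1 h1Λ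
    rw [hus 1 (by rw [hd1]; exact hξ1)] at this
    exact Complex.exp_ne_zero _ this
  obtain ⟨b, hb⟩ := order_lemma (u := u) (w := w) (β := 1 / q) (hud.analyticOnNhd hΛo 0 h0Λ) hunz
    (hwd.analyticOnNhd hΛo 0 h0Λ) hw00 hw1 (by
      filter_upwards [nhdsWithin_le_nhds (hΛo.mem_nhds h0Λ)] with s hs
      have := hid s hs
      field_simp
      linear_combination this)
  refine ⟨b, ?_⟩
  exact_mod_cast hb

/-- Case `a ≠ 0`, second step: `p` is an integer. -/
lemma p_int {p q : ℝ} (hp : 0 < p) {F : (Fin n → ℂ) → (Fin n → ℂ)}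
    (hF : IsProperHolomorphic F (ellipsoid p n) (symEllipsoid q n))
    {A : (Fin n → ℂ) → (Fin n → ℂ)} {A0 : (Fin n → ℂ) → ℂ} {M : (Fin n → ℂ) →L[ℂ] (Fin n → ℂ)}
    {m : (Fin n → ℂ) →L[ℂ] ℂ} (hA : ∀ x, A x = A 0 + M x) (hA0 : ∀ x, A0 x = A0 0 + m x)
    (hA0n : ∀ x : Fin n → ℂ, ∑ j, ‖x j‖^2 < 1 → A0 x ≠ 0)
    {a : Fin n → ℂ} (ha1 : ∑ j, ‖a j‖^2 < 1) (hAa : A a = 0) (ha0 : a ≠ 0) (huniq : ∀ y, A y = 0 → y = a)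
    {O : Set (Fin n → ℂ)} (hO : IsOpen O)
    (hOne : O.Nonempty) (hOsub : O ⊆ Om p n) {ℓ : (Fin n → ℂ) → (Fin n → ℂ)}
    (h1 : ∀ ξ ∈ O, ∀ j, A0 (Xp p ξ) * Complex.exp (q * ℓ ξ j) = A (Xp p ξ) j)
    (h2 : ∀ ξ ∈ O, F (ex ξ) = piMap n (fun j => Complex.exp (ℓ ξ j))) {b : ℕ} (hqb : q * b = 1) :
    ∃ k : ℤ, p = k := by
  have hpC : (p:ℂ) ≠ 0 := by exact_mod_cast hp.ne'
  have hb0 : b ≠ 0 := by rintro rfl; simp at hqb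
  have hqbC : (q:ℂ) * b = 1 := by exact_mod_cast hqb
  have hAd : Differentiable ℂ A := by
    have : A = fun x => A 0 + M x := funext hA
    rw [this]; fun_prop
  have hA0d : Differentiable ℂ A0 := by
    have : A0 = fun x => A0 0 + m x := funext hA0
    rw [this]; fun_prop
  obtain ⟨φ, hφ⟩ : ∃ φ : (Fin n → ℂ) → (Fin n → ℂ), φ = fun x i => (A x i / A0 x) ^ b := ⟨_, rfl⟩
  have hBo : IsOpen {x : Fin n → ℂ | ∑ j, ‖x j‖^2 < 1} :=
    isOpen_lt (by fun_prop) continuous_const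
  have hφd : DifferentiableOn ℂ φ {x : Fin n → ℂ | ∑ j, ‖x j‖^2 < 1} := by
    rw [hφ, differentiableOn_pi]
    intro i
    have e1 : DifferentiableOn ℂ (fun x => A x i) {x : Fin n → ℂ | ∑ j, ‖x j‖^2 < 1} :=
      (differentiable_pi.1 hAd i).differentiableOn
    have e2 : DifferentiableOn ℂ (fun x => A x i / A0 x) {x : Fin n → ℂ | ∑ j, ‖x j‖^2 < 1} := by
      simp only [div_eq_mul_inv]
      exact e1.fun_mul (hA0d.differentiableOn.fun_inv hA0n)
    exact e2.fun_pow b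
  have hrep : ∀ ξ ∈ Om p n, F (ex ξ) - piMap n (φ (Xp p ξ)) = 0 := by
    obtain ⟨ξ1, hξ1⟩ := hOne
    apply eqOn_zero_of_convex (isOpen_Om p) (convex_Om p) _ (hOsub hξ1)
    · filter_upwards [hO.mem_nhds hξ1] with ξ hξ
      rw [h2 ξ hξ, sub_eq_zero]
      congr 1
      funext i
      rw [hφ]
      show _ = (A (Xp p ξ) i / A0 (Xp p ξ)) ^ b
      rw [← h1 _ hξ i, mul_div_cancel_left₀ _ (hA0n _ (hOsub hξ)), ← Complex.exp_nat_mul]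
      congr 1
      linear_combination -(ℓ ξ i) * hqbC
    · apply DifferentiableOn.fun_sub
      · exact hF.1.comp differentiable_ex.differentiableOn (fun ξ hξ => ex_mem hξ)
      · exact differentiable_piMap.comp_differentiableOn
          (hφd.comp (differentiable_Xp p).differentiableOn (fun ξ hξ => hξ))
  obtain ⟨r, hr⟩ : ∃ r : ℂ, r = Complex.exp (p * (2 * Real.pi * Complex.I)) := ⟨_, rfl⟩
  have hrn : ‖r‖ = 1 := by
    rw [hr, Complex.norm_exp]; simp
  have hrB : ∀ x : Fin n → ℂ, ∑ j, ‖(r • x) j‖^2 = ∑ j, ‖x j‖^2 := fun x => by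
    simp [hrn]
  have hsym : ∀ x : Fin n → ℂ, ∑ j, ‖x j‖^2 < 1 → (∀ j, x j ≠ 0) → piMap n (φ (r • x)) - piMap n (φ x) = 0 := by
    intro x hx hxj
    obtain ⟨ξ, hξ⟩ : ∃ ξ, ξ = fun j => Complex.log (x j) / p := ⟨_, rfl⟩
    have hX : Xp p ξ = x := by rw [hξ]; exact Xp_log hp hxj
    have hX' : Xp p (ξ + (2 * Real.pi * Complex.I) • (1 : Fin n → ℂ)) = r • x := by rw [Xp_shift, hX, hr]
    have hm : ξ ∈ Om p n := by
      show ∑ j, ‖Xp p ξ j‖ ^ 2 < 1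
      rw [hX]; exact hx
    have hm' : ξ + (2 * Real.pi * Complex.I) • (1 : Fin n → ℂ) ∈ Om p n := by
      show ∑ j, ‖Xp p _ j‖ ^ 2 < 1
      rw [hX', hrB]; exact hx
    have e1 := hrep _ hm
    have e2 := hrep _ hm'
    rw [hX] at e1
    rw [hX', ex_shift, Complex.exp_two_pi_mul_I, one_smul] at e2
    linear_combination (exp := 1) e1 - e2
  have hlim : piMap n (φ (r • a)) - piMap n (φ a) = 0 := by
    have hca : ContinuousAt φ a := (hφd.differentiableAt (hBo.mem_nhds ha1)).continuousAt
    have hra : r • a ∈ {x : Fin n → ℂ | ∑ j, ‖x j‖^2 < 1} := by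
      show ∑ j, ‖(r • a) j‖^2 < 1
      rw [hrB]; exact ha1
    have hcra : ContinuousAt φ (r • a) := (hφd.differentiableAt (hBo.mem_nhds hra)).continuousAt
    have hcr : ContinuousAt (fun x : Fin n → ℂ => φ (r • x)) a :=
      ContinuousAt.comp (g := φ) (f := fun x : Fin n → ℂ => r • x) hcra (by fun_prop)
    have hc : ContinuousAt (fun x => piMap n (φ (r • x)) - piMap n (φ x)) a :=
      (continuous_piMap.continuousAt.comp hcr).sub (continuous_piMap.continuousAt.comp hca)
    have ht := hc.tendsto.comp (tendsto_line a 1)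
    refine tendsto_nhds_unique ht (tendsto_const_nhds.congr' ?_)
    filter_upwards [eventually_coord_ne a, (tendsto_line a 1).eventually (hBo.mem_nhds ha1)] with t h1 h2
    exact (hsym _ h2 h1).symm
  have hφa : φ a = 0 := by
    rw [hφ]; funext i; simp [hAa, hb0]
  obtain ⟨σ, hσ⟩ := perm_of_piMap_eq (sub_eq_zero.1 hlim).symm
  have hφra : ∀ i, φ (r • a) i = 0 := fun i => by rw [hσ, hφa]; rfl
  have hA_ra : A (r • a) = 0 := by
    funext i
    have := hφra i
    rw [hφ] at this
    have h3 := (pow_eq_zero_iff hb0).1 this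
    rcases div_eq_zero_iff.1 h3 with h | h
    · exact h
    · exact absurd h (hA0n _ (by rw [hrB]; exact ha1))
  have hra := huniq _ hA_ra
  have hr1 : r = 1 := by
    obtain ⟨i, hi⟩ : ∃ i, a i ≠ 0 := by
      by_contra! h; exact ha0 (funext h)
    have := congrFun hra i
    simpa [hi] using this
  rw [hr, Complex.exp_eq_one_iff] at hr1
  obtain ⟨k, hk⟩ := hr1
  refine ⟨k, ?_⟩
  have := mul_right_cancel₀ Complex.two_pi_I_ne_zero hk
  exact_mod_cast this

lemma main_forward (hn : 2 ≤ n) {p q : ℝ} (hp : 0 < p) (hq : 0 < q) {F : (Fin n → ℂ) → (Fin n → ℂ)}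
    (hF : IsProperHolomorphic F (ellipsoid p n) (symEllipsoid q n)) : ∃ m : ℕ, p / q = m := by
  have hn0 : 0 < n := by omega
  obtain ⟨ξ0, U, G, U', ℓ, hU, hx0, hG, hinj, hsph, hI, hS, hU', hξ0, hℓ, hdat⟩ := local_data hn0 hp hq hF
  obtain ⟨A, A0, M, m, c, r, hc, hr, hA, hA0, hip, hAG, a, ha1, hAa⟩ := auto_form hn hU hx0 hG hinj hsph hI hS
  have hcC : (c:ℂ) ≠ 0 := by exact_mod_cast hc.ne'
  have hA0n : ∀ x : Fin n → ℂ, ∑ j, ‖x j‖^2 < 1 → A0 x ≠ 0 := by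
    intro x hx h0
    have h := hip x x
    rw [h0, ip_self, ip_self] at h
    simp only [zero_mul, sub_zero] at h
    have h' : ∑ j, ‖A x j‖^2 = c * (∑ j, ‖x j‖^2 - 1) := by exact_mod_cast h
    have : 0 ≤ ∑ j, ‖A x j‖^2 := Finset.sum_nonneg fun _ _ => by positivity
    nlinarith
  have hMm : ∀ x y, ip (M x) (M y) - m x * (starRingEnd ℂ) (m y) = c * ip x y := by
    intro x y
    have e1 := hip x y
    have e2 := hip x 0
    have e3 := hip 0 y
    have e4 := hip 0 0
    rw [hA x, hA y, hA0 x, hA0 y] at e1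
    rw [hA x, hA0 x] at e2
    rw [hA y, hA0 y] at e3
    simp only [ip_add_left, ip_add_right, map_add, ip_zero_left, ip_zero_right] at e1 e2 e3 e4
    linear_combination e1 - e2 - e3 + e4
  have hMinj : ∀ x, M x = 0 → x = 0 := by
    intro x hx
    have h := hMm x x
    rw [hx, ip_zero_left, ip_self, zero_sub, Complex.mul_conj, Complex.normSq_eq_norm_sq] at h
    have h' : -(‖m x‖^2) = c * ∑ j, ‖x j‖^2 := by exact_mod_cast h
    apply ip_self_eq_zero
    have h1 : 0 ≤ ∑ j, ‖x j‖^2 := Finset.sum_nonneg fun _ _ => by positivity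
    have h2 := sq_nonneg ‖m x‖
    nlinarith
  have hMsurj : Function.Surjective M := by
    have hi : Function.Injective (M : (Fin n → ℂ) →ₗ[ℂ] (Fin n → ℂ)) :=
      (injective_iff_map_eq_zero _).2 hMinj
    exact LinearMap.injective_iff_surjective.1 hi
  have huniq : ∀ y, A y = 0 → y = a := by
    intro y hy
    have h : M (y - a) = 0 := by
      have e1 := hA y
      have e2 := hA a
      rw [hy] at e1; rw [hAa] at e2
      rw [map_sub, sub_eq_zero]
      exact add_left_cancel (e1.symm.trans e2)
    exact sub_eq_zero.1 (hMinj _ h)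
  obtain ⟨O, hOdef⟩ : ∃ O : Set (Fin n → ℂ), O = (U' ∩ Om p n) ∩ Xp p ⁻¹' ball (Xp p ξ0) r := ⟨_, rfl⟩
  have hXc : Continuous (Xp (n := n) p) := (differentiable_Xp p).continuous
  have hO : IsOpen O := by
    rw [hOdef]; exact (hU'.inter (isOpen_Om p)).inter (isOpen_ball.preimage hXc)
  have hOsub : O ⊆ Om p n := by rw [hOdef]; exact fun ξ hξ => hξ.1.2
  have hOU : O ⊆ U' := by rw [hOdef]; exact fun ξ hξ => hξ.1.1
  have hOne : O.Nonempty := by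
    have hcs : ContinuousAt (fun s : ℝ => ξ0 + (s:ℂ) • (1 : Fin n → ℂ)) 0 := by fun_prop
    have e1 : ∀ᶠ s : ℝ in 𝓝 0, ξ0 + (s:ℂ) • (1 : Fin n → ℂ) ∈ U' ∩ Xp p ⁻¹' ball (Xp p ξ0) r := by
      apply hcs.eventually
      simp only [Complex.ofReal_zero, zero_smul, add_zero]
      exact (hU'.inter (isOpen_ball.preimage hXc)).mem_nhds ⟨hξ0, mem_ball_self hr⟩
    obtain ⟨s, hs1, hs2⟩ := ((e1.filter_mono nhdsWithin_le_nhds).and (self_mem_nhdsWithin : Iio (0:ℝ) ∈ 𝓝[<] 0)).exists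
    refine ⟨ξ0 + (s:ℂ) • (1 : Fin n → ℂ), ?_⟩
    rw [hOdef]
    refine ⟨⟨hs1.1, ?_⟩, hs1.2⟩
    show ∑ j, ‖Xp p (ξ0 + (s:ℂ) • (1 : Fin n → ℂ)) j‖ ^ 2 < 1
    have hps : p * s < 0 := mul_neg_of_pos_of_neg hp hs2
    have e2 : ∀ j, ‖Xp p (ξ0 + (s:ℂ) • (1 : Fin n → ℂ)) j‖ ^ 2 = (Real.exp (p * s))^2 * ‖Complex.exp (p * ξ0 j)‖^2 := by
      intro j
      rw [Xp_shift, Pi.smul_apply, smul_eq_mul, norm_mul, mul_pow, ← Complex.ofReal_mul, Complex.norm_exp_ofReal]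
      rfl
    simp only [e2]
    rw [← Finset.mul_sum, hsph, mul_one]
    exact pow_lt_one₀ (Real.exp_pos _).le (by rw [Real.exp_lt_one_iff]; exact hps) two_ne_zero
  have hℓO : DifferentiableOn ℂ ℓ O := hℓ.mono hOU
  have h1 : ∀ ξ ∈ O, ∀ j, A0 (Xp p ξ) * Complex.exp (q * ℓ ξ j) = A (Xp p ξ) j := by
    intro ξ hξ j
    rw [← (hdat ξ (hOU hξ)).2.1 j]
    have hb : Xp p ξ ∈ ball (Xp p ξ0) r := by rw [hOdef] at hξ; exact hξ.2
    exact congrFun (hAG _ hb) j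
  have h2 : ∀ ξ ∈ O, F (ex ξ) = piMap n (fun j => Complex.exp (ℓ ξ j)) := by
    intro ξ hξ
    apply (hdat ξ (hOU hξ)).2.2
    have := hOsub hξ
    rw [← mem_ellipsoid]; exact ex_mem this
  by_cases ha0 : a = 0
  · rw [ha0] at hAa
    have hk : ∀ x, A0 x * (starRingEnd ℂ) (A0 0) = c := by
      intro x
      have := hip x 0
      rw [hAa, ip_zero_right, ip_zero_right] at this
      linear_combination -this
    have hk0 : A0 0 ≠ 0 := by
      intro h; have := hk 0; rw [h, zero_mul] at this; exact hcC this.symm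
    have hconst : ∀ x, A0 x = A0 0 := fun x =>
      mul_right_cancel₀ ((map_ne_zero (starRingEnd ℂ)).2 hk0) ((hk x).trans (hk 0).symm)
    apply case_zero hn0 hp hq hF (M := M) hk0 hO hOne hOsub hℓO _ h2
    intro ξ hξ j
    have := h1 ξ hξ j
    rw [hconst, hA, hAa, zero_add] at this
    exact this
  · have hA00 : A 0 ≠ 0 := fun h => ha0 (huniq 0 h).symm
    obtain ⟨b, hb⟩ := inv_q_nat hn0 hp hq hF hA hA0 hA0n hMsurj ha1 hAa hA00 hO hOne hOsub hℓO h1 h2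
    have hqb : q * b = 1 := by rw [← hb]; field_simp
    obtain ⟨k, hk⟩ := p_int hp hF hA hA0 hA0n ha1 hAa ha0 huniq hO hOne hOsub h1 h2 hqb
    have hk0 : 0 ≤ k := by
      have : (0:ℝ) < k := hk ▸ hp
      exact_mod_cast this.le
    obtain ⟨k', rfl⟩ := Int.eq_ofNat_of_zero_le hk0
    refine ⟨k' * b, ?_⟩
    rw [div_eq_mul_one_div, hb, hk]; push_cast; rfl

end SymEll

/-- There exists a proper holomorphic mapping `f : 𝔼_{p,n} → 𝔼_{q,n}`
iff `p/q` is a positive integer. -/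
theorem exists_proper_holomorphic_iff (n : ℕ) (hn : 2 ≤ n) (p q : ℝ)
    (hp : 0 < p) (hq : 0 < q) :
    (∃ f : (Fin n → ℂ) → (Fin n → ℂ),
        IsProperHolomorphic f (symEllipsoid p n) (symEllipsoid q n)) ↔
      ∃ k : ℕ, 0 < k ∧ p / q = (k : ℝ) := by
  constructor
  · rintro ⟨f, hf⟩
    obtain ⟨m, hm⟩ := SymEll.main_forward hn hp hq (SymEll.proper_lift hf)
    refine ⟨m, ?_, hm⟩
    have h : 0 < p / q := div_pos hp hq
    rw [hm] at h
    exact_mod_cast h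
  · rintro ⟨k, hk, h⟩
    exact SymEll.reverse_direction p q hp hq k hk h
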